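/- Under the assumptions of Theorem 1.1 (positive cylindrical weak solution (u,v) of −Δ_ℍu = f(v), −Δ_ℍv = g(u) with f,g continuous, nondecreasing on (0,∞), and h(t)=f(t)/t^τ, k(t)=g(t)/t^τ nonincreasing on (0,∞), τ=(Q+2)/(Q−2)), for every fixed λ > 0 one has ū, v̄ ∈ L^{τ+1}(Σ_λ) ∩ L^∞(Σ_λ) and U_λ⁺, V_λ⁺ ∈ L^{τ+1}(Σ_λ) ∩ L^∞(Σ_λ) ∩ H¹(Σ_λ). Moreover there exists C_λ > 0, nonincreasing in λ, such that (∫_{Σ_λ}(U_λ⁺)^{2Q/(Q−2)}dξ)^{(Q−2)/(2Q)} ≤ C_λ (∫_{Σ_λ^v}|ξ|_ℍ^{−2Q}dξ)^{2/Q} (∫_{Σ_λ}(V_λ⁺)^{2Q/(Q−2)}dξ)^{(Q−2)/(2Q)} and (∫_{Σ_λ}(V_λ⁺)^{2Q/(Q−2)}dξ)^{(Q−2)/(2Q)} ≤ C_λ (∫_{Σ_λ^u}|ξ|_ℍ^{−2Q}dξ)^{2/Q} (∫_{Σ_λ}(U_λ⁺)^{2Q/(Q−2)}dξ)^{(Q−2)/(2Q)},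 where Σ_λ^v = {ξ ∈ Σ_λ∖{0_λ} : h(|ξ|_ℍ^{Q−2}v̄(ξ)) > 0 and V_λ(ξ) > 0} and Σ_λ^u = {ξ ∈ Σ_λ∖{0_λ} : k(|ξ|_ℍ^{Q−2}ū(ξ)) > 0 and U_λ(ξ) > 0}. -/

import Mathlib

open MeasureTheory Real Filter Set Topology

noncomputable section

namespace Heisenberg

/-- The underlying space of the Heisenberg group `ℍⁿ`, identified with `ℝⁿ × ℝⁿ × ℝ`
(equipped with Lebesgue measure, which is the Haar measure of `ℍⁿ`). -/
abbrev H (n : ℕ) : Type := (Fin n → ℝ) × (Fin n → ℝ) × ℝ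

variable {n : ℕ}

/-- `|x|² + |y|²` for `ξ = (x, y, t)`. -/
def rsq (ξ : H n) : ℝ := ∑ i, (ξ.1 i) ^ 2 + ∑ i, (ξ.2.1 i) ^ 2

/-- The Kaplan gauge `|ξ|_ℍ = ((|x|²+|y|²)² + t²)^{1/4}`. -/
def gaugeH (ξ : H n) : ℝ := ((rsq ξ) ^ 2 + (ξ.2.2) ^ 2) ^ ((4 : ℝ)⁻¹)

/-- The left-invariant vector field `Xᵢ = ∂_{xᵢ} + 2yᵢ∂_t` applied to `φ`. -/
def Xd (i : Fin n) (φ : H n → ℝ) (ξ : H n) : ℝ :=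
  fderiv ℝ φ ξ (Pi.single i 1, 0, 2 * ξ.2.1 i)

/-- The left-invariant vector field `Yᵢ = ∂_{yᵢ} − 2xᵢ∂_t` applied to `φ`. -/
def Yd (i : Fin n) (φ : H n → ℝ) (ξ : H n) : ℝ :=
  fderiv ℝ φ ξ (0, Pi.single i 1, -(2 * ξ.1 i))

/-- The horizontal gradient `∇_ℍ φ = (X₁φ,…,Xₙφ,Y₁φ,…,Yₙφ)` of a differentiable function. -/
def hGrad (φ : H n → ℝ) (ξ : H n) : (Fin n → ℝ) × (Fin n → ℝ) :=
  (fun i => Xd i φ ξ, fun i => Yd i φ ξ)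

/-- Euclidean pairing of two horizontal vectors. -/
def hdot (a b : (Fin n → ℝ) × (Fin n → ℝ)) : ℝ :=
  ∑ i, a.1 i * b.1 i + ∑ i, a.2 i * b.2 i

/-- The (pointwise, classical) sub-Laplacian `Δ_ℍ = ∑ᵢ (Xᵢ² + Yᵢ²)`. -/
def subLap (u : H n → ℝ) (ξ : H n) : ℝ :=
  ∑ i, Xd i (Xd i u) ξ + ∑ i, Yd i (Yd i u) ξ

/-- `φ ∈ C¹_c(Ω)`. -/
structure IsTest (Ω : Set (H n)) (φ : H n → ℝ) : Prop where
  contDiff : ContDiff ℝ 1 φ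
  compactSupport : HasCompactSupport φ
  supportSubset : tsupport φ ⊆ Ω

/-- `G` is a weak horizontal gradient of `u` on `Ω`, with `u` locally integrable on `Ω`
and `G` locally square-integrable on `Ω` (i.e. `u ∈ H¹_loc(Ω)` with horizontal gradient `G`). -/
structure IsWeakHGrad (Ω : Set (H n)) (u : H n → ℝ)
    (G : H n → (Fin n → ℝ) × (Fin n → ℝ)) : Prop where
  locInt : LocallyIntegrableOn u Ω
  locSq : ∀ K : Set (H n), K ⊆ Ω → IsCompact K → IntegrableOn (fun ξ => ‖G ξ‖ ^ 2) K
  ibpX : ∀ i : Fin n, ∀ φ : H n → ℝ, IsTest Ω φ →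
    ∫ ξ, u ξ * Xd i φ ξ = -∫ ξ, (G ξ).1 i * φ ξ
  ibpY : ∀ i : Fin n, ∀ φ : H n → ℝ, IsTest Ω φ →
    ∫ ξ, u ξ * Yd i φ ξ = -∫ ξ, (G ξ).2 i * φ ξ

/-- `u ∈ H¹_loc(Ω)` is a weak solution of `−Δ_ℍ u = F` on `Ω`:
`∫ ∇_ℍu · ∇_ℍφ = ∫ F φ` for all `φ ∈ C¹_c(Ω)`. -/
def IsWeakSol (Ω : Set (H n)) (u F : H n → ℝ) : Prop :=
  ∃ G : H n → (Fin n → ℝ) × (Fin n → ℝ), IsWeakHGrad Ω u G ∧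
    ∀ φ : H n → ℝ, IsTest Ω φ → ∫ ξ, hdot (G ξ) (hGrad φ ξ) = ∫ ξ, F ξ * φ ξ

/-- A function on `ℍⁿ` is cylindrical if it depends only on `r = √(|x|²+|y|²)` and `t`. -/
def IsCylindrical (u : H n → ℝ) : Prop :=
  ∀ ξ ξ' : H n, rsq ξ = rsq ξ' → ξ.2.2 = ξ'.2.2 → u ξ = u ξ'

/-- The CR-inverted point `ξ̃`. -/
def tilde (ξ : H n) : H n :=
  (fun i => (ξ.1 i * ξ.2.2 + ξ.2.1 i * rsq ξ) / gaugeH ξ ^ 4,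
   fun i => (ξ.2.1 i * ξ.2.2 - ξ.1 i * rsq ξ) / gaugeH ξ ^ 4,
   -ξ.2.2 / gaugeH ξ ^ 4)

/-- The CR inversion `ū(ξ) = |ξ|_ℍ^{−(Q−2)} u(ξ̃)`, where `Q − 2 = 2n`. -/
def crInv (u : H n → ℝ) (ξ : H n) : ℝ := u (tilde ξ) / gaugeH ξ ^ (2 * n)

/-- The critical exponent `τ = (Q+2)/(Q−2)` with `Q = 2n+2`. -/
def tau (n : ℕ) : ℝ := (2 * (n : ℝ) + 4) / (2 * (n : ℝ))

/-- The half space `Σ_λ = {ξ = (x,y,t) : t > λ}`. -/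
def Sig (l : ℝ) : Set (H n) := {ξ | l < ξ.2.2}

/-- The H-reflection `ξ_λ = (y, x, 2λ − t)` with respect to the plane `T_λ = {t = λ}`. -/
def hRefl (l : ℝ) (ξ : H n) : H n := (ξ.2.1, ξ.1, 2 * l - ξ.2.2)

/-- The point `0_λ = (0, 0, 2λ)`. -/
def zl (l : ℝ) : H n := (0, 0, 2 * l)

/-- `U_λ = ū − ū_λ`, where `ū` is the CR inversion of `u` and `ū_λ(ξ) = ū(ξ_λ)`. -/
def Ulam (u : H n → ℝ) (l : ℝ) (ξ : H n) : ℝ := crInv u ξ - crInv u (hRefl l ξ)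

/-- `w ∈ L^{τ+1}(Σ_λ) ∩ L^∞(Σ_λ)`. -/
def MemLtau1Linf (l : ℝ) (w : H n → ℝ) : Prop :=
  IntegrableOn (fun ξ => |w ξ| ^ (tau n + 1)) (Sig l) ∧
    ∃ M : ℝ, ∀ ξ ∈ Sig (n := n) l, |w ξ| ≤ M

/-- `w ∈ H¹(Ω)`: square integrable on `Ω`, with a weak horizontal gradient which is
square integrable on `Ω`. -/
def MemH1 (Ω : Set (H n)) (w : H n → ℝ) : Prop :=
  IntegrableOn (fun ξ => (w ξ) ^ 2) Ω ∧
  ∃ G : H n → (Fin n → ℝ) × (Fin n → ℝ),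
    IntegrableOn (fun ξ => ‖G ξ‖ ^ 2) Ω ∧
    (∀ i : Fin n, ∀ φ : H n → ℝ, IsTest Ω φ →
      ∫ ξ, w ξ * Xd i φ ξ = -∫ ξ, (G ξ).1 i * φ ξ) ∧
    (∀ i : Fin n, ∀ φ : H n → ℝ, IsTest Ω φ →
      ∫ ξ, w ξ * Yd i φ ξ = -∫ ξ, (G ξ).2 i * φ ξ)

end Heisenberg

namespace Heisenberg
open scoped Pointwise

/-- projection to the half plane coordinates `(s,t)`. -/
def piH {n : ℕ} (ξ : H n) : ℝ × ℝ := (rsq ξ, ξ.2.2)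

def rsq2 {n : ℕ} (p : (Fin n → ℝ) × (Fin n → ℝ)) : ℝ := ∑ i, (p.1 i) ^ 2 + ∑ i, (p.2 i) ^ 2

def radM (n : ℕ) : Measure ℝ :=
  (volume.restrict (Ioi 0)).withDensity (fun s => ENNReal.ofReal (s ^ (n - 1)))

lemma continuous_rsq2 {n : ℕ} : Continuous (rsq2 (n := n)) := by unfold rsq2; fun_prop
lemma continuous_rsq {n : ℕ} : Continuous (rsq (n := n)) := by unfold rsq; fun_prop
lemma continuous_piH {n : ℕ} : Continuous (piH (n := n)) := by
  unfold piH; exact continuous_rsq.prodMk (by fun_prop)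
lemma rsq_nonneg {n : ℕ} (ξ : H n) : 0 ≤ rsq ξ := by
  unfold rsq; positivity

lemma rsq2_nonneg {n : ℕ} (p : (Fin n → ℝ) × (Fin n → ℝ)) : 0 ≤ rsq2 p := by
  unfold rsq2; positivity

lemma vol_rsq2_lt {n : ℕ} (s : ℝ) (hs : 0 < s) :
    (volume : Measure ((Fin n → ℝ) × (Fin n → ℝ))) {p | rsq2 p < s} =
      ENNReal.ofReal (s ^ n) * volume {p : (Fin n → ℝ) × (Fin n → ℝ) | rsq2 p < 1} := by
  have h1 : {p : (Fin n → ℝ) × (Fin n → ℝ) | rsq2 p < s} = (√s) • {p | rsq2 p < 1} := by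
    ext p
    have hs' : √s ≠ 0 := by positivity
    rw [Set.mem_smul_set_iff_inv_smul_mem₀ hs']
    have : rsq2 ((√s)⁻¹ • p) = s⁻¹ * rsq2 p := by
      simp only [rsq2, Prod.smul_fst, Prod.smul_snd, Pi.smul_apply, smul_eq_mul, mul_pow, inv_pow,
        Real.sq_sqrt hs.le, ← Finset.mul_sum, mul_add]
    simp only [mem_ofPred_eq, this]
    rw [inv_mul_lt_iff₀ hs, mul_one]
  haveI : (volume : Measure ((Fin n → ℝ) × (Fin n → ℝ))).IsAddHaarMeasure :=
    Measure.prod.instIsAddHaarMeasure _ _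
  rw [h1, Measure.addHaar_smul]
  congr 2
  have : Module.finrank ℝ ((Fin n → ℝ) × (Fin n → ℝ)) = 2 * n := by
    simp [two_mul]
  rw [this, pow_mul, Real.sq_sqrt hs.le, abs_of_nonneg (by positivity)]

lemma radM_Iio {n : ℕ} (hn : 1 ≤ n) (s : ℝ) (hs : 0 < s) :
    radM n (Iio s) = ENNReal.ofReal (s ^ n / n) := by
  unfold radM
  rw [withDensity_apply _ measurableSet_Iio, Measure.restrict_restrict measurableSet_Iio]
  have : Iio s ∩ Ioi 0 = Ioo 0 s := by ext; simp [and_comm]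
  rw [this, ← ofReal_integral_eq_lintegral_ofReal]
  · rw [← integral_Ioc_eq_integral_Ioo, ← intervalIntegral.integral_of_le hs.le, integral_pow]
    congr 1
    have : n - 1 + 1 = n := by omega
    rw [this]
    have : ((n - 1 : ℕ) : ℝ) + 1 = n := by
      rw [← Nat.cast_succ]; congr 1
    rw [this, zero_pow (by omega), sub_zero]
  · exact (Continuous.integrableOn_Icc (by fun_prop)).mono_set Ioo_subset_Icc_self
  · filter_upwards [ae_restrict_mem measurableSet_Ioo] with x hx
    exact pow_nonneg hx.1.le _

lemma radM_neg {n : ℕ} (s : ℝ) (hs : s ≤ 0) :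
    radM n (Iio s) = 0 := by
  unfold radM
  rw [withDensity_apply _ measurableSet_Iio, Measure.restrict_restrict measurableSet_Iio]
  have : Iio s ∩ Ioi 0 = ∅ := by ext x; simp; intro h; linarith
  simp [this]

lemma vol_rsq2_one {n : ℕ} : ∃ c : ℝ, 0 < c ∧
    (volume : Measure ((Fin n → ℝ) × (Fin n → ℝ))) {p | rsq2 p < 1} = ENNReal.ofReal c := by
  have hop : IsOpen {p : (Fin n → ℝ) × (Fin n → ℝ) | rsq2 p < 1} :=
    isOpen_lt continuous_rsq2 continuous_const
  have hpos : 0 < (volume : Measure ((Fin n → ℝ) × (Fin n → ℝ))) {p | rsq2 p < 1} :=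
    hop.measure_pos _ ⟨0, by simp [rsq2]⟩
  have hfin : (volume : Measure ((Fin n → ℝ) × (Fin n → ℝ))) {p | rsq2 p < 1} < ⊤ := by
    refine lt_of_le_of_lt (measure_mono (t := Metric.closedBall 0 1) ?_) measure_closedBall_lt_top
    intro p hp
    simp only [mem_ofPred_eq, rsq2] at hp
    rw [mem_closedBall_zero_iff, Prod.norm_def]
    have key : ∀ (q q' : Fin n → ℝ), ∑ i, q i ^ 2 + ∑ i, q' i ^ 2 < 1 → ‖q‖ ≤ 1 := by
      intro q q' h
      rw [pi_norm_le_iff_of_nonneg zero_le_one]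
      intro i
      have h1 : q i ^ 2 ≤ ∑ i, q i ^ 2 :=
        Finset.single_le_sum (f := fun i => q i ^ 2) (fun i _ => sq_nonneg _) (Finset.mem_univ i)
      have h2 : 0 ≤ ∑ i, q' i ^ 2 := Finset.sum_nonneg fun i _ => sq_nonneg _
      rw [Real.norm_eq_abs, abs_le_one_iff_mul_self_le_one]
      nlinarith
    exact max_le (key _ _ hp) (key _ _ (by rw [add_comm]; exact hp))
  exact ⟨_, ENNReal.toReal_pos hpos.ne' hfin.ne, (ENNReal.ofReal_toReal hfin.ne).symm⟩

lemma map_rsq2 {n : ℕ} (hn : 1 ≤ n) : ∃ c : ℝ, 0 < c ∧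
    Measure.map (rsq2 (n := n)) volume = ENNReal.ofReal c • radM n := by
  obtain ⟨c, hc, hV⟩ := vol_rsq2_one (n := n)
  have hnn : (0 : ℝ) < n := by exact_mod_cast hn
  refine ⟨n * c, by positivity, ?_⟩
  have hIio : ∀ s : ℝ, Measure.map (rsq2 (n := n)) volume (Iio s) =
      (ENNReal.ofReal (n * c) • radM n) (Iio s) := by
    intro s
    rw [Measure.map_apply continuous_rsq2.measurable measurableSet_Iio]
    rw [Measure.smul_apply, smul_eq_mul]
    rcases le_or_gt s 0 with hs | hs
    · rw [radM_neg s hs]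
      have : rsq2 (n := n) ⁻¹' (Iio s) = ∅ := by
        ext p; simp only [mem_preimage, mem_Iio, mem_empty_iff_false, iff_false, not_lt]
        exact hs.trans (rsq2_nonneg p)
      simp [this]
    · rw [radM_Iio hn s hs]
      change volume {p | rsq2 p < s} = _
      rw [vol_rsq2_lt s hs, hV, ← ENNReal.ofReal_mul (by positivity), ← ENNReal.ofReal_mul (by positivity)]
      congr 1
      field_simp
  have hfin : ∀ s : ℝ, (ENNReal.ofReal (n * c) • radM n) (Iio s) ≠ ⊤ := by
    intro s
    rw [Measure.smul_apply, smul_eq_mul]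
    rcases le_or_gt s 0 with hs | hs
    · rw [radM_neg s hs]; simp
    · rw [radM_Iio hn s hs]; exact ENNReal.mul_ne_top ENNReal.ofReal_ne_top ENNReal.ofReal_ne_top
  refine Measure.ext_of_Ico' _ _ ?_ ?_
  · intro a b _
    refine ne_top_of_le_ne_top ?_ (measure_mono (t := Iio b) (fun x hx => hx.2))
    rw [hIio]; exact hfin b
  · intro a b hab
    have : Ico a b = Iio b \ Iio a := by ext x; simp [and_comm]
    rw [this, measure_sdiff (Iio_subset_Iio hab.le) measurableSet_Iio.nullMeasurableSet,
      measure_sdiff (Iio_subset_Iio hab.le) measurableSet_Iio.nullMeasurableSet, hIio, hIio]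
    · exact hfin a
    · rw [hIio]; exact hfin a

instance {n : ℕ} : SFinite (radM n) := by unfold radM; infer_instance

lemma map_piH {n : ℕ} (hn : 1 ≤ n) : ∃ c : ℝ, 0 < c ∧
    Measure.map (piH (n := n)) volume = ENNReal.ofReal c • ((radM n).prod volume) := by
  obtain ⟨c, hc, h⟩ := map_rsq2 hn
  refine ⟨c, hc, ?_⟩
  have h1 : (piH (n := n)) = (Prod.map rsq2 id) ∘ (MeasurableEquiv.prodAssoc).symm := by
    ext ξ <;> rfl
  have h2 : Measure.map (MeasurableEquiv.prodAssoc (α := Fin n → ℝ) (β := Fin n → ℝ) (γ := ℝ)).symm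
      volume = (volume : Measure ((Fin n → ℝ) × (Fin n → ℝ))).prod volume :=
    ((measurePreserving_prodAssoc volume volume volume).symm).map_eq
  rw [h1, ← Measure.map_map (by exact (continuous_rsq2.measurable.prodMap measurable_id))
    (MeasurableEquiv.measurable _), h2, ← Measure.map_prod_map _ _ continuous_rsq2.measurable measurable_id,
    h, Measure.map_id, Measure.prod_smul_left]

/-- lintegral in half-plane coordinates -/
lemma lintegral_piH {n : ℕ} (hn : 1 ≤ n) : ∃ c : ℝ, 0 < c ∧
    (∀ F : ℝ × ℝ → ENNReal, Measurable F → ∫⁻ ξ : H n, F (piH ξ) =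
      ENNReal.ofReal c * ∫⁻ z in Ioi (0:ℝ) ×ˢ univ, ENNReal.ofReal (z.1 ^ (n - 1)) * F z) ∧
    (∀ F : ℝ × ℝ → ℝ, Measurable F → ∫ ξ : H n, F (piH ξ) =
      c * ∫ z in Ioi (0:ℝ) ×ˢ univ, z.1 ^ (n - 1) * F z) := by
  obtain ⟨c, hc, h⟩ := map_piH hn
  have hm : (radM n).prod volume = (volume.restrict (Ioi (0:ℝ) ×ˢ (univ : Set ℝ))).withDensity
      (fun z => ENNReal.ofReal (z.1 ^ (n - 1))) := by
    unfold radM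
    rw [← Measure.restrict_univ (μ := (volume : Measure ℝ)), prod_withDensity_left (by fun_prop), Measure.prod_restrict,
      Measure.restrict_univ]
    rfl
  refine ⟨c, hc, ?_, ?_⟩
  · intro F hF
    rw [← lintegral_map hF continuous_piH.measurable, h, lintegral_smul_measure, hm,
      lintegral_withDensity_eq_lintegral_mul _ (by fun_prop) hF]
    rfl
  · intro F hF
    rw [← integral_map continuous_piH.measurable.aemeasurable hF.aestronglyMeasurable, h,
      integral_smul_measure, hm, integral_withDensity_eq_integral_toReal_smul (by fun_prop)
      (by simp), ENNReal.toReal_ofReal hc.le, smul_eq_mul]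
    congr 1
    refine setIntegral_congr_fun (measurableSet_Ioi.prod MeasurableSet.univ) ?_
    intro z hz
    simp only [smul_eq_mul]
    rw [ENNReal.toReal_ofReal (pow_nonneg (le_of_lt hz.1) _)]

end Heisenberg

namespace Heisenberg

/-- the frame of horizontal directions -/
def dirv {n : ℕ} (k : Fin n ⊕ Fin n) (ξ : H n) : H n :=
  match k with
  | .inl i => (Pi.single i 1, 0, 2 * ξ.2.1 i)
  | .inr i => (0, Pi.single i 1, -(2 * ξ.1 i))

def Dk {n : ℕ} (k : Fin n ⊕ Fin n) (φ : H n → ℝ) (ξ : H n) : ℝ := fderiv ℝ φ ξ (dirv k ξ)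

def ck {n : ℕ} (k : Fin n ⊕ Fin n) (g : (Fin n → ℝ) × (Fin n → ℝ)) : ℝ :=
  match k with
  | .inl i => g.1 i
  | .inr i => g.2 i

/-- the coordinate function associated with the index k -/
def xk {n : ℕ} (k : Fin n ⊕ Fin n) (ξ : H n) : ℝ :=
  match k with
  | .inl i => ξ.1 i
  | .inr i => ξ.2.1 i

/-- derivative of t in direction k, divided by 2 -/
def yk {n : ℕ} (k : Fin n ⊕ Fin n) (ξ : H n) : ℝ :=
  match k with
  | .inl i => ξ.2.1 i
  | .inr i => - ξ.1 i

lemma contDiff_dirv {n : ℕ} (k : Fin n ⊕ Fin n) : ContDiff ℝ ⊤ (dirv k) := by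
  rcases k with i | i <;> (unfold dirv; simp only; fun_prop)

lemma contDiff_xk {n : ℕ} (k : Fin n ⊕ Fin n) : ContDiff ℝ ⊤ (xk k) := by
  rcases k with i | i <;> (unfold xk; simp only; fun_prop)
lemma contDiff_yk {n : ℕ} (k : Fin n ⊕ Fin n) : ContDiff ℝ ⊤ (yk k) := by
  rcases k with i | i <;> (unfold yk; simp only; fun_prop)
lemma contDiff_rsq {n : ℕ} : ContDiff ℝ ⊤ (rsq (n := n)) := by
  unfold rsq; fun_prop

lemma hdot_eq {n : ℕ} (g : (Fin n → ℝ) × (Fin n → ℝ)) (φ : H n → ℝ) (ξ : H n) :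
    hdot g (hGrad φ ξ) = ∑ k, ck k g * Dk k φ ξ := by
  rw [Fintype.sum_sum_type]; rfl

lemma Dk_add {n : ℕ} (k : Fin n ⊕ Fin n) {φ ψ : H n → ℝ} {ξ : H n} (h1 : DifferentiableAt ℝ φ ξ)
    (h2 : DifferentiableAt ℝ ψ ξ) : Dk k (fun ξ => φ ξ + ψ ξ) ξ = Dk k φ ξ + Dk k ψ ξ := by
  unfold Dk; rw [fderiv_fun_add h1 h2]; rfl

lemma Dk_mul {n : ℕ} (k : Fin n ⊕ Fin n) {φ ψ : H n → ℝ} {ξ : H n} (h1 : DifferentiableAt ℝ φ ξ)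
    (h2 : DifferentiableAt ℝ ψ ξ) :
    Dk k (fun ξ => φ ξ * ψ ξ) ξ = φ ξ * Dk k ψ ξ + ψ ξ * Dk k φ ξ := by
  unfold Dk; rw [fderiv_fun_mul h1 h2]; rfl

lemma Dk_comp {n : ℕ} (k : Fin n ⊕ Fin n) {φ : H n → ℝ} {ξ : H n} {a : ℝ → ℝ} {a' : ℝ}
    (h1 : DifferentiableAt ℝ φ ξ) (h2 : HasDerivAt a a' (φ ξ)) :
    Dk k (fun ξ => a (φ ξ)) ξ = a' * Dk k φ ξ := by
  have : HasFDerivAt (fun ξ => a (φ ξ)) (a' • fderiv ℝ φ ξ) ξ := h2.comp_hasFDerivAt ξ h1.hasFDerivAt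
  unfold Dk; rw [this.fderiv]; rfl

lemma hasFDerivAt_xk {n : ℕ} (i : Fin n) (ξ : H n) : HasFDerivAt (fun ξ : H n => ξ.1 i)
    ((ContinuousLinearMap.proj i).comp (ContinuousLinearMap.fst ℝ (Fin n → ℝ) ((Fin n → ℝ) × ℝ))) ξ :=
  ((ContinuousLinearMap.proj i).comp
    (ContinuousLinearMap.fst ℝ (Fin n → ℝ) ((Fin n → ℝ) × ℝ))).hasFDerivAt
lemma hasFDerivAt_yk {n : ℕ} (i : Fin n) (ξ : H n) : HasFDerivAt (fun ξ : H n => ξ.2.1 i)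
    ((ContinuousLinearMap.proj i).comp ((ContinuousLinearMap.fst ℝ (Fin n → ℝ) ℝ).comp
      (ContinuousLinearMap.snd ℝ (Fin n → ℝ) ((Fin n → ℝ) × ℝ)))) ξ :=
  ((ContinuousLinearMap.proj i).comp ((ContinuousLinearMap.fst ℝ (Fin n → ℝ) ℝ).comp
      (ContinuousLinearMap.snd ℝ (Fin n → ℝ) ((Fin n → ℝ) × ℝ)))).hasFDerivAt

lemma Dk_xk {n : ℕ} (k j : Fin n ⊕ Fin n) (ξ : H n) : Dk k (xk j) ξ = if k = j then 1 else 0 := by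
  unfold Dk
  rcases j with j | j
  · change fderiv ℝ (fun ξ : H n => ξ.1 j) ξ _ = _
    rw [(hasFDerivAt_xk j ξ).fderiv]
    rcases k with k | k <;> simp [dirv, Pi.single_apply, eq_comm]
  · change fderiv ℝ (fun ξ : H n => ξ.2.1 j) ξ _ = _
    rw [(hasFDerivAt_yk j ξ).fderiv]
    rcases k with k | k <;> simp [dirv, Pi.single_apply, eq_comm]

lemma Dk_yk {n : ℕ} (k : Fin n ⊕ Fin n) (ξ : H n) : Dk k (yk k) ξ = 0 := by
  unfold Dk
  rcases k with k | k
  · change fderiv ℝ (fun ξ : H n => ξ.2.1 k) ξ _ = _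
    rw [(hasFDerivAt_yk k ξ).fderiv]
    simp [dirv]
  · change fderiv ℝ (fun ξ : H n => -ξ.1 k) ξ _ = _
    rw [(hasFDerivAt_xk k ξ).fun_neg.fderiv]
    simp [dirv]

lemma Dk_t {n : ℕ} (k : Fin n ⊕ Fin n) (ξ : H n) : Dk k (fun ξ => ξ.2.2) ξ = 2 * yk k ξ := by
  unfold Dk
  have : HasFDerivAt (fun ξ : H n => ξ.2.2) ((ContinuousLinearMap.snd ℝ (Fin n → ℝ) ℝ).comp
      (ContinuousLinearMap.snd ℝ (Fin n → ℝ) ((Fin n → ℝ) × ℝ))) ξ :=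
    ((ContinuousLinearMap.snd ℝ (Fin n → ℝ) ℝ).comp
      (ContinuousLinearMap.snd ℝ (Fin n → ℝ) ((Fin n → ℝ) × ℝ))).hasFDerivAt
  rw [this.fderiv]
  rcases k with k | k <;> simp [dirv, yk]

lemma rsq_eq {n : ℕ} (ξ : H n) : rsq ξ = ∑ j, xk j ξ ^ 2 := by
  rw [Fintype.sum_sum_type]; rfl

lemma Dk_rsq {n : ℕ} (k : Fin n ⊕ Fin n) (ξ : H n) : Dk k rsq ξ = 2 * xk k ξ := by
  have h0 : rsq = fun ξ : H n => ∑ j, xk j ξ ^ 2 := by ext ξ; exact rsq_eq ξ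
  have : HasFDerivAt (fun ξ : H n => ∑ j, xk j ξ ^ 2)
     (∑ j, (2 • xk j ξ ^ (2-1)) • fderiv ℝ (xk j) ξ) ξ := by
    apply HasFDerivAt.fun_sum
    intro j _
    exact (((contDiff_xk j).differentiable (by simp)) ξ).hasFDerivAt.pow 2
  unfold Dk
  rw [h0, this.fderiv]
  simp only [_root_.sum_apply, _root_.smul_apply]
  have := fun j => Dk_xk k j ξ
  unfold Dk at this
  simp [this]

lemma sum_xk_sq {n : ℕ} (ξ : H n) : ∑ j, xk j ξ ^ 2 = rsq ξ := (rsq_eq ξ).symm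
lemma sum_yk_sq {n : ℕ} (ξ : H n) : ∑ j, yk j ξ ^ 2 = rsq ξ := by
  rw [Fintype.sum_sum_type]; simp [yk, rsq]; ring
lemma sum_xk_yk {n : ℕ} (ξ : H n) : ∑ j, xk j ξ * yk j ξ = 0 := by
  rw [Fintype.sum_sum_type]; simp [yk, xk, mul_comm]

/-- explicit second derivative of a(rsq) b(t) -/
def DDk {n : ℕ} (k : Fin n ⊕ Fin n) (a a1 a2 b b1 b2 : ℝ → ℝ) (ξ : H n) : ℝ :=
  4 * xk k ξ ^ 2 * a2 (rsq ξ) * b ξ.2.2 + 2 * a1 (rsq ξ) * b ξ.2.2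
    + 8 * xk k ξ * yk k ξ * a1 (rsq ξ) * b1 ξ.2.2 + 4 * yk k ξ ^ 2 * a (rsq ξ) * b2 ξ.2.2

lemma differentiable_rsq {n : ℕ} : Differentiable ℝ (rsq (n := n)) :=
  contDiff_rsq.differentiable (by simp)
lemma differentiable_xk {n : ℕ} (k : Fin n ⊕ Fin n) : Differentiable ℝ (xk k) :=
  (contDiff_xk k).differentiable (by simp)
lemma differentiable_yk {n : ℕ} (k : Fin n ⊕ Fin n) : Differentiable ℝ (yk k) :=
  (contDiff_yk k).differentiable (by simp)
lemma differentiable_t {n : ℕ} : Differentiable ℝ (fun ξ : H n => ξ.2.2) := by fun_prop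

lemma Dk_cyl {n : ℕ} (k : Fin n ⊕ Fin n) {a a1 b b1 : ℝ → ℝ} (ha : ∀ s, HasDerivAt a (a1 s) s)
    (hb : ∀ s, HasDerivAt b (b1 s) s) (ξ : H n) :
    Dk k (fun ξ => a (rsq ξ) * b ξ.2.2) ξ =
      2 * xk k ξ * a1 (rsq ξ) * b ξ.2.2 + 2 * yk k ξ * a (rsq ξ) * b1 ξ.2.2 := by
  rw [Dk_mul, Dk_comp k (differentiable_rsq ξ) (ha _), Dk_comp k (differentiable_t ξ) (hb _),
    Dk_rsq, Dk_t]
  · ring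
  · exact (ha _).differentiableAt.fun_comp' ξ (differentiable_rsq ξ)
  · exact (hb _).differentiableAt.fun_comp' ξ (differentiable_t ξ)

lemma DDk_cyl {n : ℕ} (k : Fin n ⊕ Fin n) {a a1 a2 b b1 b2 : ℝ → ℝ}
    (ha : ∀ s, HasDerivAt a (a1 s) s) (ha1 : ∀ s, HasDerivAt a1 (a2 s) s)
    (hb : ∀ s, HasDerivAt b (b1 s) s) (hb1 : ∀ s, HasDerivAt b1 (b2 s) s) (ξ : H n) :
    Dk k (Dk k (fun ξ => a (rsq ξ) * b ξ.2.2)) ξ = DDk k a a1 a2 b b1 b2 ξ := by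
  have h0 : Dk k (fun ξ => a (rsq ξ) * b ξ.2.2) = fun ξ =>
      xk k ξ * (2 * (a1 (rsq ξ) * b ξ.2.2)) + yk k ξ * (2 * (a (rsq ξ) * b1 ξ.2.2)) := by
    ext ξ; rw [Dk_cyl k ha hb]; ring
  have d : ∀ {a a1 b b1 : ℝ → ℝ}, (∀ s, HasDerivAt a (a1 s) s) → (∀ s, HasDerivAt b (b1 s) s) →
      DifferentiableAt ℝ (fun ξ : H n => (a (rsq ξ) * b ξ.2.2)) ξ := by
    intro a a1 b b1 ha hb
    exact ((ha _).differentiableAt.fun_comp' ξ (differentiable_rsq ξ)).mul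
      ((hb _).differentiableAt.fun_comp' ξ (differentiable_t ξ))
  have c2 : ∀ {φ : H n → ℝ}, DifferentiableAt ℝ φ ξ → Dk k (fun ξ => 2 * φ ξ) ξ = 2 * Dk k φ ξ := by
    intro φ h
    unfold Dk
    rw [fderiv_const_mul h]; rfl
  rw [h0, Dk_add, Dk_mul, Dk_mul k (φ := yk k), c2, c2, Dk_cyl k ha1 hb, Dk_cyl k ha hb1, Dk_xk, Dk_yk]
  · simp only [if_true, DDk]; ring
  · exact d ha hb1
  · exact d ha1 hb
  · exact differentiable_yk k ξ
  · exact (d ha hb1).const_mul 2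
  · exact differentiable_xk k ξ
  · exact (d ha1 hb).const_mul 2
  · exact (differentiable_xk k ξ).mul ((d ha1 hb).const_mul 2)
  · exact (differentiable_yk k ξ).mul ((d ha hb1).const_mul 2)

lemma sum_DDk {n : ℕ} (a a1 a2 b b1 b2 : ℝ → ℝ) (ξ : H n) :
    ∑ k, DDk k a a1 a2 b b1 b2 ξ = 4 * ((rsq ξ * a2 (rsq ξ) + n * a1 (rsq ξ)) * b ξ.2.2 +
      rsq ξ * a (rsq ξ) * b2 ξ.2.2) := by
  have e : ∀ k : Fin n ⊕ Fin n, DDk k a a1 a2 b b1 b2 ξ =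
      xk k ξ ^ 2 * (4 * a2 (rsq ξ) * b ξ.2.2) + 2 * a1 (rsq ξ) * b ξ.2.2
      + (xk k ξ * yk k ξ) * (8 * a1 (rsq ξ) * b1 ξ.2.2) + yk k ξ ^ 2 * (4 * a (rsq ξ) * b2 ξ.2.2) := by
    intro k; unfold DDk; ring
  simp only [e, Finset.sum_add_distrib, ← Finset.sum_mul, sum_xk_sq, sum_yk_sq, sum_xk_yk]
  simp
  ring
end Heisenberg

namespace Heisenberg

lemma contDiff_one_of' {a a1 : ℝ → ℝ} (h : ∀ s, HasDerivAt a (a1 s) s) (h1 : Continuous a1) :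
    ContDiff ℝ 1 a := by
  rw [contDiff_one_iff_deriv]
  refine ⟨fun s => (h s).differentiableAt, ?_⟩
  have : deriv a = a1 := by ext s; exact (h s).deriv
  rwa [this]

lemma contDiff_two_of' {a a1 a2 : ℝ → ℝ} (h : ∀ s, HasDerivAt a (a1 s) s)
    (h1 : ∀ s, HasDerivAt a1 (a2 s) s) (h2 : Continuous a2) : ContDiff ℝ 2 a := by
  rw [show (2 : WithTop ℕ∞) = 1 + 1 by norm_num, contDiff_succ_iff_deriv]
  refine ⟨fun s => (h s).differentiableAt, by simp, ?_⟩
  have : deriv a = a1 := by ext s; exact (h s).deriv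
  rw [this]; exact contDiff_one_of' h1 h2

lemma contDiff_Dk {n : ℕ} (k : Fin n ⊕ Fin n) {φ : H n → ℝ} (h : ContDiff ℝ 2 φ) :
    ContDiff ℝ 1 (Dk k φ) := by
  unfold Dk
  exact (h.fderiv_right (m := 1) (by norm_num)).clm_apply ((contDiff_dirv k).of_le (by simp))

lemma continuous_Dk {n : ℕ} (k : Fin n ⊕ Fin n) {φ : H n → ℝ} (h : ContDiff ℝ 1 φ) :
    Continuous (Dk k φ) := by
  unfold Dk
  exact (h.continuous_fderiv (by simp)).clm_apply ((contDiff_dirv k).continuous)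

lemma hcs_Dk {n : ℕ} (k : Fin n ⊕ Fin n) {φ : H n → ℝ} (h : HasCompactSupport φ) :
    HasCompactSupport (Dk k φ) := by
  refine (h.fderiv ℝ).mono ?_
  intro ξ hξ h0
  apply hξ
  simp [Dk, h0]

lemma isTest_univ {n : ℕ} {φ : H n → ℝ} (h : ContDiff ℝ 1 φ) (h' : HasCompactSupport φ) :
    IsTest univ φ := ⟨h, h', subset_univ _⟩

lemma compact_cyl {n : ℕ} (R : ℝ) {K : Set ℝ} (hK : IsCompact K) :
    IsCompact {ξ : H n | rsq ξ ≤ R ∧ ξ.2.2 ∈ K} := by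
  have h1 : IsCompact ((Metric.closedBall (0 : Fin n → ℝ) (√R)) ×ˢ
      ((Metric.closedBall (0 : Fin n → ℝ) (√R)) ×ˢ K)) :=
    (isCompact_closedBall _ _).prod ((isCompact_closedBall _ _).prod hK)
  refine h1.of_isClosed_subset ?_ ?_
  · exact (isClosed_le continuous_rsq continuous_const).inter
      (hK.isClosed.preimage (by fun_prop))
  · rintro ξ ⟨h, ht⟩
    have key : ∀ j, |xk j ξ| ≤ √R := by
      intro j
      apply Real.abs_le_sqrt
      refine le_trans ?_ h
      rw [rsq_eq]
      exact Finset.single_le_sum (f := fun j => xk j ξ ^ 2) (fun i _ => sq_nonneg _) (Finset.mem_univ j)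
    refine ⟨?_, ?_, ht⟩
    · rw [mem_closedBall_zero_iff, pi_norm_le_iff_of_nonneg (Real.sqrt_nonneg _)]
      intro i; exact key (.inl i)
    · rw [mem_closedBall_zero_iff, pi_norm_le_iff_of_nonneg (Real.sqrt_nonneg _)]
      intro i; exact key (.inr i)

/-- the integral identity for sums of directional derivatives, coping with a possibly non-measurable
weak gradient. -/
lemma ibp_junk {n : ℕ} {u F : H n → ℝ} (hu : Continuous u) (hF : Continuous F)
    (hsol : IsWeakSol univ u F) (Φ : H n → ℝ) (hΦ : ContDiff ℝ 2 Φ) (hc : HasCompactSupport Φ)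
    (hsym : ∀ k j, ∫ ξ, u ξ * Dk k (Dk k Φ) ξ = ∫ ξ, u ξ * Dk j (Dk j Φ) ξ) :
    ∑ k, ∫ ξ, u ξ * Dk k (Dk k Φ) ξ = - ∫ ξ, F ξ * Φ ξ := by
  obtain ⟨G, hG, hw⟩ := hsol
  have ibp : ∀ k, ∀ φ, IsTest univ φ → ∫ ξ, u ξ * Dk k φ ξ = - ∫ ξ, ck k (G ξ) * φ ξ := by
    intro k
    rcases k with k | k
    · exact hG.ibpX k
    · exact hG.ibpY k
  simp only [hdot_eq] at hw
  have tD : ∀ k, IsTest univ (Dk k Φ) := fun k => isTest_univ (contDiff_Dk k hΦ) (hcs_Dk k hc)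
  have intu : ∀ {w : H n → ℝ}, Continuous w → ∀ {φ : H n → ℝ}, Continuous φ → HasCompactSupport φ →
      Integrable (fun ξ => w ξ * φ ξ) := by
    intro w hw φ h1 h2
    exact (hw.mul h1).integrable_of_hasCompactSupport h2.mul_left
  by_cases hA : ∀ k, ∀ φ, IsTest univ φ → Integrable (fun ξ => ck k (G ξ) * φ ξ)
  · rw [← hw Φ (isTest_univ (hΦ.of_le (by norm_num)) hc), integral_finsetSum _ (fun k _ => hA k _ (tD k)),
      ← Finset.sum_neg_distrib]
    exact Finset.sum_congr rfl (fun k _ => ibp k _ (tD k))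
  · push Not at hA
    obtain ⟨k, φ0, ht0, hni⟩ := hA
    -- all integrals against D_k vanish
    have z1 : ∀ φ, IsTest univ φ → ∫ ξ, u ξ * Dk k φ ξ = 0 := by
      have z0 : ∀ φ, IsTest univ φ → ¬ Integrable (fun ξ => ck k (G ξ) * φ ξ) → ∫ ξ, u ξ * Dk k φ ξ = 0 := by
        intro φ h1 h2
        rw [ibp k φ h1, integral_undef h2, neg_zero]
      intro φ h
      by_cases hi : Integrable (fun ξ => ck k (G ξ) * φ ξ)
      · have h3 : IsTest univ (fun ξ => φ0 ξ + φ ξ) :=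
          isTest_univ (ht0.contDiff.add h.contDiff) (ht0.compactSupport.add h.compactSupport)
        have := z0 _ h3 (by
          intro h4; apply hni
          have := h4.sub hi
          refine this.congr (Eventually.of_forall ?_)
          intro ξ; simp only [Pi.sub_apply]; ring)
        have e : ∀ ξ, u ξ * Dk k (fun ξ => φ0 ξ + φ ξ) ξ = u ξ * Dk k φ0 ξ + u ξ * Dk k φ ξ := by
          intro ξ
          rw [Dk_add _ (ht0.contDiff.differentiable (by simp) ξ) (h.contDiff.differentiable (by simp) ξ)]
          ring
        simp only [e] at this
        rw [integral_add (intu hu (continuous_Dk k ht0.contDiff) (hcs_Dk k ht0.compactSupport))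
          (intu hu (continuous_Dk k h.contDiff) (hcs_Dk k h.compactSupport)), z0 _ ht0 hni, zero_add] at this
        exact this
      · exact z0 φ h hi
    -- some test function has nonintegrable pairing
    have ex : ∃ φ1, IsTest univ φ1 ∧ ¬ Integrable (fun ξ => ∑ j, ck j (G ξ) * Dk j φ1 ξ) := by
      by_cases hi : Integrable (fun ξ => ∑ j, ck j (G ξ) * Dk j φ0 ξ)
      · refine ⟨fun ξ => xk k ξ * φ0 ξ, isTest_univ ?_ ht0.compactSupport.mul_left, ?_⟩
        · exact ((contDiff_xk k).of_le (by simp)).mul ht0.contDiff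
        intro h4; apply hni
        have e : ∀ ξ, ∑ j, ck j (G ξ) * Dk j (fun ξ => xk k ξ * φ0 ξ) ξ =
            ck k (G ξ) * φ0 ξ + xk k ξ * ∑ j, ck j (G ξ) * Dk j φ0 ξ := by
          intro ξ
          have : ∀ j, ck j (G ξ) * Dk j (fun ξ => xk k ξ * φ0 ξ) ξ =
              (if j = k then ck j (G ξ) * φ0 ξ else 0) + xk k ξ * (ck j (G ξ) * Dk j φ0 ξ) := by
            intro j
            rw [Dk_mul _ (differentiable_xk k ξ) (ht0.contDiff.differentiable (by simp) ξ), Dk_xk]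
            split_ifs with h
            · subst h; ring
            · ring
          simp only [this, Finset.sum_add_distrib, Finset.mul_sum]
          simp
        simp only [e] at h4
        have h5 : Integrable (fun ξ => xk k ξ * ∑ j, ck j (G ξ) * Dk j φ0 ξ) := by
          have hs : Function.support (fun ξ => ∑ j, ck j (G ξ) * Dk j φ0 ξ) ⊆ tsupport φ0 := by
            intro ξ hξ
            by_contra h0
            apply hξ
            have : fderiv ℝ φ0 ξ = 0 := by
              by_contra h6
              exact h0 (support_fderiv_subset ℝ h6)
            simp [Dk, this]
          have hs2 : Function.support (fun ξ => xk k ξ * ∑ j, ck j (G ξ) * Dk j φ0 ξ) ⊆ tsupport φ0 := by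
            refine subset_trans ?_ hs
            intro ξ hξ h0
            apply hξ; simp only at h0 ⊢; rw [h0, mul_zero]
          rw [← integrableOn_iff_integrable_of_support_subset hs2]
          exact (hi.integrableOn).continuousOn_mul (contDiff_xk k).continuous.continuousOn
            ht0.compactSupport
        have := h4.sub h5
        refine this.congr (Eventually.of_forall ?_)
        intro ξ; simp only [Pi.sub_apply]; ring
      · exact ⟨φ0, ht0, hi⟩
    obtain ⟨φ1, ht1, hn1⟩ := ex
    have z2 : ∀ φ, IsTest univ φ → ∫ ξ, F ξ * φ ξ = 0 := by
      have z0 : ∀ φ, IsTest univ φ → ¬ Integrable (fun ξ => ∑ j, ck j (G ξ) * Dk j φ ξ) →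
          ∫ ξ, F ξ * φ ξ = 0 := by
        intro φ h1 h2
        rw [← hw φ h1, integral_undef h2]
      intro φ h
      by_cases hi : Integrable (fun ξ => ∑ j, ck j (G ξ) * Dk j φ ξ)
      · have h3 : IsTest univ (fun ξ => φ1 ξ + φ ξ) :=
          isTest_univ (ht1.contDiff.add h.contDiff) (ht1.compactSupport.add h.compactSupport)
        have := z0 _ h3 (by
          intro h4; apply hn1
          have := h4.sub hi
          refine this.congr (Eventually.of_forall ?_)
          intro ξ; simp only [Pi.sub_apply]
          rw [← Finset.sum_sub_distrib]
          refine Finset.sum_congr rfl (fun j _ => ?_)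
          rw [Dk_add _ (ht1.contDiff.differentiable (by simp) ξ) (h.contDiff.differentiable (by simp) ξ)]
          ring)
        simp only [mul_add] at this
        rw [integral_add (intu hF ht1.contDiff.continuous ht1.compactSupport)
          (intu hF h.contDiff.continuous h.compactSupport), z0 _ ht1 hn1, zero_add] at this
        exact this
      · exact z0 φ h hi
    rw [z2 Φ (isTest_univ (hΦ.of_le (by norm_num)) hc), neg_zero]
    refine Finset.sum_eq_zero (fun j _ => ?_)
    rw [hsym j k]
    exact z1 _ (tD k)

/-- rotation (x,y) ↦ (y,-x) -/
def rotJ {n : ℕ} (ξ : H n) : H n := (ξ.2.1, -ξ.1, ξ.2.2)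
def permS {n : ℕ} (e : Equiv.Perm (Fin n)) (ξ : H n) : H n := (ξ.1 ∘ e, ξ.2.1 ∘ e, ξ.2.2)

lemma mp_perm {n : ℕ} (e : Equiv.Perm (Fin n)) :
    MeasurePreserving (fun x : Fin n → ℝ => x ∘ e) volume volume := by
  have := volume_measurePreserving_piCongrLeft (fun _ : Fin n => ℝ) e.symm
  convert this using 1
  ext x i
  have := Equiv.piCongrLeft_apply_apply (fun _ : Fin n => ℝ) e.symm x (e i)
  simp only [Equiv.symm_apply_apply] at this
  simp [MeasurableEquiv.coe_piCongrLeft, this]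

lemma mp_permS {n : ℕ} (e : Equiv.Perm (Fin n)) :
    MeasurePreserving (permS e) (volume : Measure (H n)) volume := by
  have := (mp_perm e).prod ((mp_perm e).prod (MeasurePreserving.id (volume : Measure ℝ)))
  exact this

lemma mp_rotJ {n : ℕ} : MeasurePreserving rotJ (volume : Measure (H n)) volume := by
  have h1 : MeasurePreserving (fun p : (Fin n → ℝ) × (Fin n → ℝ) => (p.2, -p.1))
      (volume : Measure ((Fin n → ℝ) × (Fin n → ℝ))) volume := by
    have := ((MeasurePreserving.id (volume : Measure (Fin n → ℝ))).prod
      (Measure.measurePreserving_neg (volume : Measure (Fin n → ℝ)))).comp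
      (Measure.measurePreserving_swap (μ := (volume : Measure (Fin n → ℝ))) (ν := (volume : Measure (Fin n → ℝ))))
    exact this
  have h2 := h1.prod (MeasurePreserving.id (volume : Measure ℝ))
  have h3 := (measurePreserving_prodAssoc (volume : Measure (Fin n → ℝ)) (volume : Measure (Fin n → ℝ))
    (volume : Measure ℝ))
  have := h3.comp (h2.comp h3.symm)
  exact this

lemma rsq_permS {n : ℕ} (e : Equiv.Perm (Fin n)) (ξ : H n) : rsq (permS e ξ) = rsq ξ := by
  unfold rsq permS
  simp only [Function.comp]
  rw [Equiv.sum_comp e (fun i => ξ.1 i ^ 2), Equiv.sum_comp e (fun i => ξ.2.1 i ^ 2)]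
lemma rsq_rotJ {n : ℕ} (ξ : H n) : rsq (rotJ ξ) = rsq ξ := by
  unfold rsq rotJ
  simp [add_comm]

lemma integral_comp_mp {n : ℕ} {T : H n → H n} (hT : MeasurePreserving T volume volume) {f : H n → ℝ}
    (hf : Continuous f) : ∫ ξ, f (T ξ) = ∫ ξ, f ξ := by
  rw [← integral_map hT.measurable.aemeasurable (by rw [hT.map_eq]; exact hf.aestronglyMeasurable), hT.map_eq]

lemma distr_eq {n : ℕ} {u F : H n → ℝ} (hu : Continuous u) (hF : Continuous F)
    (hcyl : IsCylindrical u) (hsol : IsWeakSol univ u F) {a a1 a2 b b1 b2 : ℝ → ℝ}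
    (ha : ∀ s, HasDerivAt a (a1 s) s) (ha1 : ∀ s, HasDerivAt a1 (a2 s) s) (ha2 : Continuous a2)
    (hb : ∀ s, HasDerivAt b (b1 s) s) (hb1 : ∀ s, HasDerivAt b1 (b2 s) s) (hb2 : Continuous b2)
    (R : ℝ) (haR : ∀ s, R < s → a s = 0) (hbc : HasCompactSupport b) :
    ∫ ξ : H n, (u ξ * (4 * ((rsq ξ * a2 (rsq ξ) + n * a1 (rsq ξ)) * b ξ.2.2 +
      rsq ξ * a (rsq ξ) * b2 ξ.2.2)) + F ξ * (a (rsq ξ) * b ξ.2.2)) = 0 := by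
  set Φ : H n → ℝ := fun ξ => a (rsq ξ) * b ξ.2.2 with hΦd
  have hΦ : ContDiff ℝ 2 Φ := by
    refine ContDiff.mul ?_ ?_
    · exact (contDiff_two_of' ha ha1 ha2).comp (contDiff_rsq.of_le (by simp))
    · exact (contDiff_two_of' hb hb1 hb2).comp (by fun_prop)
  have hc : HasCompactSupport Φ := by
    refine HasCompactSupport.intro (compact_cyl (n := n) R hbc) ?_
    intro ξ hξ
    simp only [mem_ofPred_eq, not_and_or, not_le] at hξ
    rcases hξ with h | h
    · simp [hΦd, haR _ h]
    · simp [hΦd, image_eq_zero_of_notMem_tsupport h]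
  have hDD : ∀ k, Dk k (Dk k Φ) = DDk k a a1 a2 b b1 b2 := by
    intro k; ext ξ; exact DDk_cyl k ha ha1 hb hb1 ξ
  have cont : ∀ k, Continuous (fun ξ => u ξ * Dk k (Dk k Φ) ξ) := fun k =>
    hu.mul (continuous_Dk k (contDiff_Dk k hΦ))
  have int : ∀ k, Integrable (fun ξ => u ξ * Dk k (Dk k Φ) ξ) := fun k =>
    (cont k).integrable_of_hasCompactSupport (hcs_Dk k (hcs_Dk k hc)).mul_left
  have sJ : ∀ i : Fin n, ∫ ξ, u ξ * Dk (.inr i) (Dk (.inr i) Φ) ξ =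
      ∫ ξ, u ξ * Dk (.inl i) (Dk (.inl i) Φ) ξ := by
    intro i
    rw [← integral_comp_mp mp_rotJ (cont (.inl i))]
    congr 1; ext ξ
    rw [hcyl (rotJ ξ) ξ (rsq_rotJ ξ) rfl, hDD, hDD]
    simp only [DDk, rsq_rotJ]
    simp [rotJ, xk, yk]
  have sP : ∀ i j : Fin n, ∫ ξ, u ξ * Dk (.inl i) (Dk (.inl i) Φ) ξ =
      ∫ ξ, u ξ * Dk (.inl j) (Dk (.inl j) Φ) ξ := by
    intro i j
    rw [← integral_comp_mp (mp_permS (Equiv.swap i j)) (cont (.inl j))]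
    congr 1; ext ξ
    rw [hcyl (permS (Equiv.swap i j) ξ) ξ (rsq_permS _ ξ) rfl, hDD, hDD]
    simp only [DDk, rsq_permS]
    simp [permS, xk, yk]
  have hsym : ∀ k j, ∫ ξ, u ξ * Dk k (Dk k Φ) ξ = ∫ ξ, u ξ * Dk j (Dk j Φ) ξ := by
    have : ∀ k : Fin n ⊕ Fin n, ∃ i : Fin n, ∫ ξ, u ξ * Dk k (Dk k Φ) ξ = ∫ ξ, u ξ * Dk (.inl i) (Dk (.inl i) Φ) ξ := by
      intro k
      rcases k with k | k
      · exact ⟨k, rfl⟩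
      · exact ⟨k, sJ k⟩
    intro k j
    obtain ⟨i, hi⟩ := this k
    obtain ⟨i', hi'⟩ := this j
    rw [hi, hi', sP i i']
  have key := ibp_junk hu hF hsol Φ hΦ hc hsym
  rw [← integral_finsetSum _ (fun k _ => int k)] at key
  have e : ∀ ξ, ∑ k, u ξ * Dk k (Dk k Φ) ξ = u ξ * (4 * ((rsq ξ * a2 (rsq ξ) + n * a1 (rsq ξ)) * b ξ.2.2 +
      rsq ξ * a (rsq ξ) * b2 ξ.2.2)) := by
    intro ξ
    rw [← Finset.mul_sum, ← sum_DDk a a1 a2 b b1 b2]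
    simp only [hDD]
  have hnt := integrable_finsetSum Finset.univ (fun k (_ : k ∈ Finset.univ) => int k)
  simp only [e] at key hnt
  rw [integral_add hnt, key]
  · simp [hΦd]
  · exact (hF.mul hΦ.continuous).integrable_of_hasCompactSupport hc.mul_left
end Heisenberg

namespace Heisenberg

def pds (W : ℝ × ℝ → ℝ) (z : ℝ × ℝ) : ℝ := fderiv ℝ W z (1, 0)
def pdt (W : ℝ × ℝ → ℝ) (z : ℝ × ℝ) : ℝ := fderiv ℝ W z (0, 1)

/-- the linear form (α,β) -/
def lin2 (a b : ℝ) : ℝ × ℝ →L[ℝ] ℝ :=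
  a • ContinuousLinearMap.fst ℝ ℝ ℝ + b • ContinuousLinearMap.snd ℝ ℝ ℝ

lemma lin2_apply (a b : ℝ) (v : ℝ × ℝ) : lin2 a b v = a * v.1 + b * v.2 := rfl

lemma pds_of {W : ℝ × ℝ → ℝ} {z : ℝ × ℝ} {a b : ℝ} (h : HasFDerivAt W (lin2 a b) z) : pds W z = a := by
  unfold pds; rw [h.fderiv, lin2_apply]; simp
lemma pdt_of {W : ℝ × ℝ → ℝ} {z : ℝ × ℝ} {a b : ℝ} (h : HasFDerivAt W (lin2 a b) z) : pdt W z = b := by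
  unfold pdt; rw [h.fderiv, lin2_apply]; simp

lemma hasFDerivAt_lin2 {W : ℝ × ℝ → ℝ} {z : ℝ × ℝ} (h : DifferentiableAt ℝ W z) :
    HasFDerivAt W (lin2 (pds W z) (pdt W z)) z := by
  convert h.hasFDerivAt using 1
  ext <;> simp [lin2_apply, pds, pdt]

lemma partial_fderiv {f f1 f2 : ℝ × ℝ → ℝ} {U : Set (ℝ × ℝ)} (hU : IsOpen U)
    (h1 : ∀ z ∈ U, HasDerivAt (fun s => f (s, z.2)) (f1 z) z.1)
    (h2 : ∀ z ∈ U, HasDerivAt (fun t => f (z.1, t)) (f2 z) z.2)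
    (c1 : ContinuousOn f1 U) (c2 : ContinuousOn f2 U) :
    ∀ z ∈ U, HasFDerivAt f (lin2 (f1 z) (f2 z)) z := by
  intro z hz
  have := hasStrictFDerivAt_uncurry_coprod (𝕜 := ℝ) (u := z) (f := fun s t => f (s, t))
    (f₁ := fun s t => ContinuousLinearMap.toSpanSingleton ℝ (f1 (s, t)))
    (f₂ := fun s t => ContinuousLinearMap.toSpanSingleton ℝ (f2 (s, t)))
    (by filter_upwards [hU.mem_nhds hz] with v hv using (h1 v hv).hasFDerivAt)
    (by filter_upwards [hU.mem_nhds hz] with v hv using (h2 v hv).hasFDerivAt)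
    (((ContinuousLinearMap.toSpanSingletonCLE (𝕜 := ℝ) (E := ℝ)).continuous.continuousAt).comp (c1.continuousAt (hU.mem_nhds hz)))
    (((ContinuousLinearMap.toSpanSingletonCLE (𝕜 := ℝ) (E := ℝ)).continuous.continuousAt).comp (c2.continuousAt (hU.mem_nhds hz)))
  have e : lin2 (f1 z) (f2 z) = (ContinuousLinearMap.toSpanSingleton ℝ (f1 z)).coprod
      (ContinuousLinearMap.toSpanSingleton ℝ (f2 z)) := by
    ext <;> simp [lin2_apply]
  rw [e]
  exact this.hasFDerivAt

lemma continuousOn_lin2 {f1 f2 : ℝ × ℝ → ℝ} {U : Set (ℝ × ℝ)} (c1 : ContinuousOn f1 U)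
    (c2 : ContinuousOn f2 U) : ContinuousOn (fun z => lin2 (f1 z) (f2 z)) U := by
  unfold lin2; fun_prop

lemma partial_contDiffOn {f f1 f2 : ℝ × ℝ → ℝ} {U : Set (ℝ × ℝ)} (hU : IsOpen U)
    (h1 : ∀ z ∈ U, HasDerivAt (fun s => f (s, z.2)) (f1 z) z.1)
    (h2 : ∀ z ∈ U, HasDerivAt (fun t => f (z.1, t)) (f2 z) z.2)
    (c1 : ContinuousOn f1 U) (c2 : ContinuousOn f2 U) : ContDiffOn ℝ 1 f U := by
  have hf := partial_fderiv hU h1 h2 c1 c2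
  rw [show (1 : WithTop ℕ∞) = 0 + 1 by norm_num, contDiffOn_succ_iff_fderiv_of_isOpen hU]
  refine ⟨fun z hz => (hf z hz).differentiableAt.differentiableWithinAt, by simp, ?_⟩
  rw [contDiffOn_zero]
  exact (continuousOn_lin2 c1 c2).congr (fun z hz => (hf z hz).fderiv)

lemma partial_contDiffOn_two {f f1 f2 : ℝ × ℝ → ℝ} {U : Set (ℝ × ℝ)} (hU : IsOpen U)
    (h1 : ∀ z ∈ U, HasDerivAt (fun s => f (s, z.2)) (f1 z) z.1)
    (h2 : ∀ z ∈ U, HasDerivAt (fun t => f (z.1, t)) (f2 z) z.2)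
    (c1 : ContDiffOn ℝ 1 f1 U) (c2 : ContDiffOn ℝ 1 f2 U) : ContDiffOn ℝ 2 f U := by
  have hf := partial_fderiv hU h1 h2 c1.continuousOn c2.continuousOn
  rw [show (2 : WithTop ℕ∞) = 1 + 1 by norm_num, contDiffOn_succ_iff_fderiv_of_isOpen hU]
  refine ⟨fun z hz => (hf z hz).differentiableAt.differentiableWithinAt, by simp, ?_⟩
  have : ContDiffOn ℝ 1 (fun z => lin2 (f1 z) (f2 z)) U := by unfold lin2; fun_prop
  exact this.congr (fun z hz => (hf z hz).fderiv)

lemma hasDerivAt_param {f f' : ℝ → ℝ → ℝ} (hf : Continuous (fun p : ℝ × ℝ => f p.1 p.2))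
    (hf' : Continuous (fun p : ℝ × ℝ => f' p.1 p.2))
    (h : ∀ t θ, HasDerivAt (fun t => f t θ) (f' t θ) t) (a b t : ℝ) :
    HasDerivAt (fun t => ∫ θ in a..b, f t θ) (∫ θ in a..b, f' t θ) t := by
  have hK : IsCompact (Icc (t - 1) (t + 1) ×ˢ uIcc a b) := isCompact_Icc.prod isCompact_uIcc
  obtain ⟨C, hC⟩ := hK.exists_bound_of_continuousOn hf'.continuousOn
  refine (intervalIntegral.hasDerivAt_integral_of_dominated_loc_of_deriv_le (μ := volume)
    (F := f) (F' := f') (x₀ := t) (s := Icc (t - 1) (t + 1)) (bound := fun _ => C)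
    (Icc_mem_nhds (by linarith) (by linarith)) ?_ ?_ ?_ ?_ ?_ ?_).2
  · exact Eventually.of_forall (fun x => (by fun_prop : Continuous (f x)).aestronglyMeasurable)
  · exact (by fun_prop : Continuous (f t)).intervalIntegrable _ _
  · exact (by fun_prop : Continuous (f' t)).aestronglyMeasurable
  · exact Eventually.of_forall (fun θ hθ x hx => hC (x, θ) ⟨hx, uIoc_subset_uIcc hθ⟩)
  · exact intervalIntegrable_const
  · exact Eventually.of_forall (fun θ hθ x hx => h x θ)

lemma ftc {f : ℝ → ℝ} (hf : Continuous f) (a s : ℝ) :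
    HasDerivAt (fun s => ∫ x in a..s, f x) (f s) s := (hf.integral_hasStrictDerivAt a s).hasDerivAt

/-- one-dimensional radial ODE from its weak form -/
lemma ode1 {n : ℕ} (hn : 1 ≤ n) {w r : ℝ → ℝ} (hw : Continuous w) (hr : Continuous r)
    (hyp : ∀ a a1 a2 : ℝ → ℝ, (∀ s, HasDerivAt a (a1 s) s) → (∀ s, HasDerivAt a1 (a2 s) s) →
      Continuous a2 → ∀ S : ℝ, (∀ s, S ≤ s → a s = 0 ∧ a1 s = 0 ∧ a2 s = 0) →
      ∫ s in Ioi (0:ℝ), ((s ^ n * a2 s + n * s ^ (n - 1) * a1 s) * w s - s ^ (n - 1) * a s * r s) = 0) :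
    ∀ s, 0 ≤ s → w s = w 0 + ∫ σ in (0:ℝ)..s, ∫ θ in (0:ℝ)..1, θ ^ (n - 1) * r (θ * σ) := by
  set p : ℝ → ℝ := fun σ => ∫ θ in (0:ℝ)..1, θ ^ (n - 1) * r (θ * σ) with hp
  have hpc : Continuous p := by
    apply intervalIntegral.continuous_parametric_intervalIntegral_of_continuous' ; fun_prop
  set P : ℝ → ℝ := fun s => ∫ σ in (0:ℝ)..s, p σ with hP
  have hPd : ∀ s, HasDerivAt P (p s) s := fun s => ftc hpc _ s
  have hPc : Continuous P := continuous_iff_continuousAt.2 (fun s => (hPd s).continuousAt)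
  set R : ℝ → ℝ := fun s => ∫ σ in (0:ℝ)..s, σ ^ (n - 1) * r σ with hR
  have hRd : ∀ s, HasDerivAt R (s ^ (n - 1) * r s) s := fun s => ftc (by fun_prop) _ s
  have hRp : ∀ s, 0 < s → R s = s ^ n * p s := by
    intro s hs
    have h1 := intervalIntegral.integral_comp_mul_right (fun σ => σ ^ (n - 1) * r σ) hs.ne' (a := 0) (b := 1)
    simp only [zero_mul, one_mul, smul_eq_mul] at h1
    rw [hR, hp]
    simp only
    rw [eq_inv_mul_iff_mul_eq₀ hs.ne'] at h1
    rw [← h1]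
    have : ∀ θ : ℝ, (θ * s) ^ (n - 1) * r (θ * s) = s ^ (n - 1) * (θ ^ (n - 1) * r (θ * s)) := by
      intro θ; rw [mul_pow]; ring
    simp only [this, intervalIntegral.integral_const_mul]
    rw [← mul_assoc, ← pow_succ', Nat.sub_add_cancel hn]
  -- N is constant
  set N : ℝ → ℝ := fun s => w s - P s with hN
  have hNc : Continuous N := hw.sub hPc
  have key : ∀ s1 s2 : ℝ, 0 < s1 → s1 < s2 → ∀ ψ : ℝ → ℝ, Continuous ψ → (∀ s, s ≤ s1 → ψ s = 0) →
      (∀ s, s2 ≤ s → ψ s = 0) → ∫ s in s1..s2, ψ s = 0 → ∫ s in (0:ℝ)..s2, N s * ψ s = 0 := by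
    intro s1 s2 h1 h12 ψ hψ z1 z2 hnt
    have h2 : 0 < s2 := h1.trans h12
    set y : ℝ → ℝ := fun s => ∫ σ in s1..s, ψ σ with hy
    have hyd : ∀ s, HasDerivAt y (ψ s) s := fun s => ftc hψ _ s
    have hyc : Continuous y := continuous_iff_continuousAt.2 (fun s => (hyd s).continuousAt)
    have y1 : ∀ s, s ≤ s1 → y s = 0 := by
      intro s hs
      rw [hy]; simp only
      rw [intervalIntegral.integral_congr (g := fun _ => (0:ℝ))]
      · simp
      · intro σ hσ; rw [uIcc_of_ge hs] at hσ; exact z1 σ hσ.2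
    have y2 : ∀ s, s2 ≤ s → y s = 0 := by
      intro s hs
      rw [hy]; simp only
      rw [← intervalIntegral.integral_add_adjacent_intervals (hψ.intervalIntegrable s1 s2)
        (hψ.intervalIntegrable s2 s), hnt, zero_add, intervalIntegral.integral_congr (g := fun _ => (0:ℝ))]
      · simp
      · intro σ hσ; rw [uIcc_of_le hs] at hσ; exact z2 σ hσ.1
    set a1 : ℝ → ℝ := fun s => y s / s ^ n with ha1
    set a2 : ℝ → ℝ := fun s => (ψ s * s ^ n - y s * (n * s ^ (n - 1))) / (s ^ n) ^ 2 with ha2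
    have ha1d : ∀ s, HasDerivAt a1 (a2 s) s := by
      intro s
      rcases eq_or_ne s 0 with h0 | h0
      · have e : a1 =ᶠ[𝓝 s] fun _ => 0 := by
          filter_upwards [Iio_mem_nhds (show s < s1 by linarith)] with x hx
          simp [ha1, y1 x (le_of_lt hx)]
        have e2 : a2 s = 0 := by simp [ha2, y1 s (by linarith), z1 s (by linarith)]
        rw [e2]
        exact (hasDerivAt_const s (0:ℝ)).congr_of_eventuallyEq e
      · exact (hyd s).div (hasDerivAt_pow n s) (pow_ne_zero _ h0)
    have ha2c : Continuous a2 := by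
      rw [continuous_iff_continuousAt]
      intro s
      rcases eq_or_ne s 0 with h0 | h0
      · have e : a2 =ᶠ[𝓝 s] fun _ => 0 := by
          filter_upwards [Iio_mem_nhds (show s < s1 by linarith)] with x hx
          simp [ha2, y1 x (le_of_lt hx), z1 x (le_of_lt hx)]
        exact (continuousAt_const).congr e.symm
      · refine ContinuousAt.div (by fun_prop) (by fun_prop) (by positivity)
    have ha1c : Continuous a1 := continuous_iff_continuousAt.2 (fun s => (ha1d s).continuousAt)
    set a : ℝ → ℝ := fun s => ∫ σ in s2..s, a1 σ with ha
    have had : ∀ s, HasDerivAt a (a1 s) s := fun s => ftc ha1c _ s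
    have hac : Continuous a := continuous_iff_continuousAt.2 (fun s => (had s).continuousAt)
    have a1z : ∀ s, s2 ≤ s → a1 s = 0 := fun s hs => by simp [ha1, y2 s hs]
    have a2z : ∀ s, s2 ≤ s → a2 s = 0 := fun s hs => by simp [ha2, y2 s hs, z2 s hs]
    have az : ∀ s, s2 ≤ s → a s = 0 := by
      intro s hs
      rw [ha]; simp only
      rw [intervalIntegral.integral_congr (g := fun _ => (0:ℝ))]
      · simp
      · intro σ hσ; rw [uIcc_of_le hs] at hσ; exact a1z σ hσ.1
    have H := hyp a a1 a2 had ha1d ha2c s2 (fun s hs => ⟨az s hs, a1z s hs, a2z s hs⟩)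
    have H2 : ∫ s in (0:ℝ)..s2, (ψ s * w s - s ^ (n - 1) * r s * a s) = 0 := by
      rw [intervalIntegral.integral_of_le h2.le]
      refine Eq.trans ?_ H
      rw [setIntegral_eq_of_subset_of_forall_sdiff_eq_zero measurableSet_Ioi (Ioc_subset_Ioi_self : Ioc 0 s2 ⊆ Ioi 0)
        (f := fun s => ((s ^ n * a2 s + n * s ^ (n - 1) * a1 s) * w s - s ^ (n - 1) * a s * r s))]
      · refine setIntegral_congr_fun measurableSet_Ioc ?_
        intro s hs
        have hs0 : s ≠ 0 := hs.1.ne'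
        have : s ^ n * a2 s + n * s ^ (n - 1) * a1 s = ψ s := by
          simp only [ha1, ha2]; field_simp; ring
        simp only [this]; ring
      · intro s hs
        have : s2 ≤ s := by
          by_contra h
          exact hs.2 ⟨hs.1, by linarith⟩
        simp [az s this, a1z s this, a2z s this]
    have I1 := intervalIntegral.integral_deriv_mul_eq_sub (u := R) (v := a) (a := 0) (b := s2)
      (fun x _ => hRd x) (fun x _ => had x)
      ((by fun_prop : Continuous fun σ => σ ^ (n - 1) * r σ).intervalIntegrable _ _) (ha1c.intervalIntegrable _ _)
    have hR0 : R 0 = 0 := by simp [hR]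
    have hP0 : P 0 = 0 := by simp [hP]
    rw [hR0, az s2 le_rfl] at I1
    have I2 := intervalIntegral.integral_deriv_mul_eq_sub (u := P) (v := y) (a := 0) (b := s2)
      (fun x _ => hPd x) (fun x _ => hyd x)
      (hpc.intervalIntegrable _ _) (hψ.intervalIntegrable _ _)
    rw [hP0, y2 s2 le_rfl] at I2
    have e3 : ∫ s in (0:ℝ)..s2, (s ^ (n - 1) * r s * a s + R s * a1 s) =
        ∫ s in (0:ℝ)..s2, (s ^ (n - 1) * r s * a s + p s * y s) := by
      rw [intervalIntegral.integral_of_le h2.le, intervalIntegral.integral_of_le h2.le]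
      refine setIntegral_congr_fun measurableSet_Ioc ?_
      intro s hs
      have hs0 : s ≠ 0 := hs.1.ne'
      simp only [hRp s hs.1, ha1]; field_simp
    rw [e3] at I1
    have hRc : Continuous R := continuous_iff_continuousAt.2 (fun s => (hRd s).continuousAt)
    have : ∫ s in (0:ℝ)..s2, N s * ψ s = ∫ s in (0:ℝ)..s2, ((ψ s * w s - s ^ (n - 1) * r s * a s) +
        ((s ^ (n - 1) * r s * a s + p s * y s) - (p s * y s + P s * ψ s))) := by
      congr 1; ext s; simp only [hN]; ring
    rw [this, intervalIntegral.integral_add, intervalIntegral.integral_sub (f := fun s => (s ^ (n - 1) * r s * a s + p s * y s)), H2, I1, I2]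
    · simp
    all_goals (apply Continuous.intervalIntegrable; fun_prop)
  have const : ∀ s1 s2 : ℝ, 0 < s1 → s1 < s2 → ∃ c, ∀ s ∈ Ioo s1 s2, N s = c := by
    intro s1 s2 h1 h12
    set η : ℝ → ℝ := fun s => max 0 ((s - s1) * (s2 - s)) with hη
    have hηc : Continuous η := by fun_prop
    have ηpos : ∀ s ∈ Ioo s1 s2, 0 < η s := by
      intro s hs
      have := mul_pos (sub_pos.2 hs.1) (sub_pos.2 hs.2)
      exact lt_max_of_lt_right this
    have hη0 : ∀ s, 0 ≤ η s := fun s => le_max_left _ _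
    have e1 : ∀ s, s ≤ s1 → η s = 0 := by
      intro s hs; apply max_eq_left; nlinarith
    have e2 : ∀ s, s2 ≤ s → η s = 0 := by
      intro s hs; apply max_eq_left; nlinarith
    have hIpos : 0 < ∫ s in s1..s2, η s :=
      intervalIntegral.intervalIntegral_pos_of_pos_on (hηc.intervalIntegrable _ _) ηpos h12
    set c := (∫ s in s1..s2, η s * N s) / ∫ s in s1..s2, η s with hc
    refine ⟨c, ?_⟩
    have hz : ∫ s in s1..s2, η s * (N s - c) = 0 := by
      simp only [mul_sub]
      rw [intervalIntegral.integral_sub ((by fun_prop : Continuous fun s => η s * N s).intervalIntegrable _ _)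
        ((by fun_prop : Continuous fun s => η s * c).intervalIntegrable _ _), intervalIntegral.integral_mul_const, hc]
      field_simp; ring
    have hk := key s1 s2 h1 h12 (fun s => η s * (N s - c)) (by fun_prop)
      (fun s hs => by simp [e1 s hs]) (fun s hs => by simp [e2 s hs]) hz
    have hk2 : ∫ s in s1..s2, N s * (η s * (N s - c)) = 0 := by
      rw [← hk, ← intervalIntegral.integral_add_adjacent_intervals (a := 0) (b := s1) (c := s2)]
      · rw [intervalIntegral.integral_congr (a := 0) (b := s1) (g := fun _ => (0:ℝ))]
        · simp
        · intro σ hσ; rw [uIcc_of_le h1.le] at hσ; simp [e1 σ hσ.2]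
      all_goals (apply Continuous.intervalIntegrable; fun_prop)
    have hk3 : ∫ s in s1..s2, η s * (N s - c) ^ 2 = 0 := by
      have : ∀ s, η s * (N s - c) ^ 2 = N s * (η s * (N s - c)) - c * (η s * (N s - c)) := by intro s; ring
      simp only [this]
      rw [intervalIntegral.integral_sub, hk2, intervalIntegral.integral_const_mul, hz]
      · ring
      all_goals (apply Continuous.intervalIntegrable; fun_prop)
    intro s hs
    by_contra hne
    have : 0 < ∫ s in s1..s2, η s * (N s - c) ^ 2 := by
      refine intervalIntegral.integral_pos h12 (by fun_prop) (fun x _ => mul_nonneg (hη0 x) (sq_nonneg _))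
        ⟨s, ⟨hs.1.le, hs.2.le⟩, ?_⟩
      exact mul_pos (ηpos s hs) (by have := sub_ne_zero.2 hne; positivity)
    linarith
  have hall : ∀ s, 0 < s → N s = N 1 := by
    intro s hs
    obtain ⟨c, hc⟩ := const (min s 1 / 2) (max s 1 + 1) (by positivity) (by
      have h1 := min_le_left s 1; have h2 := le_max_left s 1; linarith)
    rw [hc s ⟨by have := min_le_left s 1; have : min s 1 > 0 := by positivity
                 linarith, by have := le_max_left s 1; linarith⟩, hc 1 ⟨by
                 have := min_le_right s 1; have : min s 1 > 0 := by positivity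
                 linarith, by have := le_max_right s 1; linarith⟩]
  have h0 : N 0 = N 1 := by
    have t1 : Tendsto N (𝓝[>] 0) (𝓝 (N 0)) := hNc.continuousAt.continuousWithinAt
    have t2 : Tendsto N (𝓝[>] 0) (𝓝 (N 1)) := by
      refine tendsto_const_nhds.congr' ?_
      filter_upwards [self_mem_nhdsWithin] with s hs using (hall s hs).symm
    exact tendsto_nhds_unique t1 t2
  intro s hs
  have : N s = N 0 := by
    rcases hs.eq_or_lt with h | h
    · rw [← h]
    · rw [hall s h, h0]
  simp only [hN] at this
  have hP0 : P 0 = 0 := by simp [hP]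
  rw [hP0] at this
  change w s = w 0 + P s
  linarith
end Heisenberg

namespace Heisenberg
open scoped ContDiff

structure IsK (κ : ℝ → ℝ) : Prop where
  smooth : ContDiff ℝ ∞ κ
  supp : tsupport κ ⊆ Icc (-1) 1

lemma IsK.hcs {κ : ℝ → ℝ} (h : IsK κ) : HasCompactSupport κ :=
  isCompact_Icc.of_isClosed_subset (isClosed_tsupport κ) h.supp
lemma IsK.deriv {κ : ℝ → ℝ} (h : IsK κ) : IsK (deriv κ) :=
  ⟨(contDiff_infty_iff_deriv.1 h.smooth).2, tsupport_deriv_subset.trans h.supp⟩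
lemma IsK.cont {κ : ℝ → ℝ} (h : IsK κ) : Continuous κ := h.smooth.continuous
lemma IsK.hasDerivAt {κ : ℝ → ℝ} (h : IsK κ) (t : ℝ) : HasDerivAt κ (_root_.deriv κ t) t :=
  (h.smooth.differentiable (by simp) t).hasDerivAt
lemma IsK.zero {κ : ℝ → ℝ} (h : IsK κ) {t : ℝ} (ht : t ∉ Icc (-1:ℝ) 1) : κ t = 0 :=
  image_eq_zero_of_notMem_tsupport (fun h' => ht (h.supp h'))

/-- mollification in t -/
def Mo (κ : ℝ → ℝ) (w : ℝ × ℝ → ℝ) (z : ℝ × ℝ) : ℝ := ∫ τ, w (z.1, τ) * κ (z.2 - τ)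

lemma Mo_eq {κ : ℝ → ℝ} (h : IsK κ) (w : ℝ × ℝ → ℝ) (z : ℝ × ℝ) :
    Mo κ w z = ∫ τ in Icc (-1:ℝ) 1, w (z.1, z.2 - τ) * κ τ := by
  unfold Mo
  rw [← integral_sub_left_eq_self (fun τ => w (z.1, τ) * κ (z.2 - τ)) volume z.2]
  rw [setIntegral_eq_integral_of_forall_compl_eq_zero]
  · simp
  · intro τ hτ; rw [h.zero hτ, mul_zero]

lemma Mo_cont {κ : ℝ → ℝ} (h : IsK κ) {w : ℝ × ℝ → ℝ} (hw : Continuous w) : Continuous (Mo κ w) := by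
  have e : Mo κ w = fun z => ∫ τ in Icc (-1:ℝ) 1, w (z.1, z.2 - τ) * κ τ := by
    ext z; exact Mo_eq h w z
  rw [e]
  have hc := h.cont
  exact continuous_parametric_integral_of_continuous
    (f := fun (z : ℝ × ℝ) (τ : ℝ) => w (z.1, z.2 - τ) * κ τ) (by fun_prop) isCompact_Icc

lemma Mo_deriv {κ : ℝ → ℝ} (h : IsK κ) {w : ℝ × ℝ → ℝ} (hw : Continuous w) (s t : ℝ) :
    HasDerivAt (fun t => Mo κ w (s, t)) (Mo (deriv κ) w (s, t)) t := by
  have := h.hcs.hasDerivAt_convolution_right (ContinuousLinearMap.mul ℝ ℝ) (μ := volume)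
    (f₀ := fun τ => w (s, τ)) (by fun_prop : Continuous fun τ => w (s, τ)).locallyIntegrable (h.smooth.of_le (by simp)) t
  exact this

lemma hp_eq {n : ℕ} (hn : 1 ≤ n) {u F : H n → ℝ} (hu : Continuous u) (hF : Continuous F)
    (hcyl : IsCylindrical u) (hsol : IsWeakSol univ u F) {u0 F0 : ℝ × ℝ → ℝ} (hu0 : Continuous u0)
    (hF0 : Continuous F0) (eu : ∀ ξ, u ξ = u0 (piH ξ)) (eF : ∀ ξ, F ξ = F0 (piH ξ))
    {a a1 a2 b b1 b2 : ℝ → ℝ}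
    (ha : ∀ s, HasDerivAt a (a1 s) s) (ha1 : ∀ s, HasDerivAt a1 (a2 s) s) (ha2 : Continuous a2)
    (hb : ∀ s, HasDerivAt b (b1 s) s) (hb1 : ∀ s, HasDerivAt b1 (b2 s) s) (hb2 : Continuous b2)
    (R : ℝ) (haR : ∀ s, R < s → a s = 0) (hbc : HasCompactSupport b) :
    ∫ z in Ioi (0:ℝ) ×ˢ univ, z.1 ^ (n - 1) * (u0 z * (4 * ((z.1 * a2 z.1 + n * a1 z.1) * b z.2 +
      z.1 * a z.1 * b2 z.2)) + F0 z * (a z.1 * b z.2)) = 0 := by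
  obtain ⟨c, hc, -, h2⟩ := lintegral_piH hn
  have h := distr_eq hu hF hcyl hsol ha ha1 ha2 hb hb1 hb2 R haR hbc
  have hac : Continuous a := continuous_iff_continuousAt.2 (fun s => (ha s).continuousAt)
  have ha1c : Continuous a1 := continuous_iff_continuousAt.2 (fun s => (ha1 s).continuousAt)
  have hbc : Continuous b := continuous_iff_continuousAt.2 (fun s => (hb s).continuousAt)
  have := h2 (fun z => (u0 z * (4 * ((z.1 * a2 z.1 + n * a1 z.1) * b z.2 +
      z.1 * a z.1 * b2 z.2)) + F0 z * (a z.1 * b z.2))) (by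
      apply Continuous.measurable; fun_prop)
  simp only [eu, eF] at h
  rw [show (∫ ξ : H n, (fun z : ℝ × ℝ => (u0 z * (4 * ((z.1 * a2 z.1 + n * a1 z.1) * b z.2 +
      z.1 * a z.1 * b2 z.2)) + F0 z * (a z.1 * b z.2))) (piH ξ)) = 0 from h] at this
  have := (mul_eq_zero.1 this.symm).resolve_left hc.ne'
  exact this

def rK (κ : ℝ → ℝ) (u0 F0 : ℝ × ℝ → ℝ) (z : ℝ × ℝ) : ℝ :=
  -(Mo κ F0 z / 4 + z.1 * Mo (deriv (deriv κ)) u0 z)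
def pK (n : ℕ) (κ : ℝ → ℝ) (u0 F0 : ℝ × ℝ → ℝ) (z : ℝ × ℝ) : ℝ :=
  ∫ θ in (0:ℝ)..1, θ ^ (n - 1) * rK κ u0 F0 (θ * z.1, z.2)
def uK (n : ℕ) (κ : ℝ → ℝ) (u0 F0 : ℝ × ℝ → ℝ) (z : ℝ × ℝ) : ℝ :=
  Mo κ u0 (0, z.2) + ∫ σ in (0:ℝ)..z.1, pK n κ u0 F0 (σ, z.2)

section
variable {n : ℕ} {κ : ℝ → ℝ} {u0 F0 : ℝ × ℝ → ℝ}

lemma rK_cont (h : IsK κ) (hu0 : Continuous u0) (hF0 : Continuous F0) : Continuous (rK κ u0 F0) := by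
  have h1 := Mo_cont h hF0
  have h2 := Mo_cont h.deriv.deriv hu0
  unfold rK; fun_prop
lemma pK_cont (h : IsK κ) (hu0 : Continuous u0) (hF0 : Continuous F0) : Continuous (pK n κ u0 F0) := by
  have h1 := rK_cont h hu0 hF0
  unfold pK
  exact intervalIntegral.continuous_parametric_intervalIntegral_of_continuous'
    (f := fun (z : ℝ × ℝ) (θ : ℝ) => θ ^ (n - 1) * rK κ u0 F0 (θ * z.1, z.2)) (by fun_prop) _ _
lemma uK_cont (h : IsK κ) (hu0 : Continuous u0) (hF0 : Continuous F0) : Continuous (uK n κ u0 F0) := by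
  have h1 := pK_cont (n := n) h hu0 hF0
  have h2 := Mo_cont h hu0
  unfold uK
  have := intervalIntegral.continuous_parametric_intervalIntegral_of_continuous (μ := volume) (a₀ := 0)
    (f := fun (z : ℝ × ℝ) (σ : ℝ) => pK n κ u0 F0 (σ, z.2)) (by fun_prop) (s := fun z => z.1) continuous_fst
  fun_prop

lemma rK_dt (h : IsK κ) (hu0 : Continuous u0) (hF0 : Continuous F0) (s t : ℝ) :
    HasDerivAt (fun t => rK κ u0 F0 (s, t)) (rK (deriv κ) u0 F0 (s, t)) t := by
  unfold rK
  exact (((Mo_deriv h hF0 s t).div_const 4).add ((Mo_deriv h.deriv.deriv hu0 s t).const_mul s)).neg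

lemma pK_dt (h : IsK κ) (hu0 : Continuous u0) (hF0 : Continuous F0) (s t : ℝ) :
    HasDerivAt (fun t => pK n κ u0 F0 (s, t)) (pK n (deriv κ) u0 F0 (s, t)) t := by
  have h1 := rK_cont h hu0 hF0
  have h2 := rK_cont h.deriv hu0 hF0
  exact hasDerivAt_param (f := fun t θ => θ ^ (n - 1) * rK κ u0 F0 (θ * s, t))
    (f' := fun t θ => θ ^ (n - 1) * rK (deriv κ) u0 F0 (θ * s, t)) (by fun_prop) (by fun_prop)
    (fun t θ => (rK_dt h hu0 hF0 (θ * s) t).const_mul _) 0 1 t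

lemma uK_dt (h : IsK κ) (hu0 : Continuous u0) (hF0 : Continuous F0) (s t : ℝ) :
    HasDerivAt (fun t => uK n κ u0 F0 (s, t)) (uK n (deriv κ) u0 F0 (s, t)) t := by
  have h1 := pK_cont (n := n) h hu0 hF0
  have h2 := pK_cont (n := n) h.deriv hu0 hF0
  exact (Mo_deriv h hu0 0 t).add (hasDerivAt_param (f := fun t σ => pK n κ u0 F0 (σ, t))
    (f' := fun t σ => pK n (deriv κ) u0 F0 (σ, t)) (by fun_prop) (by fun_prop)
    (fun t σ => pK_dt h hu0 hF0 σ t) 0 s t)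

lemma uK_ds (h : IsK κ) (hu0 : Continuous u0) (hF0 : Continuous F0) (s t : ℝ) :
    HasDerivAt (fun s => uK n κ u0 F0 (s, t)) (pK n κ u0 F0 (s, t)) s := by
  have h1 := pK_cont (n := n) h hu0 hF0
  exact (ftc (f := fun σ => pK n κ u0 F0 (σ, t)) (by fun_prop) 0 s).const_add (Mo κ u0 (0, t))

lemma pK_ds (hn : 1 ≤ n) (h : IsK κ) (hu0 : Continuous u0) (hF0 : Continuous F0) (s t : ℝ) (hs : 0 < s) :
    HasDerivAt (fun s => pK n κ u0 F0 (s, t)) ((rK κ u0 F0 (s, t) - n * pK n κ u0 F0 (s, t)) / s) s := by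
  have hr := rK_cont h hu0 hF0
  set R : ℝ → ℝ := fun s => ∫ σ in (0:ℝ)..s, σ ^ (n - 1) * rK κ u0 F0 (σ, t) with hR
  have hRd : HasDerivAt R (s ^ (n - 1) * rK κ u0 F0 (s, t)) s :=
    ftc (f := fun σ => σ ^ (n - 1) * rK κ u0 F0 (σ, t)) (by fun_prop) _ s
  have hRp : ∀ s, 0 < s → R s = s ^ n * pK n κ u0 F0 (s, t) := by
    intro s hs
    have h1 := intervalIntegral.integral_comp_mul_right (fun σ => σ ^ (n - 1) * rK κ u0 F0 (σ, t)) hs.ne' (a := 0) (b := 1)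
    simp only [zero_mul, one_mul, smul_eq_mul] at h1
    rw [hR]
    unfold pK
    simp only
    rw [eq_inv_mul_iff_mul_eq₀ hs.ne'] at h1
    rw [← h1]
    have : ∀ θ : ℝ, (θ * s) ^ (n - 1) * rK κ u0 F0 (θ * s, t) = s ^ (n - 1) * (θ ^ (n - 1) * rK κ u0 F0 (θ * s, t)) := by
      intro θ; rw [mul_pow]; ring
    simp only [this, intervalIntegral.integral_const_mul]
    rw [← mul_assoc, ← pow_succ', Nat.sub_add_cancel hn]
  have e : (fun s => pK n κ u0 F0 (s, t)) =ᶠ[𝓝 s] fun s => R s / s ^ n := by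
    filter_upwards [Ioi_mem_nhds hs] with x hx
    have hx : 0 < x := hx
    rw [hRp x hx]; field_simp
  refine HasDerivAt.congr_of_eventuallyEq ?_ e
  have ev : (rK κ u0 F0 (s, t) - n * pK n κ u0 F0 (s, t)) / s =
      (s ^ (n - 1) * rK κ u0 F0 (s, t) * s ^ n - R s * (n * s ^ (n - 1))) / (s ^ n) ^ 2 := by
    rw [hRp s hs]
    have : s ^ n = s ^ (n - 1) * s := by rw [← pow_succ, Nat.sub_add_cancel hn]
    rw [this]
    have h3 := hs.ne'
    field_simp
  rw [ev]
  exact hRd.div (hasDerivAt_pow n s) (pow_ne_zero _ hs.ne')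

lemma uK_contDiff (h : IsK κ) (hu0 : Continuous u0) (hF0 : Continuous F0) :
    ContDiff ℝ 1 (uK n κ u0 F0) := by
  rw [← contDiffOn_univ]
  exact partial_contDiffOn isOpen_univ (fun z _ => uK_ds h hu0 hF0 z.1 z.2) (fun z _ => uK_dt h hu0 hF0 z.1 z.2)
    (pK_cont h hu0 hF0).continuousOn (uK_cont h.deriv hu0 hF0).continuousOn

lemma isOpen_pos : IsOpen {z : ℝ × ℝ | 0 < z.1} := isOpen_lt continuous_const continuous_fst

lemma pKs_cont (h : IsK κ) (hu0 : Continuous u0) (hF0 : Continuous F0) :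
    ContinuousOn (fun z => (rK κ u0 F0 z - n * pK n κ u0 F0 z) / z.1) {z : ℝ × ℝ | 0 < z.1} := by
  refine ContinuousOn.div ?_ continuous_fst.continuousOn (fun z hz => (ne_of_gt hz))
  exact ((rK_cont h hu0 hF0).sub (continuous_const.mul (pK_cont h hu0 hF0))).continuousOn

lemma uK_contDiff_two (hn : 1 ≤ n) (h : IsK κ) (hu0 : Continuous u0) (hF0 : Continuous F0) :
    ContDiffOn ℝ 2 (uK n κ u0 F0) {z | 0 < z.1} := by
  refine partial_contDiffOn_two isOpen_pos (fun z _ => uK_ds h hu0 hF0 z.1 z.2) (fun z _ => uK_dt h hu0 hF0 z.1 z.2)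
    ?_ (uK_contDiff h.deriv hu0 hF0).contDiffOn
  exact partial_contDiffOn isOpen_pos (fun z hz => pK_ds hn h hu0 hF0 z.1 z.2 hz)
    (fun z _ => pK_dt h hu0 hF0 z.1 z.2) (pKs_cont h hu0 hF0) (pK_cont h.deriv hu0 hF0).continuousOn

lemma uK_pds (h : IsK κ) (hu0 : Continuous u0) (hF0 : Continuous F0) :
    pds (uK n κ u0 F0) = pK n κ u0 F0 := by
  ext z
  exact pds_of (partial_fderiv isOpen_univ (fun z _ => uK_ds h hu0 hF0 z.1 z.2) (fun z _ => uK_dt h hu0 hF0 z.1 z.2)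
    (pK_cont h hu0 hF0).continuousOn (uK_cont h.deriv hu0 hF0).continuousOn z (mem_univ _))
lemma uK_pdt (h : IsK κ) (hu0 : Continuous u0) (hF0 : Continuous F0) :
    pdt (uK n κ u0 F0) = uK n (deriv κ) u0 F0 := by
  ext z
  exact pdt_of (partial_fderiv isOpen_univ (fun z _ => uK_ds h hu0 hF0 z.1 z.2) (fun z _ => uK_dt h hu0 hF0 z.1 z.2)
    (pK_cont h hu0 hF0).continuousOn (uK_cont h.deriv hu0 hF0).continuousOn z (mem_univ _))
lemma pK_pds (hn : 1 ≤ n) (h : IsK κ) (hu0 : Continuous u0) (hF0 : Continuous F0) {z : ℝ × ℝ} (hz : 0 < z.1) :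
    pds (pK n κ u0 F0) z = (rK κ u0 F0 z - n * pK n κ u0 F0 z) / z.1 := by
  exact pds_of (partial_fderiv isOpen_pos (fun z hz => pK_ds hn h hu0 hF0 z.1 z.2 hz)
    (fun z _ => pK_dt h hu0 hF0 z.1 z.2) (pKs_cont h hu0 hF0) (pK_cont h.deriv hu0 hF0).continuousOn z hz)

end

/-- on the half plane the function uK is the mollification. -/
lemma uK_eq {n : ℕ} (hn : 1 ≤ n) {u F : H n → ℝ} (hu : Continuous u) (hF : Continuous F)
    (hcyl : IsCylindrical u) (hsol : IsWeakSol univ u F) {u0 F0 : ℝ × ℝ → ℝ} (hu0 : Continuous u0)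
    (hF0 : Continuous F0) (eu : ∀ ξ, u ξ = u0 (piH ξ)) (eF : ∀ ξ, F ξ = F0 (piH ξ)) {κ : ℝ → ℝ} (h : IsK κ) :
    ∀ z : ℝ × ℝ, 0 ≤ z.1 → uK n κ u0 F0 z = Mo κ u0 z := by
  rintro ⟨s0, t⟩ hs0
  have cMu := Mo_cont h hu0
  have cMF := Mo_cont h hF0
  have cMu2 := Mo_cont h.deriv.deriv hu0
  have cr := rK_cont h hu0 hF0
  have := ode1 hn (w := fun s => Mo κ u0 (s, t)) (r := fun s => rK κ u0 F0 (s, t)) (by fun_prop) (by fun_prop) ?_ s0 hs0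
  · rw [this]; rfl
  intro a a1 a2 ha ha1 ha2 S hS
  have hac : Continuous a := continuous_iff_continuousAt.2 (fun s => (ha s).continuousAt)
  have ha1c : Continuous a1 := continuous_iff_continuousAt.2 (fun s => (ha1 s).continuousAt)
  have hb : ∀ {κ : ℝ → ℝ}, IsK κ → ∀ τ, HasDerivAt (fun τ => κ (t - τ)) (- deriv κ (t - τ)) τ := by
    intro κ h τ
    have := (h.hasDerivAt (t - τ)).comp τ ((hasDerivAt_id τ).const_sub t)
    simpa [Function.comp_def] using this
  have hb2 : ∀ τ, HasDerivAt (fun τ => - deriv κ (t - τ)) (deriv (deriv κ) (t - τ)) τ := by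
    intro τ; simpa using (hb h.deriv τ).fun_neg
  have c0 := h.cont
  have c2 := h.deriv.deriv.cont
  have H := hp_eq hn hu hF hcyl hsol hu0 hF0 eu eF ha ha1 ha2 (hb h) hb2 (by fun_prop) S
    (fun s hs => (hS s hs.le).1) (h.hcs.comp_homeomorph (Homeomorph.subLeft t))
  rw [Measure.volume_eq_prod, setIntegral_prod] at H
  · have e : ∀ s, (∫ τ in univ, s ^ (n - 1) * (u0 (s, τ) * (4 * ((s * a2 s + n * a1 s) * κ (t - τ) +
      s * a s * deriv (deriv κ) (t - τ))) + F0 (s, τ) * (a s * κ (t - τ)))) =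
      4 * ((s ^ n * a2 s + n * s ^ (n - 1) * a1 s) * Mo κ u0 (s, t) - s ^ (n - 1) * a s * rK κ u0 F0 (s, t)) := by
      intro s
      rw [setIntegral_univ]
      have e2 : ∀ τ, s ^ (n - 1) * (u0 (s, τ) * (4 * ((s * a2 s + n * a1 s) * κ (t - τ) +
        s * a s * deriv (deriv κ) (t - τ))) + F0 (s, τ) * (a s * κ (t - τ))) =
        (4 * s ^ (n - 1) * (s * a2 s + n * a1 s)) * (u0 (s, τ) * κ (t - τ)) +
        (4 * s ^ (n - 1) * s * a s) * (u0 (s, τ) * deriv (deriv κ) (t - τ)) +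
        (s ^ (n - 1) * a s) * (F0 (s, τ) * κ (t - τ)) := by intro τ; ring
      have I : ∀ {w : ℝ × ℝ → ℝ} {κ : ℝ → ℝ}, Continuous w → IsK κ → Integrable (fun τ => w (s, τ) * κ (t - τ)) := by
        intro w κ hw h
        have := h.cont
        refine Continuous.integrable_of_hasCompactSupport (by fun_prop) ?_
        exact (h.hcs.comp_homeomorph (Homeomorph.subLeft t)).mul_left
      simp only [e2]
      have J : Integrable (fun τ => (4 * s ^ (n - 1) * (s * a2 s + n * a1 s)) * (u0 (s, τ) * κ (t - τ)) +
        (4 * s ^ (n - 1) * s * a s) * (u0 (s, τ) * deriv (deriv κ) (t - τ))) :=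
        ((I hu0 h).const_mul _).add ((I hu0 h.deriv.deriv).const_mul _)
      rw [integral_add J ((I hF0 h).const_mul _),
        integral_add ((I hu0 h).const_mul _) ((I hu0 h.deriv.deriv).const_mul _)]
      rw [integral_const_mul, integral_const_mul, integral_const_mul]
      unfold rK Mo
      have : s ^ n = s ^ (n - 1) * s := by rw [← pow_succ, Nat.sub_add_cancel hn]
      simp only [this]; ring
    simp only [e] at H
    rw [integral_const_mul] at H
    linarith
  · have : IntegrableOn (fun z : ℝ × ℝ => z.1 ^ (n - 1) * (u0 z * (4 * ((z.1 * a2 z.1 + n * a1 z.1) * κ (t - z.2) +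
      z.1 * a z.1 * deriv (deriv κ) (t - z.2))) + F0 z * (a z.1 * κ (t - z.2)))) (Icc 0 S ×ˢ Icc (t - 1) (t + 1)) volume := by
      apply ContinuousOn.integrableOn_compact (isCompact_Icc.prod isCompact_Icc)
      apply Continuous.continuousOn
      fun_prop
    refine this.of_forall_sdiff_eq_zero (measurableSet_Ioi.prod MeasurableSet.univ) ?_
    rintro ⟨s, τ⟩ ⟨hz1, hz2⟩
    have hs : 0 < s := hz1.1
    by_cases hsS : S ≤ s
    · obtain ⟨q1, q2, q3⟩ := hS s hsS
      simp [q1, q2, q3]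
    · have : t - τ ∉ Icc (-1:ℝ) 1 := by
        intro hh
        apply hz2
        exact ⟨⟨hs.le, by linarith⟩, ⟨by linarith [hh.2], by linarith [hh.1]⟩⟩
      simp [h.zero this, h.deriv.deriv.zero this]

/-- packaged classical approximations -/
structure Cls (n : ℕ) (U : Set (ℝ × ℝ)) (W B : ℝ × ℝ → ℝ) : Prop where
  c1 : ContDiffOn ℝ 1 W U
  c2 : ContDiffOn ℝ 2 W (U ∩ {z | 0 < z.1})
  pde : ∀ z ∈ U, 0 < z.1 → z.1 * pds (pds W) z + n * pds W z + z.1 * pdt (pdt W) z = - (B z / 4)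

lemma uK_cls {n : ℕ} (hn : 1 ≤ n) {u F : H n → ℝ} (hu : Continuous u) (hF : Continuous F)
    (hcyl : IsCylindrical u) (hsol : IsWeakSol univ u F) {u0 F0 : ℝ × ℝ → ℝ} (hu0 : Continuous u0)
    (hF0 : Continuous F0) (eu : ∀ ξ, u ξ = u0 (piH ξ)) (eF : ∀ ξ, F ξ = F0 (piH ξ)) {κ : ℝ → ℝ} (h : IsK κ) :
    Cls n univ (uK n κ u0 F0) (Mo κ F0) := by
  refine ⟨(uK_contDiff h hu0 hF0).contDiffOn, (uK_contDiff_two hn h hu0 hF0).mono (by simp), ?_⟩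
  intro z _ hz
  rw [uK_pds h hu0 hF0, uK_pdt h hu0 hF0, uK_pdt h.deriv hu0 hF0, pK_pds hn h hu0 hF0 hz]
  have hue := fun z hz => uK_eq hn hu hF hcyl hsol hu0 hF0 eu eF h z hz
  -- second t-derivative
  have e2 : uK n (deriv (deriv κ)) u0 F0 z = Mo (deriv (deriv κ)) u0 z :=
    uK_eq hn hu hF hcyl hsol hu0 hF0 eu eF h.deriv.deriv z hz.le
  rw [e2]
  unfold rK
  field_simp
  ring
end Heisenberg

namespace Heisenberg
open scoped ContDiff

/-! mini calculus with `lin2` -/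
lemma l2_congr {f : ℝ × ℝ → ℝ} {z : ℝ × ℝ} {a b a' b' : ℝ} (h : HasFDerivAt f (lin2 a b) z)
    (ha : a = a') (hb : b = b') : HasFDerivAt f (lin2 a' b') z := by rw [← ha, ← hb]; exact h
lemma l2_add {f g : ℝ × ℝ → ℝ} {z : ℝ × ℝ} {a b a' b' : ℝ} (h : HasFDerivAt f (lin2 a b) z)
    (h' : HasFDerivAt g (lin2 a' b') z) : HasFDerivAt (fun z => f z + g z) (lin2 (a + a') (b + b')) z := by
  have e : lin2 (a + a') (b + b') = lin2 a b + lin2 a' b' := by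
    ext <;> simp [lin2_apply]
  rw [e]; exact h.add h'
lemma l2_sub {f g : ℝ × ℝ → ℝ} {z : ℝ × ℝ} {a b a' b' : ℝ} (h : HasFDerivAt f (lin2 a b) z)
    (h' : HasFDerivAt g (lin2 a' b') z) : HasFDerivAt (fun z => f z - g z) (lin2 (a - a') (b - b')) z := by
  have e : lin2 (a - a') (b - b') = lin2 a b - lin2 a' b' := by
    ext <;> simp [lin2_apply]
  rw [e]; exact h.sub h'
lemma l2_mul {f g : ℝ × ℝ → ℝ} {z : ℝ × ℝ} {a b a' b' : ℝ} (h : HasFDerivAt f (lin2 a b) z)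
    (h' : HasFDerivAt g (lin2 a' b') z) :
    HasFDerivAt (fun z => f z * g z) (lin2 (f z * a' + g z * a) (f z * b' + g z * b)) z := by
  have e : lin2 (f z * a' + g z * a) (f z * b' + g z * b) = f z • lin2 a' b' + g z • lin2 a b := by
    ext <;> simp [lin2_apply]
  rw [e]; exact h.mul h'
lemma l2_comp1 {f : ℝ × ℝ → ℝ} {g : ℝ → ℝ} {z : ℝ × ℝ} {a b d : ℝ} (h : HasFDerivAt f (lin2 a b) z)
    (h' : HasDerivAt g d (f z)) : HasFDerivAt (fun z => g (f z)) (lin2 (d * a) (d * b)) z := by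
  have e : lin2 (d * a) (d * b) = d • lin2 a b := by
    ext <;> simp [lin2_apply]
  rw [e]; exact h'.comp_hasFDerivAt z h
lemma l2_const (c : ℝ) (z : ℝ × ℝ) : HasFDerivAt (fun _ : ℝ × ℝ => c) (lin2 0 0) z := by
  have e : lin2 0 0 = 0 := by ext <;> simp [lin2_apply]
  rw [e]; exact hasFDerivAt_const c z
lemma l2_fst (z : ℝ × ℝ) : HasFDerivAt (fun z : ℝ × ℝ => z.1) (lin2 1 0) z := by
  have e : lin2 1 0 = ContinuousLinearMap.fst ℝ ℝ ℝ := by ext <;> simp [lin2_apply]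
  rw [e]; exact hasFDerivAt_fst
lemma l2_snd (z : ℝ × ℝ) : HasFDerivAt (fun z : ℝ × ℝ => z.2) (lin2 0 1) z := by
  have e : lin2 0 1 = ContinuousLinearMap.snd ℝ ℝ ℝ := by ext <;> simp [lin2_apply]
  rw [e]; exact hasFDerivAt_snd
lemma l2_comp {W P R : ℝ × ℝ → ℝ} {z : ℝ × ℝ} {a b ps pt rs rt : ℝ}
    (hW : HasFDerivAt W (lin2 a b) (P z, R z)) (hP : HasFDerivAt P (lin2 ps pt) z)
    (hR : HasFDerivAt R (lin2 rs rt) z) :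
    HasFDerivAt (fun z => W (P z, R z)) (lin2 (a * ps + b * rs) (a * pt + b * rt)) z := by
  have e : lin2 (a * ps + b * rs) (a * pt + b * rt) = (lin2 a b).comp ((lin2 ps pt).prod (lin2 rs rt)) := by
    ext <;> simp [lin2_apply]
  rw [e]; exact HasFDerivAt.comp (f := fun z => (P z, R z)) z hW (hP.prodMk hR)
lemma l2_div {f g : ℝ × ℝ → ℝ} {z : ℝ × ℝ} {a b a' b' : ℝ} (h : HasFDerivAt f (lin2 a b) z)
    (h' : HasFDerivAt g (lin2 a' b') z) (hg : g z ≠ 0) :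
    HasFDerivAt (fun z => f z / g z) (lin2 ((a * g z - f z * a') / g z ^ 2) ((b * g z - f z * b') / g z ^ 2)) z := by
  have := l2_mul h (l2_comp1 (g := fun x => x⁻¹) h' (hasDerivAt_inv hg))
  simp only [div_eq_mul_inv]
  refine l2_congr this ?_ ?_ <;> field_simp <;> ring
lemma l2_diff {f : ℝ × ℝ → ℝ} {z : ℝ × ℝ} {a b : ℝ} (h : HasFDerivAt f (lin2 a b) z) : 
    DifferentiableAt ℝ f z := h.differentiableAt

/-- squared euclidean norm on the half plane -/
def na (z : ℝ × ℝ) : ℝ := z.1 ^ 2 + z.2 ^ 2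
/-- the inversion -/
def Tinv (z : ℝ × ℝ) : ℝ × ℝ := (z.1 / na z, -z.2 / na z)
def mK (n : ℕ) (z : ℝ × ℝ) : ℝ := (√(na z) ^ n)⁻¹
def kel (n : ℕ) (W : ℝ × ℝ → ℝ) (z : ℝ × ℝ) : ℝ := mK n z * W (Tinv z)
def kelB (n : ℕ) (F : ℝ × ℝ → ℝ) (z : ℝ × ℝ) : ℝ := mK n z / na z * F (Tinv z)

lemma na_pos {z : ℝ × ℝ} (hz : z ≠ 0) : 0 < na z := by
  unfold na
  rcases eq_or_ne z.1 0 with h1 | h1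
  · have : z.2 ≠ 0 := fun h2 => hz (Prod.ext h1 h2)
    positivity
  · positivity
lemma na_nonneg (z : ℝ × ℝ) : 0 ≤ na z := by unfold na; positivity
lemma continuous_na : Continuous na := by unfold na; fun_prop

lemma l2_na (z : ℝ × ℝ) : HasFDerivAt na (lin2 (2 * z.1) (2 * z.2)) z := by
  refine l2_congr (l2_add (l2_comp1 (l2_fst z) (hasDerivAt_pow 2 z.1)) (l2_comp1 (l2_snd z) (hasDerivAt_pow 2 z.2))) ?_ ?_ <;> simp

lemma hasDerivAt_mk (n : ℕ) {x : ℝ} (hx : 0 < x) :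
    HasDerivAt (fun x => (√x ^ n)⁻¹) (-(n / 2) / x * (√x ^ n)⁻¹) x := by
  have h1 := ((hasDerivAt_sqrt hx.ne').pow n).inv (pow_ne_zero _ (sqrt_pos.2 hx).ne')
  have hq := sqrt_pos.2 hx
  have : -(n / 2) / x * (√x ^ n)⁻¹ = -(n * √x ^ (n - 1) * (1 / (2 * √x))) / (√x ^ n) ^ 2 := by
    have hx2 : x = √x * √x := (mul_self_sqrt hx.le).symm
    rcases n with _ | n
    · simp
    · simp only [Nat.add_sub_cancel, pow_succ]
      have e : -(((n + 1 : ℕ) : ℝ) / 2) / x = -(((n + 1 : ℕ) : ℝ) / 2) / (√x * √x) := by rw [← hx2]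
      rw [e]; field_simp
  rw [this]; exact h1

lemma l2_mK (n : ℕ) {z : ℝ × ℝ} (hz : z ≠ 0) :
    HasFDerivAt (mK n) (lin2 (-(n * z.1 / na z) * mK n z) (-(n * z.2 / na z) * mK n z)) z := by
  have := l2_comp1 (l2_na z) (hasDerivAt_mk n (na_pos hz))
  have h := (na_pos hz).ne'
  refine l2_congr this ?_ ?_ <;> · unfold mK; field_simp

def cA (z : ℝ × ℝ) : ℝ := (z.2 ^ 2 - z.1 ^ 2) / na z ^ 2
def cB (z : ℝ × ℝ) : ℝ := 2 * z.1 * z.2 / na z ^ 2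

lemma l2_P {z : ℝ × ℝ} (hz : z ≠ 0) : HasFDerivAt (fun z => z.1 / na z) (lin2 (cA z) (-cB z)) z := by
  have h := (na_pos hz).ne'
  refine l2_congr (l2_div (l2_fst z) (l2_na z) h) ?_ ?_
  · unfold cA; congr 1; unfold na; ring
  · unfold cB; rw [← neg_div]; congr 1; unfold na; ring
lemma l2_R {z : ℝ × ℝ} (hz : z ≠ 0) : HasFDerivAt (fun z : ℝ × ℝ => -z.2 / na z) (lin2 (cB z) (cA z)) z := by
  have h := (na_pos hz).ne'
  have h2 : HasFDerivAt (fun z : ℝ × ℝ => -z.2) (lin2 0 (-1)) z :=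
    l2_congr (l2_comp1 (l2_snd z) (hasDerivAt_neg _)) (by simp) (by simp)
  refine l2_congr (l2_div h2 (l2_na z) h) ?_ ?_
  · unfold cB; congr 1; ring
  · unfold cA; congr 1; unfold na; ring
lemma l2_na2 (z : ℝ × ℝ) : HasFDerivAt (fun z => na z ^ 2) (lin2 (4 * z.1 * na z) (4 * z.2 * na z)) z := by
  refine l2_congr (l2_comp1 (l2_na z) (hasDerivAt_pow 2 _)) ?_ ?_ <;> · simp; ring

lemma l2_cA {z : ℝ × ℝ} (hz : z ≠ 0) : HasFDerivAt cA
    (lin2 (-2 * z.1 / na z ^ 2 - (z.2 ^ 2 - z.1 ^ 2) * 4 * z.1 / na z ^ 3)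
      (2 * z.2 / na z ^ 2 - (z.2 ^ 2 - z.1 ^ 2) * 4 * z.2 / na z ^ 3)) z := by
  have h := (na_pos hz).ne'
  have := l2_div (l2_sub (l2_comp1 (l2_snd z) (hasDerivAt_pow 2 z.2)) (l2_comp1 (l2_fst z) (hasDerivAt_pow 2 z.1)))
    (l2_na2 z) (pow_ne_zero 2 h)
  refine l2_congr this ?_ ?_ <;> · field_simp; try ring
lemma l2_cB {z : ℝ × ℝ} (hz : z ≠ 0) : HasFDerivAt cB
    (lin2 (2 * z.2 / na z ^ 2 - 8 * z.1 ^ 2 * z.2 / na z ^ 3)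
      (2 * z.1 / na z ^ 2 - 8 * z.1 * z.2 ^ 2 / na z ^ 3)) z := by
  have h := (na_pos hz).ne'
  have := l2_div (l2_mul (l2_mul (l2_const 2 z) (l2_fst z)) (l2_snd z)) (l2_na2 z) (pow_ne_zero 2 h)
  refine l2_congr this ?_ ?_ <;> · field_simp; try ring

lemma l2_inv {z : ℝ × ℝ} (hz : z ≠ 0) (c : ℝ) : HasFDerivAt (fun z => c / na z)
    (lin2 (-2 * c * z.1 / na z ^ 2) (-2 * c * z.2 / na z ^ 2)) z := by
  have h := (na_pos hz).ne'
  refine l2_congr (l2_div (l2_const c z) (l2_na z) h) ?_ ?_ <;> · field_simp; try ring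

lemma l2_kel {n : ℕ} {W : ℝ × ℝ → ℝ} {z : ℝ × ℝ} (hz : z ≠ 0) (hW : DifferentiableAt ℝ W (Tinv z)) :
    HasFDerivAt (kel n W)
      (lin2 (mK n z * (-n * (z.1 / na z) * W (Tinv z) + cA z * pds W (Tinv z) + cB z * pdt W (Tinv z)))
        (mK n z * (n * (-z.2 / na z) * W (Tinv z) - cB z * pds W (Tinv z) + cA z * pdt W (Tinv z)))) z := by
  have := l2_mul (l2_mK n hz) (l2_comp (hasFDerivAt_lin2 hW) (l2_P hz) (l2_R hz))
  refine l2_congr this ?_ ?_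
  · rw [show (z.1 / na z, -z.2 / na z) = Tinv z from rfl]; ring
  · rw [show (z.1 / na z, -z.2 / na z) = Tinv z from rfl]; ring

lemma Tinv_contDiffOn {k : WithTop ℕ∞} : ContDiffOn ℝ k Tinv {0}ᶜ := by
  intro z hz
  have h := (na_pos hz).ne'
  unfold Tinv
  have h1 : ContDiffWithinAt ℝ k na {0}ᶜ z := by unfold na; fun_prop
  exact ((contDiff_fst.contDiffWithinAt).div h1 h).prodMk ((contDiff_snd.neg.contDiffWithinAt).div h1 h)
lemma mK_contDiffOn {n : ℕ} {k : WithTop ℕ∞} : ContDiffOn ℝ k (mK n) {0}ᶜ := by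
  intro z hz
  have h := (na_pos hz)
  have h1 : ContDiffWithinAt ℝ k na {0}ᶜ z := by unfold na; fun_prop
  exact ((h1.sqrt h.ne').pow n).inv (pow_ne_zero _ (sqrt_pos.2 h).ne')

lemma kel_contDiffOn {n : ℕ} {k : WithTop ℕ∞} {W : ℝ × ℝ → ℝ} {U : Set (ℝ × ℝ)} (hW : ContDiffOn ℝ k W U) :
    ContDiffOn ℝ k (kel n W) ({0}ᶜ ∩ Tinv ⁻¹' U) := by
  exact (mK_contDiffOn.mono inter_subset_left).mul (hW.comp (Tinv_contDiffOn.mono inter_subset_left) (fun z hz => hz.2))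

lemma ne_zero_of_pos {z : ℝ × ℝ} (h : 0 < z.1) : z ≠ 0 := by rintro rfl; simp at h
lemma Tinv_pos {z : ℝ × ℝ} (h : 0 < z.1) : 0 < (Tinv z).1 := div_pos h (na_pos (ne_zero_of_pos h))

lemma cls_pds_diff {n : ℕ} {W B : ℝ × ℝ → ℝ} {U} (hU : IsOpen U) (h : Cls n U W B) {z : ℝ × ℝ} (hz : z ∈ U) (hz1 : 0 < z.1) :
    DifferentiableAt ℝ (pds W) z ∧ DifferentiableAt ℝ (pdt W) z := by
  have hO : IsOpen (U ∩ {z : ℝ × ℝ | 0 < z.1}) := hU.inter isOpen_pos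
  have h2 : ContDiffAt ℝ 2 W z := h.c2.contDiffAt (hO.mem_nhds ⟨hz, hz1⟩)
  have h3 : DifferentiableAt ℝ (fderiv ℝ W) z := (h2.fderiv_right (m := 1) (by norm_num)).differentiableAt (by norm_num)
  exact ⟨h3.clm_apply (differentiableAt_const _), h3.clm_apply (differentiableAt_const _)⟩

lemma cls_diff {n : ℕ} {W B : ℝ × ℝ → ℝ} {U} (hU : IsOpen U) (h : Cls n U W B) {z : ℝ × ℝ} (hz : z ∈ U) :
    DifferentiableAt ℝ W z := (h.c1.contDiffAt (hU.mem_nhds hz)).differentiableAt (by norm_num)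

set_option maxHeartbeats 1000000 in
lemma kel_cls {n : ℕ} {W F : ℝ × ℝ → ℝ} (h : Cls n univ W F) : Cls n {0}ᶜ (kel n W) (kelB n F) := by
  refine ⟨?_, ?_, ?_⟩
  · exact (kel_contDiffOn h.c1).mono (by simp)
  · exact (kel_contDiffOn h.c2).mono (fun z hz => ⟨hz.1, ⟨mem_univ _, Tinv_pos hz.2⟩⟩)
  intro z hz hz1
  have dW : ∀ z, DifferentiableAt ℝ W z := fun z => cls_diff isOpen_univ h (mem_univ z)
  have hna := na_pos hz
  have hs : pds (kel n W) =ᶠ[𝓝 z] fun z => mK n z * (-n * (z.1 / na z) * W (Tinv z) + cA z * pds W (Tinv z) + cB z * pdt W (Tinv z)) := by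
    filter_upwards [isOpen_compl_singleton.mem_nhds hz] with y hy
    exact pds_of (l2_kel hy (dW _))
  have ht : pdt (kel n W) =ᶠ[𝓝 z] fun z => mK n z * (n * (-z.2 / na z) * W (Tinv z) - cB z * pds W (Tinv z) + cA z * pdt W (Tinv z)) := by
    filter_upwards [isOpen_compl_singleton.mem_nhds hz] with y hy
    exact pdt_of (l2_kel hy (dW _))
  have hp : pds (pds (kel n W)) z = pds (fun z => mK n z * (-n * (z.1 / na z) * W (Tinv z) + cA z * pds W (Tinv z) + cB z * pdt W (Tinv z))) z := by
    unfold pds at *; rw [hs.fderiv_eq]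
  have hq : pdt (pdt (kel n W)) z = pdt (fun z => mK n z * (n * (-z.2 / na z) * W (Tinv z) - cB z * pds W (Tinv z) + cA z * pdt W (Tinv z))) z := by
    unfold pdt at *; rw [ht.fderiv_eq]
  obtain ⟨d1, d2⟩ := cls_pds_diff isOpen_univ h (mem_univ (Tinv z)) (Tinv_pos hz1)
  have cW := l2_comp (hasFDerivAt_lin2 (dW (Tinv z))) (l2_P hz) (l2_R hz)
  have cWs := l2_comp (hasFDerivAt_lin2 d1) (l2_P hz) (l2_R hz)
  have cWt := l2_comp (hasFDerivAt_lin2 d2) (l2_P hz) (l2_R hz)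
  have F1 := l2_mul (l2_mK n hz) (l2_add (l2_add (l2_mul (l2_mul (l2_const (-n) z) (l2_P hz)) cW) (l2_mul (l2_cA hz) cWs)) (l2_mul (l2_cB hz) cWt))
  have F2 := l2_mul (l2_mK n hz) (l2_add (l2_sub (l2_mul (l2_mul (l2_const n z) (l2_R hz)) cW) (l2_mul (l2_cB hz) cWs)) (l2_mul (l2_cA hz) cWt))
  have E1 := pds_of F1
  have E2 := pdt_of F2
  have E1' : pds (pds (kel n W)) z = _ := hp.trans E1
  have E2' : pdt (pdt (kel n W)) z = _ := hq.trans E2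
  rw [E1', E2', hs.eq_of_nhds]
  have pde := h.pde (Tinv z) (mem_univ _) (Tinv_pos hz1)
  rw [show (z.1 / na z, -z.2 / na z) = Tinv z from rfl]
  have eT : (Tinv z).1 = z.1 / na z := rfl
  rw [eT] at pde
  unfold kelB
  have hF : F (Tinv z) = - 4 * (z.1 / na z * pds (pds W) (Tinv z) + ↑n * pds W (Tinv z) + z.1 / na z * pdt (pdt W) (Tinv z)) := by
    rw [pde]; ring
  rw [hF]
  generalize pds (pds W) (Tinv z) = w11 at *
  generalize pdt (pds W) (Tinv z) = w12 at *
  generalize pds (pdt W) (Tinv z) = w21 at *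
  generalize pdt (pdt W) (Tinv z) = w22 at *
  generalize pds W (Tinv z) = w1 at *
  generalize pdt W (Tinv z) = w2 at *
  generalize W (Tinv z) = w0 at *
  generalize mK n z = m at *
  clear E1 E2 E1' E2' F1 F2 cW cWs cWt d1 d2 hp hq hs ht pde hF dW h eT
  have hna' := hna.ne'
  obtain ⟨s, t⟩ := z
  unfold cA cB
  have e : na (s, t) = s ^ 2 + t ^ 2 := rfl
  simp only at hz1
  generalize na (s, t) = A at *
  simp only
  field_simp
  subst e
  ring

end Heisenberg

namespace Heisenberg
open scoped ContDiff

def refl (l : ℝ) (z : ℝ × ℝ) : ℝ × ℝ := (z.1, 2 * l - z.2)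
def dif (l : ℝ) (K : ℝ × ℝ → ℝ) (z : ℝ × ℝ) : ℝ := K z - K (refl l z)
def Udom (l : ℝ) : Set (ℝ × ℝ) := {z | z ≠ 0 ∧ refl l z ≠ 0}

lemma continuous_refl (l : ℝ) : Continuous (refl l) := by unfold refl; fun_prop
lemma contDiff_refl {k} (l : ℝ) : ContDiff ℝ k (refl l) := by unfold refl; fun_prop
lemma isOpen_Udom (l : ℝ) : IsOpen (Udom l) :=
  (isOpen_compl_singleton (x := (0 : ℝ × ℝ))).inter ((isOpen_compl_singleton (x := (0 : ℝ × ℝ))).preimage (continuous_refl l))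

lemma l2_refl {l : ℝ} {W : ℝ × ℝ → ℝ} {z : ℝ × ℝ} {a b : ℝ} (h : HasFDerivAt W (lin2 a b) (refl l z)) :
    HasFDerivAt (fun z => W (refl l z)) (lin2 a (-b)) z := by
  refine l2_congr (l2_comp h (l2_fst z) (l2_sub (l2_const (2 * l) z) (l2_snd z))) ?_ ?_ <;> simp

lemma dif_cls {n : ℕ} {l : ℝ} {W F : ℝ × ℝ → ℝ} (h : Cls n {0}ᶜ W F) : Cls n (Udom l) (dif l W) (dif l F) := by
  have hO : IsOpen ({0}ᶜ : Set (ℝ × ℝ)) := isOpen_compl_singleton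
  refine ⟨?_, ?_, ?_⟩
  · exact (h.c1.mono (fun z hz => hz.1)).sub (h.c1.comp (contDiff_refl l).contDiffOn (fun z hz => hz.2))
  · exact (h.c2.mono (fun z hz => ⟨hz.1.1, hz.2⟩)).sub
      (h.c2.comp (contDiff_refl l).contDiffOn (fun z hz => ⟨hz.1.2, hz.2⟩))
  intro z hz hz1
  have D : ∀ y ∈ Udom l, HasFDerivAt (dif l W) (lin2 (pds W y - pds W (refl l y)) (pdt W y - - pdt W (refl l y))) y := by
    intro y hy
    exact l2_sub (hasFDerivAt_lin2 (cls_diff hO h hy.1)) (l2_refl (hasFDerivAt_lin2 (cls_diff hO h hy.2)))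
  have hs : pds (dif l W) =ᶠ[𝓝 z] fun y => pds W y - pds W (refl l y) := by
    filter_upwards [(isOpen_Udom l).mem_nhds hz] with y hy
    exact pds_of (D y hy)
  have ht : pdt (dif l W) =ᶠ[𝓝 z] fun y => pdt W y + pdt W (refl l y) := by
    filter_upwards [(isOpen_Udom l).mem_nhds hz] with y hy
    rw [pdt_of (D y hy)]; ring
  obtain ⟨d1, d2⟩ := cls_pds_diff hO h hz.1 hz1
  obtain ⟨d3, d4⟩ := cls_pds_diff hO h hz.2 (show 0 < (refl l z).1 from hz1)
  have E1 : pds (pds (dif l W)) z = _ := (by unfold pds at *; rw [hs.fderiv_eq] :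
    pds (pds (dif l W)) z = pds (fun y => pds W y - pds W (refl l y)) z).trans (pds_of (l2_sub (hasFDerivAt_lin2 d1) (l2_refl (hasFDerivAt_lin2 d3))))
  have E2 : pdt (pdt (dif l W)) z = _ := (by unfold pdt at *; rw [ht.fderiv_eq] :
    pdt (pdt (dif l W)) z = pdt (fun y => pdt W y + pdt W (refl l y)) z).trans (pdt_of (l2_add (hasFDerivAt_lin2 d2) (l2_refl (hasFDerivAt_lin2 d4))))
  rw [E1, E2, hs.eq_of_nhds]
  have p1 := h.pde z hz.1 hz1
  have p2 := h.pde (refl l z) hz.2 hz1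
  have e : (refl l z).1 = z.1 := rfl
  rw [e] at p2
  unfold dif
  linear_combination p1 - p2

/-! truncations -/
def pT (δ x : ℝ) : ℝ := 1 - (δ / (max x 0 + δ)) ^ 2
def kT (δ x : ℝ) : ℝ := (max x 0) ^ 2 / (max x 0 + δ)
def jT (δ x : ℝ) : ℝ := ∫ y in (0:ℝ)..x, pT δ y ^ 2
def JT (δ x : ℝ) : ℝ := ∫ y in (0:ℝ)..x, jT δ y

variable {δ : ℝ}
lemma pT_cont (hδ : 0 < δ) : Continuous (pT δ) := by
  unfold pT
  refine continuous_const.sub (Continuous.pow (continuous_const.div (by fun_prop) ?_) 2)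
  intro x
  have : 0 ≤ max x 0 := le_max_right _ _
  positivity
lemma jT_deriv (hδ : 0 < δ) (x : ℝ) : HasDerivAt (jT δ) (pT δ x ^ 2) x := ftc ((pT_cont hδ).pow 2) 0 x
lemma jT_cont (hδ : 0 < δ) : Continuous (jT δ) := continuous_iff_continuousAt.2 fun x => (jT_deriv hδ x).continuousAt
lemma JT_deriv (hδ : 0 < δ) (x : ℝ) : HasDerivAt (JT δ) (jT δ x) x := ftc (jT_cont hδ) 0 x
lemma pT_neg (hδ : 0 < δ) {x : ℝ} (hx : x ≤ 0) : pT δ x = 0 := by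
  unfold pT; rw [max_eq_right hx]; simp [hδ.ne']
lemma pT_mono (hδ : 0 < δ) : Monotone (pT δ) := by
  intro x y h
  unfold pT
  have h0 : 0 ≤ max x 0 := le_max_right _ _
  have h1 : max x 0 ≤ max y 0 := max_le_max h le_rfl
  have : δ / (max y 0 + δ) ≤ δ / (max x 0 + δ) := by gcongr
  have h2 : 0 ≤ δ / (max y 0 + δ) := by positivity
  have := pow_le_pow_left₀ h2 this 2
  linarith
lemma pT_nonneg (hδ : 0 < δ) (x : ℝ) : 0 ≤ pT δ x := by
  rcases le_total x 0 with h | h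
  · rw [pT_neg hδ h]
  · rw [← pT_neg hδ le_rfl]; exact pT_mono hδ h
lemma pT_le_one (x : ℝ) : pT δ x ≤ 1 := by unfold pT; nlinarith [sq_nonneg (δ / (max x 0 + δ))]

lemma kT_deriv (hδ : 0 < δ) (x : ℝ) : HasDerivAt (kT δ) (pT δ x) x := by
  -- positive side formula
  have hpos : ∀ x : ℝ, 0 ≤ x → HasDerivAt (fun x => x ^ 2 / (x + δ)) (pT δ x) x := by
    intro x hx
    have h1 := (hasDerivAt_pow 2 x).div ((hasDerivAt_id x).add_const δ) (by simp only [id]; positivity)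
    have e : pT δ x = ((2 : ℕ) * x ^ (2 - 1) * (id x + δ) - x ^ 2 * 1) / (id x + δ) ^ 2 := by
      unfold pT; rw [max_eq_left hx]; simp only [id]; 
      have : x + δ ≠ 0 := by positivity
      field_simp; push_cast; ring
    rw [e]; exact h1
  rcases lt_trichotomy x 0 with h | h | h
  · rw [pT_neg hδ h.le]
    refine (hasDerivAt_const x (0:ℝ)).congr_of_eventuallyEq ?_
    filter_upwards [Iio_mem_nhds h] with y hy
    have hy : y < 0 := hy
    unfold kT; rw [max_eq_right hy.le]; simp
  · subst h
    have h2 := hpos 0 le_rfl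
    rw [pT_neg hδ le_rfl] at h2 ⊢
    rw [hasDerivAt_iff_isLittleO] at h2 ⊢
    simp at h2 ⊢
    refine Asymptotics.IsLittleO.of_norm_left ((Asymptotics.IsBigO.of_bound 1 ?_).trans_isLittleO h2.norm_left)
    filter_upwards [Ioi_mem_nhds (show -δ < 0 by linarith)] with y hy
    unfold kT
    rcases le_total y 0 with h | h
    · rw [max_eq_right h]; simp; positivity
    · rw [max_eq_left h]; simp
  · refine (hpos x h.le).congr_of_eventuallyEq ?_
    filter_upwards [Ioi_mem_nhds h] with y hy
    have hy : 0 < y := hy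
    unfold kT; rw [max_eq_left hy.le]

lemma kT_nonneg (hδ : 0 < δ) (x : ℝ) : 0 ≤ kT δ x := by
  unfold kT
  have : 0 ≤ max x 0 := le_max_right _ _
  positivity
lemma kT_le (hδ : 0 < δ) (x : ℝ) : kT δ x ≤ max x 0 := by
  unfold kT
  have : 0 ≤ max x 0 := le_max_right _ _
  rw [div_le_iff₀ (by positivity)]; nlinarith
lemma le_kT (hδ : 0 < δ) (x : ℝ) : max x 0 - δ ≤ kT δ x := by
  unfold kT
  have : 0 ≤ max x 0 := le_max_right _ _
  rw [le_div_iff₀ (by positivity)]; nlinarith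
lemma kT_zero : kT δ 0 = 0 := by simp [kT]
lemma jT_zero : jT δ 0 = 0 := by simp [jT]
lemma JT_zero : JT δ 0 = 0 := by simp [JT]

lemma jT_neg (hδ : 0 < δ) {x : ℝ} (hx : x ≤ 0) : jT δ x = 0 := by
  unfold jT
  rw [intervalIntegral.integral_congr (g := fun _ => 0)]
  · simp
  · intro y hy
    rw [uIcc_of_ge hx] at hy
    simp [pT_neg hδ hy.2]
lemma JT_neg (hδ : 0 < δ) {x : ℝ} (hx : x ≤ 0) : JT δ x = 0 := by
  unfold JT
  rw [intervalIntegral.integral_congr (g := fun _ => 0)]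
  · simp
  · intro y hy
    rw [uIcc_of_ge hx] at hy
    simp [jT_neg hδ hy.2]
lemma jT_nonneg (hδ : 0 < δ) (x : ℝ) : 0 ≤ jT δ x := by
  rcases le_total x 0 with h | h
  · rw [jT_neg hδ h]
  · exact intervalIntegral.integral_nonneg h (fun y _ => sq_nonneg _)
lemma JT_nonneg (hδ : 0 < δ) (x : ℝ) : 0 ≤ JT δ x := by
  rcases le_total x 0 with h | h
  · rw [JT_neg hδ h]
  · exact intervalIntegral.integral_nonneg h (fun y _ => jT_nonneg hδ _)
lemma jT_le (hδ : 0 < δ) (x : ℝ) : jT δ x ≤ pT δ x * max x 0 := by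
  rcases le_total x 0 with h | h
  · rw [jT_neg hδ h, max_eq_right h]; simp
  · rw [max_eq_left h]
    have := intervalIntegral.integral_mono_on (μ := volume) (f := fun y => pT δ y ^ 2) (g := fun _ => pT δ x) h
      (((pT_cont hδ).pow 2).intervalIntegrable _ _) (by simp) (fun y hy => by
        have h1 := pT_nonneg hδ y
        have h2 := pT_mono hδ hy.2
        have h3 := pT_le_one (δ := δ) y
        show pT δ y ^ 2 ≤ _
        nlinarith)
    simp at this
    unfold jT; linarith
lemma jT_le' (hδ : 0 < δ) (x : ℝ) : jT δ x ≤ max x 0 := by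
  have h1 := jT_le hδ x
  have h2 := pT_le_one (δ := δ) x
  have h3 : 0 ≤ max x 0 := le_max_right _ _
  nlinarith
lemma JT_le (hδ : 0 < δ) (x : ℝ) : JT δ x ≤ (max x 0) ^ 2 := by
  rcases le_total x 0 with h | h
  · rw [JT_neg hδ h]; positivity
  · rw [max_eq_left h]
    have := intervalIntegral.integral_mono_on (μ := volume) (f := fun y => jT δ y) (g := fun _ => x) h
      ((jT_cont hδ).intervalIntegrable _ _) (by simp) (fun y hy => by
        have h1 := jT_le' hδ y
        rw [max_eq_left hy.1] at h1
        show jT δ y ≤ _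
        linarith [hy.2])
    simp at this
    unfold JT; nlinarith

end Heisenberg

namespace Heisenberg
open scoped ContDiff

/-- the quadrant -/
def Qd (l : ℝ) : Set (ℝ × ℝ) := Ioi 0 ×ˢ Ioi l
lemma Qd_meas (l : ℝ) : MeasurableSet (Qd l) := measurableSet_Ioi.prod measurableSet_Ioi
lemma Qd_open (l : ℝ) : IsOpen (Qd l) := isOpen_Ioi.prod isOpen_Ioi

lemma div0 {l : ℝ} {A1 A2 d : ℝ × ℝ → ℝ} (R : ℝ)
    (c1 : ContinuousOn A1 (Ici 0 ×ˢ Ici l)) (c2 : ContinuousOn A2 (Ici 0 ×ˢ Ici l))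
    (d1 : ∀ z ∈ Qd l, DifferentiableAt ℝ A1 z) (d2 : ∀ z ∈ Qd l, DifferentiableAt ℝ A2 z)
    (hd : ∀ z ∈ Qd l, pds A1 z + pdt A2 z = d z) (hi : IntegrableOn d (Qd l))
    (hR : ∀ z : ℝ × ℝ, R ≤ z.1 ∨ R ≤ z.2 → A1 z = 0 ∧ A2 z = 0 ∧ d z = 0)
    (b1 : ∀ t, A1 (0, t) = 0) (b2 : ∀ s, A2 (s, l) = 0) : ∫ z in Qd l, d z = 0 := by
  set M := max R (max 0 l) with hM
  have hM0 : 0 ≤ M := le_max_of_le_right (le_max_left _ _)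
  have hMl : l ≤ M := le_max_of_le_right (le_max_right _ _)
  have hMR : R ≤ M := le_max_left _ _
  have hsub : Ioo 0 M ×ˢ Ioo l M ⊆ Qd l := prod_mono (fun x hx => hx.1) (fun x hx => hx.1)
  have e1 : ∫ z in Qd l, d z = ∫ z in Ioo 0 M ×ˢ Ioo l M, d z := by
    refine setIntegral_eq_of_subset_of_forall_sdiff_eq_zero (Qd_meas l) hsub ?_
    rintro ⟨s, t⟩ ⟨hz1, hz2⟩
    refine (hR _ ?_).2.2
    by_contra hc
    push Not at hc
    exact hz2 ⟨⟨hz1.1, hc.1.trans_le hMR⟩, ⟨hz1.2, hc.2.trans_le hMR⟩⟩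
  have e2 : (Ioo 0 M ×ˢ Ioo l M : Set (ℝ × ℝ)) =ᵐ[volume] Icc ((0 : ℝ), l) (M, M) := by
    rw [← Icc_prod_Icc]
    exact Measure.set_prod_ae_eq Ioo_ae_eq_Icc Ioo_ae_eq_Icc
  have e3 : ∫ z in Ioo 0 M ×ˢ Ioo l M, d z = ∫ z in Ioo 0 M ×ˢ Ioo l M, (fderiv ℝ A1 z (1, 0) + fderiv ℝ A2 z (0, 1)) := by
    refine setIntegral_congr_fun (measurableSet_Ioo.prod measurableSet_Ioo) ?_
    intro z hz
    exact (hd z (hsub hz)).symm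
  have hi2 : IntegrableOn (fun z => fderiv ℝ A1 z (1, 0) + fderiv ℝ A2 z (0, 1)) (Icc ((0 : ℝ), l) (M, M)) := by
    rw [← integrableOn_congr_set_ae e2]
    refine (hi.mono_set hsub).congr_fun (fun z hz => (hd z (hsub hz)).symm) (measurableSet_Ioo.prod measurableSet_Ioo)
  have hIcc : Icc ((0 : ℝ), l) (M, M) ⊆ Ici 0 ×ˢ Ici l := by
    rw [← Icc_prod_Icc]; exact prod_mono (fun x hx => hx.1) (fun x hx => hx.1)
  have key := integral_divergence_prod_Icc_of_hasFDerivAt_of_le A1 A2 (fderiv ℝ A1) (fderiv ℝ A2) (0, l) (M, M)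
    ⟨hM0, hMl⟩ (c1.mono hIcc) (c2.mono hIcc) (fun z hz => (d1 z (hsub hz)).hasFDerivAt)
    (fun z hz => (d2 z (hsub hz)).hasFDerivAt) hi2
  rw [e1, e3, setIntegral_congr_set e2, key]
  simp only [b1, b2]
  have q1 : ∀ x, A2 (x, M) = 0 := fun x => (hR (x, M) (Or.inr hMR)).2.1
  have q2 : ∀ x, A1 (M, x) = 0 := fun x => (hR (M, x) (Or.inl hMR)).1
  simp [q1, q2]

lemma l2_pow1 (n : ℕ) (z : ℝ × ℝ) : HasFDerivAt (fun z : ℝ × ℝ => z.1 ^ n) (lin2 (n * z.1 ^ (n - 1)) 0) z :=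
  l2_congr (l2_comp1 (l2_fst z) (hasDerivAt_pow n z.1)) (by simp) (by simp)

lemma zero_of_nt {ζ : ℝ × ℝ → ℝ} {z : ℝ × ℝ} (h : z ∉ tsupport ζ) : ζ z = 0 ∧ pds ζ z = 0 ∧ pdt ζ z = 0 := by
  have e := notMem_tsupport_iff_eventuallyEq.1 h
  refine ⟨e.eq_of_nhds, ?_, ?_⟩
  · unfold pds; rw [e.fderiv_eq]; simp
  · unfold pdt; rw [e.fderiv_eq]; simp

lemma pds_cont {ζ : ℝ × ℝ → ℝ} {U} (hU : IsOpen U) (h : ContDiffOn ℝ 1 ζ U) : ContinuousOn (pds ζ) U :=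
  (h.continuousOn_fderiv_of_isOpen hU (by norm_num)).clm_apply continuousOn_const
lemma pdt_cont {ζ : ℝ × ℝ → ℝ} {U} (hU : IsOpen U) (h : ContDiffOn ℝ 1 ζ U) : ContinuousOn (pdt ζ) U :=
  (h.continuousOn_fderiv_of_isOpen hU (by norm_num)).clm_apply continuousOn_const
lemma pds_cont' {ζ : ℝ × ℝ → ℝ} (h : ContDiff ℝ 1 ζ) : Continuous (pds ζ) := by
  rw [← continuousOn_univ]; exact pds_cont isOpen_univ h.contDiffOn
lemma pdt_cont' {ζ : ℝ × ℝ → ℝ} (h : ContDiff ℝ 1 ζ) : Continuous (pdt ζ) := by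
  rw [← continuousOn_univ]; exact pdt_cont isOpen_univ h.contDiffOn

lemma cut_cont {U : Set (ℝ × ℝ)} (hU : IsOpen U) {ζ G : ℝ × ℝ → ℝ} (hG : ContinuousOn G U)
    (hζU : tsupport ζ ⊆ U) (hz : ∀ z ∉ tsupport ζ, G z = 0) : Continuous G := by
  refine hG.continuous_of_tsupport_subset hU ?_
  refine (closure_minimal ?_ (isClosed_tsupport ζ)).trans hζU
  intro z hz'
  by_contra hc
  exact hz' (hz z hc)
lemma cut_hcs {ζ G : ℝ × ℝ → ℝ} (hζ : HasCompactSupport ζ) (hz : ∀ z ∉ tsupport ζ, G z = 0) : HasCompactSupport G :=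
  HasCompactSupport.intro' hζ (isClosed_tsupport ζ) hz

lemma kT_contDiff {δ : ℝ} (hδ : 0 < δ) : ContDiff ℝ 1 (kT δ) := by
  rw [contDiff_one_iff_deriv]
  have : deriv (kT δ) = pT δ := funext fun x => (kT_deriv hδ x).deriv
  exact ⟨fun x => (kT_deriv hδ x).differentiableAt, by rw [this]; exact pT_cont hδ⟩

section
variable {n : ℕ} {l α β δ : ℝ} {U : Set (ℝ × ℝ)} {w b ζ : ℝ × ℝ → ℝ}

lemma h_contDiff (hδ : 0 < δ) (hU : IsOpen U) (h : ContDiffOn ℝ 1 w U)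
    (hζ : ContDiff ℝ 1 ζ) (hζU : tsupport ζ ⊆ U) : ContDiff ℝ 1 (fun z => kT δ (w z) * ζ z) := by
  rw [contDiff_iff_contDiffAt]
  intro z
  by_cases hz : z ∈ tsupport (fun z => kT δ (w z) * ζ z)
  swap
  · exact contDiffAt_const.congr_of_eventuallyEq (notMem_tsupport_iff_eventuallyEq.1 hz)
  have hz2 : z ∈ U := hζU (tsupport_mul_subset_right hz)
  exact ((kT_contDiff hδ).contDiffAt.comp z (h.contDiffAt (hU.mem_nhds hz2))).mul hζ.contDiffAt

lemma energy_id (hn : 1 ≤ n) (hδ : 0 < δ) (hU : IsOpen U) (h : Cls n U w b)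
    (hb : ContinuousOn b U) (hw : ∀ s, (s, l) ∈ U → w (s, l) = 0) (hζ : ContDiff ℝ 1 ζ) (hζc : HasCompactSupport ζ)
    (hζU : tsupport ζ ⊆ U) :
    let d : ℝ × ℝ → ℝ := fun z => - (z.1 ^ (n - 1) * (b z / 4) * jT δ (w z) * ζ z ^ 2 * (α + β * z.2)) +
      z.1 ^ n * (pT δ (w z) ^ 2 * ζ z ^ 2 * (α + β * z.2) * (pds w z ^ 2 + pdt w z ^ 2) +
        2 * jT δ (w z) * ζ z * (α + β * z.2) * (pds ζ z * pds w z + pdt ζ z * pdt w z)) -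
      2 * β * z.1 ^ n * JT δ (w z) * ζ z * pdt ζ z
    IntegrableOn d (Qd l) ∧ ∫ z in Qd l, d z = 0 := by
  intro d
  have cw := h.c1.continuousOn
  have cws := pds_cont hU h.c1
  have cwt := pdt_cont hU h.c1
  have cζs := pds_cont' hζ
  have cζt := pdt_cont' hζ
  have cζ := hζ.continuous
  have cp := (pT_cont hδ).comp_continuousOn cw
  have cj := (jT_cont hδ).comp_continuousOn cw
  have cJT : Continuous (JT δ) := continuous_iff_continuousAt.2 fun x => (JT_deriv hδ x).continuousAt
  have cJ := cJT.comp_continuousOn cw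
  simp only [Function.comp_def] at cp cj cJ
  have hz0 : ∀ z ∉ tsupport ζ, d z = 0 := by
    intro z hz
    simp [d, (zero_of_nt hz).1]
  have cd : Continuous d := by
    refine cut_cont hU ?_ hζU hz0
    simp only [d]
    fun_prop
  have hi : Integrable d := cd.integrable_of_hasCompactSupport (cut_hcs hζc hz0)
  refine ⟨hi.integrableOn, ?_⟩
  obtain ⟨R, hR⟩ : ∃ R : ℝ, ∀ z : ℝ × ℝ, R ≤ z.1 ∨ R ≤ z.2 → z ∉ tsupport ζ := by
    obtain ⟨R, hR⟩ := hζc.isBounded.subset_closedBall (0 : ℝ × ℝ)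
    refine ⟨R + 1, fun z hz hc => ?_⟩
    have := hR hc
    rw [mem_closedBall_zero_iff] at this
    have h1 := (le_abs_self z.1).trans (norm_fst_le z)
    have h2 := (le_abs_self z.2).trans (norm_snd_le z)
    rcases hz with hz | hz <;> linarith
  set A1 : ℝ × ℝ → ℝ := fun z => z.1 ^ n * (jT δ (w z) * (ζ z * ζ z) * (α + β * z.2) * pds w z) with hA1
  set A2 : ℝ × ℝ → ℝ := fun z => z.1 ^ n * (jT δ (w z) * (ζ z * ζ z) * (α + β * z.2) * pdt w z -
    JT δ (w z) * (ζ z * ζ z) * β) with hA2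
  have z1 : ∀ z ∉ tsupport ζ, A1 z = 0 := fun z hz => by simp [hA1, (zero_of_nt hz).1]
  have z2 : ∀ z ∉ tsupport ζ, A2 z = 0 := fun z hz => by simp [hA2, (zero_of_nt hz).1]
  have cA1 : Continuous A1 := cut_cont hU (by simp only [hA1]; fun_prop) hζU z1
  have cA2 : Continuous A2 := cut_cont hU (by simp only [hA2]; fun_prop) hζU z2
  have D : ∀ z ∈ Qd l, ∃ x1 x2 y1 y2, HasFDerivAt A1 (lin2 x1 x2) z ∧ HasFDerivAt A2 (lin2 y1 y2) z ∧ x1 + y2 = d z := by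
    intro z hz
    by_cases hs : z ∈ tsupport ζ
    · have hzU := hζU hs
      obtain ⟨e1, e2⟩ := cls_pds_diff hU h hzU hz.1
      have Lw := hasFDerivAt_lin2 (cls_diff hU h hzU)
      have Lζ := hasFDerivAt_lin2 (hζ.differentiable (by norm_num) z)
      have Lψ := l2_add (l2_const α z) (l2_mul (l2_const β z) (l2_snd z))
      have Lj := l2_comp1 Lw (jT_deriv hδ (w z))
      have LJ := l2_comp1 Lw (JT_deriv hδ (w z))
      have Lc := l2_mul (l2_mul Lj (l2_mul Lζ Lζ)) Lψ
      have LA1 := l2_mul (l2_pow1 n z) (l2_mul Lc (hasFDerivAt_lin2 e1))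
      have LA2 := l2_mul (l2_pow1 n z) (l2_sub (l2_mul Lc (hasFDerivAt_lin2 e2))
        (l2_mul (l2_mul LJ (l2_mul Lζ Lζ)) (l2_const β z)))
      refine ⟨_, _, _, _, LA1, LA2, ?_⟩
      have pde := h.pde z hzU hz.1
      have hp : z.1 ^ n = z.1 ^ (n - 1) * z.1 := by rw [← pow_succ, Nat.sub_add_cancel hn]
      simp only [d, hp]
      linear_combination (z.1 ^ (n - 1) * (jT δ (w z) * (ζ z * ζ z) * (α + β * z.2))) * pde
    · have t1 : tsupport A1 ⊆ tsupport ζ := closure_minimal (fun y hy => by_contra fun hc => hy (z1 y hc)) (isClosed_tsupport ζ)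
      have t2 : tsupport A2 ⊆ tsupport ζ := closure_minimal (fun y hy => by_contra fun hc => hy (z2 y hc)) (isClosed_tsupport ζ)
      have q1 := notMem_tsupport_iff_eventuallyEq.1 (fun hc => hs (t1 hc))
      have q2 := notMem_tsupport_iff_eventuallyEq.1 (fun hc => hs (t2 hc))
      refine ⟨0, 0, 0, 0, (l2_const 0 z).congr_of_eventuallyEq q1, (l2_const 0 z).congr_of_eventuallyEq q2, ?_⟩
      rw [hz0 z hs]; simp
  refine div0 (A1 := A1) (A2 := A2) R cA1.continuousOn cA2.continuousOn ?_ ?_ ?_ hi.integrableOn ?_ ?_ ?_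
  · intro z hz; obtain ⟨_, _, _, _, h1, h2, -⟩ := D z hz; exact h1.differentiableAt
  · intro z hz; obtain ⟨_, _, _, _, h1, h2, -⟩ := D z hz; exact h2.differentiableAt
  · intro z hz; obtain ⟨_, _, _, _, h1, h2, h3⟩ := D z hz; rw [pds_of h1, pdt_of h2, h3]
  · intro z hz; exact ⟨z1 z (hR z hz), z2 z (hR z hz), hz0 z (hR z hz)⟩
  · intro t; simp [hA1, show n ≠ 0 by omega]
  · intro s
    by_cases hs : (s, l) ∈ tsupport ζ
    · simp [hA2, hw s (hζU hs), jT_zero, JT_zero]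
    · exact z2 _ hs

def rhsE (n : ℕ) (α β δ : ℝ) (w b ζ : ℝ × ℝ → ℝ) (z : ℝ × ℝ) : ℝ :=
  z.1 ^ (n - 1) * b z * jT δ (w z) * ζ z ^ 2 * (α + β * z.2) +
  10 * z.1 ^ n * (max (w z) 0) ^ 2 * (α + β * z.2) * (pds ζ z ^ 2 + pdt ζ z ^ 2) +
  8 * β * z.1 ^ n * (max (w z) 0) ^ 2 * |ζ z| * |pdt ζ z|

lemma energy (hn : 1 ≤ n) (hδ : 0 < δ) (hl : 0 < l) (hα : 0 ≤ α) (hβ : 0 ≤ β) (hU : IsOpen U) (h : Cls n U w b)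
    (hb : ContinuousOn b U) (hw : ∀ s, (s, l) ∈ U → w (s, l) = 0) (hζ : ContDiff ℝ 1 ζ) (hζc : HasCompactSupport ζ)
    (hζU : tsupport ζ ⊆ U) :
    ∫ z in Qd l, z.1 ^ n * (α + β * z.2) * (pds (fun z => kT δ (w z) * ζ z) z ^ 2 + pdt (fun z => kT δ (w z) * ζ z) z ^ 2) ≤
    ∫ z in Qd l, rhsE n α β δ w b ζ z := by
  obtain ⟨hi, h0⟩ := energy_id (α := α) (β := β) hn hδ hU h hb hw hζ hζc hζU
  have cw := h.c1.continuousOn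
  have cζs := pds_cont' hζ
  have cζt := pdt_cont' hζ
  have cζ := hζ.continuous
  have cj := (jT_cont hδ).comp_continuousOn cw
  simp only [Function.comp_def] at cj
  have hz0 : ∀ z ∉ tsupport ζ, rhsE n α β δ w b ζ z = 0 := by
    intro z hz
    simp [rhsE, zero_of_nt hz]
  have cR : Continuous (rhsE n α β δ w b ζ) := by
    refine cut_cont hU ?_ hζU hz0
    unfold rhsE
    fun_prop
  have hiR : IntegrableOn (rhsE n α β δ w b ζ) (Qd l) := 
    (cR.integrable_of_hasCompactSupport (cut_hcs hζc hz0)).integrableOn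
  set d : ℝ × ℝ → ℝ := fun z => - (z.1 ^ (n - 1) * (b z / 4) * jT δ (w z) * ζ z ^ 2 * (α + β * z.2)) +
      z.1 ^ n * (pT δ (w z) ^ 2 * ζ z ^ 2 * (α + β * z.2) * (pds w z ^ 2 + pdt w z ^ 2) +
        2 * jT δ (w z) * ζ z * (α + β * z.2) * (pds ζ z * pds w z + pdt ζ z * pdt w z)) -
      2 * β * z.1 ^ n * JT δ (w z) * ζ z * pdt ζ z with hd
  have hi4 : IntegrableOn (fun z => rhsE n α β δ w b ζ z + 4 * d z) (Qd l) := hiR.add (hi.const_mul 4)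
  have e : ∫ z in Qd l, rhsE n α β δ w b ζ z = ∫ z in Qd l, (rhsE n α β δ w b ζ z + 4 * d z) := by
    rw [integral_add hiR (hi.const_mul 4), integral_const_mul, h0]; simp
  rw [e]
  have cH := h_contDiff hδ hU h.c1 hζ hζU
  have cHs := pds_cont' cH
  have cHt := pdt_cont' cH
  have hH0 : ∀ z ∉ tsupport ζ, pds (fun z => kT δ (w z) * ζ z) z = 0 ∧ pdt (fun z => kT δ (w z) * ζ z) z = 0 := by
    intro z hz
    have := zero_of_nt (ζ := fun z => kT δ (w z) * ζ z) (fun hc => hz (tsupport_mul_subset_right hc))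
    exact this.2
  refine setIntegral_mono_on ?_ hi4 (Qd_meas l) ?_
  · refine Integrable.integrableOn (Continuous.integrable_of_hasCompactSupport (by fun_prop) (cut_hcs hζc ?_))
    intro z hz; simp [hH0 z hz]
  intro z hz
  by_cases hs : z ∈ tsupport ζ
  · have hzU := hζU hs
    have Lw := hasFDerivAt_lin2 (cls_diff hU h hzU)
    have Lζ := hasFDerivAt_lin2 (hζ.differentiable (by norm_num) z)
    have LH := l2_mul (l2_comp1 Lw (kT_deriv hδ (w z))) Lζ
    rw [pds_of LH, pdt_of LH]
    have k0 := kT_nonneg hδ (w z)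
    have k1 := kT_le hδ (w z)
    have j0 := jT_nonneg hδ (w z)
    have j1 := jT_le hδ (w z)
    have J0 := JT_nonneg hδ (w z)
    have J1 := JT_le hδ (w z)
    have p0 := pT_nonneg hδ (w z)
    have hψ : 0 ≤ α + β * z.2 := by
      have : l < z.2 := hz.2
      have : 0 < z.2 := hl.trans this
      positivity
    have hsn : 0 ≤ z.1 ^ n := by
      have : 0 < z.1 := hz.1
      positivity
    have m0 : 0 ≤ max (w z) 0 := le_max_right _ _
    unfold rhsE
    simp only [hd]
    generalize max (w z) 0 = m at *
    generalize kT δ (w z) = k at *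
    generalize jT δ (w z) = j at *
    generalize JT δ (w z) = J at *
    generalize pT δ (w z) = p at *
    generalize pds w z = w1 at *
    generalize pdt w z = w2 at *
    generalize pds ζ z = x1 at *
    generalize pdt ζ z = x2 at *
    generalize ζ z = x at *
    generalize α + β * z.2 = ψ at *
    generalize z.1 ^ n = S at *
    generalize z.1 ^ (n - 1) = S1 at *
    -- gradient part
    have g1 : ∀ a c : ℝ, (k * c + x * (p * a)) ^ 2 ≤ 2 * p ^ 2 * x ^ 2 * a ^ 2 + 2 * m ^ 2 * c ^ 2 := by
      intro a c
      have : k ^ 2 ≤ m ^ 2 := pow_le_pow_left₀ k0 k1 2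
      nlinarith [sq_nonneg (k * c - x * (p * a)), mul_le_mul_of_nonneg_right this (sq_nonneg c)]
    have g2 : ∀ a c : ℝ, - (2 * p ^ 2 * x ^ 2 * a ^ 2) - 8 * m ^ 2 * c ^ 2 ≤ 8 * (j * x * (c * a)) := by
      intro a c
      have h1 : |8 * (j * x * (c * a))| ≤ 8 * (p * m) * |x * (c * a)| := by
        rw [show 8 * (j * x * (c * a)) = 8 * j * (x * (c * a)) by ring, abs_mul, abs_of_nonneg (by positivity : 0 ≤ 8 * j)]
        gcongr
      have h2 : 8 * (p * m) * |x * (c * a)| ≤ 2 * p ^ 2 * x ^ 2 * a ^ 2 + 8 * m ^ 2 * c ^ 2 := by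
        have : |x * (c * a)| = |x * a| * |c| := by rw [← abs_mul]; congr 1; ring
        rw [this]
        have := sq_nonneg (p * |x * a| - 2 * (m * |c|))
        nlinarith [sq_abs (x * a), sq_abs c]
      linarith [neg_abs_le (8 * (j * x * (c * a)))]
    have g3 : 8 * (J * x * x2) ≤ 8 * m ^ 2 * |x| * |x2| := by
      have h1 : J * x * x2 ≤ J * (|x| * |x2|) := by
        rw [← abs_mul, mul_assoc]; exact mul_le_mul_of_nonneg_left (le_abs_self _) J0
      have h2 : J * (|x| * |x2|) ≤ m ^ 2 * (|x| * |x2|) := mul_le_mul_of_nonneg_right J1 (by positivity)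
      nlinarith
    have hSψ : 0 ≤ S * ψ := by positivity
    have hSβ : 0 ≤ β * S := by positivity
    have G1 := mul_le_mul_of_nonneg_left (add_le_add (g1 w1 x1) (g1 w2 x2)) hSψ
    have G2 := mul_le_mul_of_nonneg_left (add_le_add (g2 w1 x1) (g2 w2 x2)) hSψ
    have G3 := mul_le_mul_of_nonneg_left g3 hSβ
    nlinarith
  · have q := hH0 z hs
    rw [q.1, q.2, hz0 z hs]
    simp [hd, zero_of_nt hs]
end

end Heisenberg

namespace Heisenberg
open scoped ContDiff ENNReal

lemma hcs_bound {h : ℝ × ℝ → ℝ} (hc : HasCompactSupport h) :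
    ∃ R : ℝ, ∀ z : ℝ × ℝ, R ≤ z.1 ∨ R ≤ z.2 → z ∉ tsupport h := by
  obtain ⟨R, hR⟩ := hc.isBounded.subset_closedBall (0 : ℝ × ℝ)
  refine ⟨R + 1, fun z hz hc => ?_⟩
  have := hR hc
  rw [mem_closedBall_zero_iff] at this
  have h1 := (le_abs_self z.1).trans (norm_fst_le z)
  have h2 := (le_abs_self z.2).trans (norm_snd_le z)
  rcases hz with hz | hz <;> linarith

/-- weighted Hardy inequality -/
lemma hardyW {n : ℕ} (hn : 1 ≤ n) {l : ℝ} (hl : 0 < l) {h : ℝ × ℝ → ℝ} (hh : ContDiff ℝ 1 h)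
    (hc : HasCompactSupport h) (h0 : ∀ s, h (s, l) = 0) :
    ∫ z in Qd l, z.1 ^ (n - 1) * h z ^ 2 ≤ 8 * ∫ z in Qd l, z.1 ^ n * z.2 * (pds h z ^ 2 + pdt h z ^ 2) := by
  have cs := pds_cont' hh
  have ct := pdt_cont' hh
  have c0 := hh.continuous
  set g : ℝ × ℝ → ℝ := fun z => z.1 ^ n * z.2 / (z.1 + z.2) with hg
  set d : ℝ × ℝ → ℝ := fun z => (n * z.1 ^ (n - 1) * z.2 / (z.1 + z.2) - z.1 ^ n * z.2 / (z.1 + z.2) ^ 2 +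
    z.1 ^ (n + 1) / (z.1 + z.2) ^ 2) * h z ^ 2 + 2 * h z * g z * (pds h z + pdt h z) with hd
  have hne : ∀ z ∈ (Ici 0 ×ˢ Ici l : Set (ℝ × ℝ)), z.1 + z.2 ≠ 0 := by
    rintro ⟨s, t⟩ ⟨h1, h2⟩
    have h1 : 0 ≤ s := h1
    have h2 : l ≤ t := h2
    have : 0 < s + t := by linarith
    exact this.ne'
  have hsub : Qd l ⊆ Ici 0 ×ˢ Ici l := prod_mono Ioi_subset_Ici_self Ioi_subset_Ici_self
  have cg : ContinuousOn g (Ici 0 ×ˢ Ici l) := by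
    refine ContinuousOn.div (by fun_prop) (by fun_prop) hne
  have cA : ContinuousOn (fun z => g z * (h z * h z)) (Ici 0 ×ˢ Ici l) := cg.mul (by fun_prop)
  have cd : ContinuousOn d (Ici 0 ×ˢ Ici l) := by
    have q : ∀ z ∈ (Ici 0 ×ˢ Ici l : Set (ℝ × ℝ)), (z.1 + z.2) ^ 2 ≠ 0 := fun z hz => pow_ne_zero 2 (hne z hz)
    refine ContinuousOn.add (ContinuousOn.mul (ContinuousOn.add (ContinuousOn.sub ?_ ?_) ?_) (by fun_prop)) (by fun_prop)
    · exact ContinuousOn.div (by fun_prop) (by fun_prop) hne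
    · exact ContinuousOn.div (by fun_prop) (by fun_prop) q
    · exact ContinuousOn.div (by fun_prop) (by fun_prop) q
  have hd0 : ∀ z ∉ tsupport h, d z = 0 := fun z hz => by simp [hd, (zero_of_nt hz).1]
  have hi : IntegrableOn d (Qd l) := by
    have : IntegrableOn d ((Ici 0 ×ˢ Ici l) ∩ tsupport h) :=
      (cd.mono inter_subset_left).integrableOn_compact (hc.isCompact.inter_left (isClosed_Ici.prod isClosed_Ici))
    refine (this.of_forall_sdiff_eq_zero (Qd_meas l) ?_)
    intro z hz
    exact hd0 z (fun hc => hz.2 ⟨hsub hz.1, hc⟩)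
  have D : ∀ z ∈ Qd l, HasFDerivAt (fun z => g z * (h z * h z)) (lin2
      ((n * z.1 ^ (n - 1) * z.2 / (z.1 + z.2) - z.1 ^ n * z.2 / (z.1 + z.2) ^ 2) * h z ^ 2 + 2 * h z * g z * pds h z)
      (z.1 ^ (n + 1) / (z.1 + z.2) ^ 2 * h z ^ 2 + 2 * h z * g z * pdt h z)) z := by
    intro z hz
    have hz' := hne z (hsub hz)
    have Lh := hasFDerivAt_lin2 (hh.differentiable (by norm_num) z)
    refine l2_congr (l2_mul (l2_div (l2_mul (l2_pow1 n z) (l2_snd z)) (l2_add (l2_fst z) (l2_snd z)) hz') (l2_mul Lh Lh)) ?_ ?_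
    · simp only [hg]; field_simp; ring
    · simp only [hg]; field_simp; ring
  obtain ⟨R, hR⟩ := hcs_bound hc
  have I0 : ∫ z in Qd l, d z = 0 := by
    refine div0 (A1 := fun z => g z * (h z * h z)) (A2 := fun z => g z * (h z * h z)) R cA cA
      (fun z hz => (D z hz).differentiableAt) (fun z hz => (D z hz).differentiableAt) ?_ hi ?_ ?_ ?_
    · intro z hz; rw [pds_of (D z hz), pdt_of (D z hz)]; simp only [hd]; ring
    · intro z hz
      have := (zero_of_nt (hR z hz)).1
      exact ⟨by simp [this], by simp [this], hd0 z (hR z hz)⟩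
    · intro t; simp [hg, show n ≠ 0 by omega]
    · intro s; simp [h0]
  have z0 : ∀ z ∉ tsupport h, h z = 0 := fun z hz => (zero_of_nt hz).1
  have i1 : IntegrableOn (fun z => z.1 ^ (n - 1) * h z ^ 2) (Qd l) := 
    ((by fun_prop : Continuous fun z : ℝ × ℝ => z.1 ^ (n - 1) * h z ^ 2).integrable_of_hasCompactSupport
      (cut_hcs hc (fun z hz => by simp [zero_of_nt hz]))).integrableOn
  have i2 : IntegrableOn (fun z => z.1 ^ n * z.2 * (pds h z ^ 2 + pdt h z ^ 2)) (Qd l) := 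
    ((by fun_prop : Continuous fun z : ℝ × ℝ => z.1 ^ n * z.2 * (pds h z ^ 2 + pdt h z ^ 2)).integrable_of_hasCompactSupport
      (cut_hcs hc (fun z hz => by simp [zero_of_nt hz]))).integrableOn
  have key : ∫ z in Qd l, z.1 ^ (n - 1) * h z ^ 2 ≤ ∫ z in Qd l, (8 * (z.1 ^ n * z.2 * (pds h z ^ 2 + pdt h z ^ 2)) + 4 * d z) := by
    refine setIntegral_mono_on i1 ((i2.const_mul 8).add (hi.const_mul 4)) (Qd_meas l) ?_
    rintro z hz
    have hs : 0 < z.1 := hz.1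
    have ht : 0 < z.2 := hl.trans hz.2
    have hp : z.1 ^ n = z.1 ^ (n - 1) * z.1 := by rw [← pow_succ, Nat.sub_add_cancel hn]
    have hS : 0 < z.1 ^ (n - 1) := by positivity
    have hn' : (1 : ℝ) ≤ n := by exact_mod_cast hn
    simp only [hd, hg]
    rw [pow_succ z.1 n, hp]
    generalize z.1 ^ (n - 1) = S at *
    generalize pds h z = a at *
    generalize pdt h z = b at *
    generalize h z = x at *
    obtain ⟨s, t⟩ := z
    simp only at *
    set q := s * t / (s + t) with hq
    have hst : 0 < s + t := by positivity
    have e1 : n * S * t / (s + t) - S * s * t / (s + t) ^ 2 + S * s * s / (s + t) ^ 2 ≥ S / 2 := by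
      have : n * S * t / (s + t) - S * s * t / (s + t) ^ 2 + S * s * s / (s + t) ^ 2 - S / 2 =
        S * ((n - 1) * t * (s + t) + (s - t) ^ 2 / 2) / (s + t) ^ 2 := by
        field_simp; ring
      have h2 : 0 ≤ S * ((n - 1) * t * (s + t) + (s - t) ^ 2 / 2) / (s + t) ^ 2 := by
        have : 0 ≤ (n : ℝ) - 1 := by linarith
        positivity
      linarith
    have e2 : S * s * t / (s + t) = S * q := by rw [hq]; ring
    have e3 : q ^ 2 ≤ s * t / 4 := by
      rw [hq, div_pow, div_le_iff₀ (by positivity)]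
      nlinarith [mul_nonneg (mul_nonneg hs.le ht.le) (sq_nonneg (s - t))]
    rw [e2]
    have e4 : (S / 2) * x ^ 2 ≤ (n * S * t / (s + t) - S * s * t / (s + t) ^ 2 + S * s * s / (s + t) ^ 2) * x ^ 2 :=
      mul_le_mul_of_nonneg_right e1 (sq_nonneg x)
    have e5 : x ^ 2 ≤ 8 * (s * t * (a ^ 2 + b ^ 2)) + 2 * x ^ 2 + 8 * x * q * (a + b) := by
      have h1 : q ^ 2 * (a + b) ^ 2 ≤ s * t / 4 * (2 * (a ^ 2 + b ^ 2)) := by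
        apply mul_le_mul e3 _ (sq_nonneg _) (by positivity)
        nlinarith [sq_nonneg (a - b)]
      nlinarith [sq_nonneg (x + 4 * q * (a + b))]
    have e6 := mul_le_mul_of_nonneg_left e5 hS.le
    generalize (n * S * t / (s + t) - S * s * t / (s + t) ^ 2 + S * s * s / (s + t) ^ 2) = Z at *
    have e7 : S * (8 * (s * t * (a ^ 2 + b ^ 2)) + 2 * x ^ 2 + 8 * x * q * (a + b)) =
      8 * (S * s * t * (a ^ 2 + b ^ 2)) + 4 * (S / 2 * x ^ 2 + 2 * x * (S * q) * (a + b)) := by ring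
    rw [e7] at e6
    linarith
  rw [integral_add (i2.const_mul 8) (hi.const_mul 4), integral_const_mul, integral_const_mul, I0] at key
  linarith

/-! Sobolev -/
lemma vol_Qd (l : ℝ) : (volume : Measure (ℝ × ℝ)).restrict (Qd l) =
    (volume.restrict (Ioi 0)).prod (volume.restrict (Ioi l)) := by
  unfold Qd; rw [Measure.volume_eq_prod, Measure.prod_restrict]

lemma hardyE {l a : ℝ} (ha : 0 < a) {W P : ℝ × ℝ → ℝ≥0∞} (hP : Measurable P) (hW : Measurable W)
    (h : ∀ s t, W (s, t) ≤ ∫⁻ σ in Ioi s, P (σ, t)) :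
    ∫⁻ z in Qd l, ENNReal.ofReal (z.1 ^ (a - 1)) * W z ≤
      ENNReal.ofReal (1 / a) * ∫⁻ z in Qd l, ENNReal.ofReal (z.1 ^ a) * P z := by
  rw [vol_Qd, lintegral_prod_symm _ (by fun_prop), lintegral_prod_symm _ (by fun_prop),
    ← lintegral_const_mul _ (by fun_prop)]
  refine lintegral_mono (fun t => ?_)
  simp only
  rw [← lintegral_const_mul _ (by fun_prop)]
  calc ∫⁻ s in Ioi 0, ENNReal.ofReal (s ^ (a - 1)) * W (s, t)
      ≤ ∫⁻ s in Ioi 0, ∫⁻ σ in Ioi 0, (Iio σ).indicator (fun s => ENNReal.ofReal (s ^ (a - 1)) * P (σ, t)) s := by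
        refine setLIntegral_mono' measurableSet_Ioi (fun s hs => ?_)
        have hs : 0 < s := hs
        calc ENNReal.ofReal (s ^ (a - 1)) * W (s, t) ≤ ENNReal.ofReal (s ^ (a - 1)) * ∫⁻ σ in Ioi s, P (σ, t) := by
              gcongr; exact h s t
          _ = ∫⁻ σ in Ioi s, ENNReal.ofReal (s ^ (a - 1)) * P (σ, t) := (lintegral_const_mul _ (by fun_prop)).symm
          _ = ∫⁻ σ in Ioi s, (Iio σ).indicator (fun s => ENNReal.ofReal (s ^ (a - 1)) * P (σ, t)) s := by
              refine setLIntegral_congr_fun measurableSet_Ioi (fun σ hσ => ?_)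
              rw [indicator_of_mem (show s ∈ Iio σ from hσ)]
          _ ≤ _ := lintegral_mono_set (Ioi_subset_Ioi hs.le)
    _ = ∫⁻ σ in Ioi 0, ∫⁻ s in Ioi 0, (Iio σ).indicator (fun s => ENNReal.ofReal (s ^ (a - 1)) * P (σ, t)) s := by
        refine lintegral_lintegral_swap ?_
        have : (Function.uncurry fun s σ => (Iio σ).indicator (fun s => ENNReal.ofReal (s ^ (a - 1)) * P (σ, t)) s) =
          {p : ℝ × ℝ | p.1 < p.2}.indicator (fun p => ENNReal.ofReal (p.1 ^ (a - 1)) * P (p.2, t)) := by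
          ext ⟨s, σ⟩; simp [indicator, Function.uncurry]
        rw [this]
        exact (Measurable.indicator (by fun_prop) (measurableSet_lt measurable_fst measurable_snd)).aemeasurable
    _ ≤ _ := by
        refine setLIntegral_mono' measurableSet_Ioi (fun σ hσ => ?_)
        have hσ : 0 < σ := hσ
        rw [setLIntegral_indicator measurableSet_Iio]
        rw [lintegral_mul_const _ (by fun_prop)]
        have e : ∫⁻ s in Iio σ ∩ Ioi 0, ENNReal.ofReal (s ^ (a - 1)) = ENNReal.ofReal (1 / a) * ENNReal.ofReal (σ ^ a) := by
          rw [inter_comm, Ioi_inter_Iio, setLIntegral_congr Ioo_ae_eq_Ioc, ← ofReal_integral_eq_lintegral_ofReal]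
          · rw [← intervalIntegral.integral_of_le hσ.le, integral_rpow (by left; linarith), ← ENNReal.ofReal_mul (by positivity)]
            congr 1
            rw [sub_add_cancel, zero_rpow ha.ne']; ring
          · rw [← IntegrableOn, ← intervalIntegrable_iff_integrableOn_Ioc_of_le hσ.le]
            exact intervalIntegral.intervalIntegrable_rpow' (by linarith)
          · filter_upwards [ae_restrict_mem measurableSet_Ioc] with x hx
            exact rpow_nonneg hx.1.le _
        rw [e, mul_assoc]

lemma loomis {l a : ℝ} (ha : 0 < a) {W P R : ℝ × ℝ → ℝ≥0∞} (hP : Measurable P) (hR : Measurable R)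
    (h : ∀ s t, W (s, t) ≤ ∫⁻ σ in Ioi s, P (σ, t)) (h' : ∀ s t, W (s, t) ≤ ∫⁻ σ in Ioi t, R (s, σ)) :
    ∫⁻ z in Qd l, (ENNReal.ofReal (z.1 ^ a) * W z) ^ (2 : ℝ) ≤
      (∫⁻ z in Qd l, ENNReal.ofReal (z.1 ^ a) * P z) * ∫⁻ z in Qd l, ENNReal.ofReal (z.1 ^ a) * R z := by
  calc ∫⁻ z in Qd l, (ENNReal.ofReal (z.1 ^ a) * W z) ^ (2 : ℝ) ≤
      ∫⁻ z in Qd l, (∫⁻ τ in Ioi l, ENNReal.ofReal (z.1 ^ a) * R (z.1, τ)) * (∫⁻ σ in Ioi 0, ENNReal.ofReal (σ ^ a) * P (σ, z.2)) := by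
        refine setLIntegral_mono' (Qd_meas l) ?_
        rintro ⟨s, t⟩ ⟨hs, ht⟩
        have hs : 0 < s := hs
        have ht : l < t := ht
        rw [ENNReal.rpow_two, sq]
        refine mul_le_mul' ?_ ?_
        · rw [lintegral_const_mul _ (by fun_prop)]
          gcongr
          exact (h' s t).trans (lintegral_mono_set (Ioi_subset_Ioi ht.le))
        · calc ENNReal.ofReal (s ^ a) * W (s, t) ≤ ENNReal.ofReal (s ^ a) * ∫⁻ σ in Ioi s, P (σ, t) := by gcongr; exact h s t
            _ = ∫⁻ σ in Ioi s, ENNReal.ofReal (s ^ a) * P (σ, t) := (lintegral_const_mul _ (by fun_prop)).symm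
            _ ≤ ∫⁻ σ in Ioi s, ENNReal.ofReal (σ ^ a) * P (σ, t) := by
                refine setLIntegral_mono' measurableSet_Ioi (fun σ hσ => ?_)
                have hσ : s < σ := hσ
                gcongr
            _ ≤ _ := lintegral_mono_set (Ioi_subset_Ioi hs.le)
    _ = _ := by
        rw [vol_Qd]
        rw [lintegral_prod_mul (f := fun s => ∫⁻ τ in Ioi l, ENNReal.ofReal (s ^ a) * R (s, τ))
          (g := fun t => ∫⁻ σ in Ioi 0, ENNReal.ofReal (σ ^ a) * P (σ, t))]
        · rw [mul_comm, lintegral_prod_symm _ (by fun_prop), lintegral_prod _ (by fun_prop)]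
        · exact (Measurable.lintegral_prod_right' (f := fun z : ℝ × ℝ => ENNReal.ofReal (z.1 ^ a) * R z) (by fun_prop)).aemeasurable
        · exact (Measurable.lintegral_prod_left' (f := fun z : ℝ × ℝ => ENNReal.ofReal (z.1 ^ a) * P z) (by fun_prop)).aemeasurable

end Heisenberg

namespace Heisenberg
open scoped ContDiff ENNReal

lemma ftc_bound {φ φ' : ℝ → ℝ} (hφ : ∀ x, HasDerivAt φ (φ' x) x) (hc : Continuous φ')
    (hs : HasCompactSupport φ) (s : ℝ) :
    ENNReal.ofReal (φ s) ≤ ∫⁻ σ in Ioi s, ENNReal.ofReal |φ' σ| := by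
  have hd : deriv φ = φ' := funext fun x => (hφ x).deriv
  have c1 : ContDiff ℝ 1 φ := contDiff_one_iff_deriv.2 ⟨fun x => (hφ x).differentiableAt, by rwa [hd]⟩
  have e := hs.integral_Ioi_deriv_eq c1 s
  rw [hd] at e
  have hi : Integrable φ' := hc.integrable_of_hasCompactSupport (hd ▸ hs.deriv)
  rw [← ofReal_integral_eq_lintegral_ofReal hi.abs.integrableOn (ae_of_all _ fun x => abs_nonneg _)]
  apply ENNReal.ofReal_le_ofReal
  have h2 := abs_integral_le_integral_abs (μ := volume.restrict (Ioi s)) (f := φ')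
  rw [e, abs_neg] at h2
  exact (le_abs_self _).trans h2

lemma hcs_slice1 {h : ℝ × ℝ → ℝ} (hc : HasCompactSupport h) (t : ℝ) : HasCompactSupport fun s => h (s, t) := by
  refine HasCompactSupport.intro (hc.isCompact.image continuous_fst) (fun s hs => ?_)
  refine (zero_of_nt (z := (s, t)) fun hm => hs ⟨_, hm, rfl⟩).1
lemma hcs_slice2 {h : ℝ × ℝ → ℝ} (hc : HasCompactSupport h) (s : ℝ) : HasCompactSupport fun t => h (s, t) := by
  refine HasCompactSupport.intro (hc.isCompact.image continuous_snd) (fun t hs => ?_)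
  refine (zero_of_nt (z := (s, t)) fun hm => hs ⟨_, hm, rfl⟩).1

lemma absorb {N D : ℝ≥0∞} {p : ℝ} (hp : 0 < p) (hp2 : p < 2) {K : ℝ≥0∞} (hN : N ≠ ⊤)
    (h : N ≤ K * (N ^ (1/2 : ℝ) * D ^ (1/2 : ℝ)) ^ p) :
    N ^ ((2 - p) / p) ≤ K ^ (2 / p) * D := by
  rcases eq_or_ne N 0 with rfl | h0
  · rw [ENNReal.zero_rpow_of_pos (by apply div_pos <;> linarith)]; exact zero_le
  have hm : N ^ (p / 2) ≠ 0 := by simp [h0, hN]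
  have hm' : N ^ (p / 2) ≠ ⊤ := by simp [h0, hN]
  have h1 : N ^ (1 - p / 2) ≤ K * D ^ (p / 2) := by
    rw [ENNReal.rpow_sub _ _ h0 hN, ENNReal.rpow_one]
    apply ENNReal.div_le_of_le_mul
    refine h.trans_eq ?_
    rw [ENNReal.mul_rpow_of_nonneg _ _ hp.le, ← ENNReal.rpow_mul, ← ENNReal.rpow_mul,
      show 1 / 2 * p = p / 2 by ring]
    ring
  have h2 := ENNReal.rpow_le_rpow h1 (show 0 ≤ 2 / p by positivity)
  rw [ENNReal.mul_rpow_of_nonneg _ _ (by positivity), ← ENNReal.rpow_mul, ← ENNReal.rpow_mul,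
    show p / 2 * (2 / p) = 1 by field_simp, ENNReal.rpow_one, show (1 - p / 2) * (2 / p) = (2 - p) / p by field_simp] at h2
  exact h2

lemma sobolev {n : ℕ} (hn : 1 ≤ n) : ∃ S : ℝ, 0 < S ∧ ∀ l : ℝ, ∀ h : ℝ × ℝ → ℝ, ContDiff ℝ 1 h →
    HasCompactSupport h → (∀ z, 0 ≤ h z) →
    (∫⁻ z in Qd l, ENNReal.ofReal (z.1 ^ (n - 1)) * ENNReal.ofReal (h z ^ (2 + 2 / (n : ℝ)))) ^ ((n : ℝ) / (n + 1)) ≤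
      ENNReal.ofReal (S * ∫ z in Qd l, z.1 ^ n * (pds h z ^ 2 + pdt h z ^ 2)) := by
  have hn' : (1 : ℝ) ≤ n := by exact_mod_cast hn
  set a : ℝ := n - 1 / 2 with ha
  set γ : ℝ := 2 + 1 / n with hγ
  set θ : ℝ := 2 * n / (2 * n + 1) with hθ
  set p : ℝ := 2 - θ with hp
  have ha0 : 0 < a := by rw [ha]; linarith
  have hθ0 : 0 < θ := by positivity
  have hθ1 : θ < 1 := by rw [hθ, div_lt_one (by positivity)]; linarith
  have hγ1 : 1 < γ := by rw [hγ]; have : 0 < 1 / (n : ℝ) := by positivity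
                         linarith
  set K : ℝ := (1 / a) ^ θ * γ ^ p with hK
  have hK0 : 0 < K := by positivity
  have hp0 : 0 < p := by linarith
  refine ⟨K ^ (2 / p) * 2, by positivity, fun l h hh hc h0 => ?_⟩
  have cs := pds_cont' hh
  have ct := pdt_cont' hh
  have c0 := hh.continuous
  -- the power
  have D : ∀ z, HasFDerivAt (fun z => h z ^ γ) (lin2 (γ * h z ^ (γ - 1) * pds h z) (γ * h z ^ (γ - 1) * pdt h z)) z := by
    intro z
    exact l2_comp1 (hasFDerivAt_lin2 (hh.differentiable (by norm_num) z)) (hasDerivAt_rpow_const (Or.inr hγ1.le))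
  have c1 : Continuous fun z => h z ^ (γ - 1) := c0.rpow_const (fun _ => Or.inr (by linarith))
  have c2 : Continuous fun z => h z ^ γ := c0.rpow_const (fun _ => Or.inr (by linarith))
  have hcW : HasCompactSupport fun z => h z ^ γ :=
    cut_hcs hc (fun z hz => by simp [(zero_of_nt hz).1, (zero_lt_one.trans hγ1).ne'])
  set W : ℝ × ℝ → ℝ≥0∞ := fun z => ENNReal.ofReal (h z ^ γ) with hW
  set P : ℝ × ℝ → ℝ≥0∞ := fun z => ENNReal.ofReal |γ * h z ^ (γ - 1) * pds h z| with hP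
  set R : ℝ × ℝ → ℝ≥0∞ := fun z => ENNReal.ofReal |γ * h z ^ (γ - 1) * pdt h z| with hR
  have mP : Measurable P := (ENNReal.continuous_ofReal.comp (((continuous_const.mul c1).mul cs).abs)).measurable
  have mR : Measurable R := (ENNReal.continuous_ofReal.comp (((continuous_const.mul c1).mul ct).abs)).measurable
  have mW : Measurable W := (ENNReal.continuous_ofReal.comp c2).measurable
  have HP : ∀ s t, W (s, t) ≤ ∫⁻ σ in Ioi s, P (σ, t) := by
    intro s t
    refine ftc_bound (φ := fun s => h (s, t) ^ γ) (φ' := fun s => γ * h (s, t) ^ (γ - 1) * pds h (s, t)) (fun x => ?_) (((continuous_const.mul c1).mul cs).comp (Continuous.prodMk_left t)) (hcs_slice1 hcW t) s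
    have := (D (x, t)).comp_hasDerivAt x ((hasDerivAt_id x).prodMk (hasDerivAt_const x t))
    simpa [lin2_apply, Function.comp_def] using this
  have HR : ∀ s t, W (s, t) ≤ ∫⁻ σ in Ioi t, R (s, σ) := by
    intro s t
    refine ftc_bound (φ := fun t => h (s, t) ^ γ) (φ' := fun t => γ * h (s, t) ^ (γ - 1) * pdt h (s, t)) (fun x => ?_) (((continuous_const.mul c1).mul ct).comp (Continuous.prodMk_right s)) (hcs_slice2 hcW s) t
    have := (D (s, x)).comp_hasDerivAt x ((hasDerivAt_const x s).prodMk (hasDerivAt_id x))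
    simpa [lin2_apply, Function.comp_def] using this
  have LX := hardyE (l := l) ha0 mP mW HP
  have LY := loomis (l := l) ha0 mP mR HP HR
  set N := ∫⁻ z in Qd l, ENNReal.ofReal (z.1 ^ (n - 1)) * ENNReal.ofReal (h z ^ (2 + 2 / (n : ℝ))) with hN
  set G := ∫⁻ z in Qd l, ENNReal.ofReal (z.1 ^ a) * (P z + R z) with hG
  have GP : ∫⁻ z in Qd l, ENNReal.ofReal (z.1 ^ a) * P z ≤ G :=
    lintegral_mono fun z => by gcongr; exact le_self_add
  have GR : ∫⁻ z in Qd l, ENNReal.ofReal (z.1 ^ a) * R z ≤ G :=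
    lintegral_mono fun z => by gcongr; exact le_add_self
  have s1 : N ≤ ENNReal.ofReal ((1 / a) ^ θ) * G ^ p := by
    calc N = ∫⁻ z in Qd l, (ENNReal.ofReal (z.1 ^ (a - 1)) * W z) ^ θ * ((ENNReal.ofReal (z.1 ^ a) * W z) ^ (2 : ℝ)) ^ (1 - θ) := by
          refine setLIntegral_congr_fun (Qd_meas l) (fun z hz => ?_)
          have hs : 0 < z.1 := hz.1
          have hx := h0 z
          simp only [hW]
          rw [← ENNReal.ofReal_mul (by positivity), ← ENNReal.ofReal_mul (by positivity), ← ENNReal.ofReal_mul (by positivity),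
            ← ENNReal.rpow_mul, ENNReal.ofReal_rpow_of_nonneg (by positivity) hθ0.le,
            ENNReal.ofReal_rpow_of_nonneg (by positivity) (by linarith), ← ENNReal.ofReal_mul (by positivity)]
          congr 1
          rw [mul_rpow (by positivity) (by positivity), mul_rpow (by positivity) (by positivity),
            ← rpow_mul hs.le, ← rpow_mul hs.le, ← rpow_mul hx, ← rpow_mul hx, mul_mul_mul_comm, ← rpow_add hs,
            ← rpow_add_of_nonneg hx (by positivity) (mul_nonneg (by positivity) (by linarith)), ← rpow_natCast]
          congr 2
          · rw [ha, hθ]; push_cast [hn]; field_simp; ring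
          · rw [hγ, hθ]; field_simp; ring
      _ ≤ (∫⁻ z in Qd l, ENNReal.ofReal (z.1 ^ (a - 1)) * W z) ^ θ * (∫⁻ z in Qd l, (ENNReal.ofReal (z.1 ^ a) * W z) ^ (2 : ℝ)) ^ (1 - θ) :=
          ENNReal.lintegral_mul_norm_pow_le (by fun_prop) (by fun_prop) hθ0.le (by linarith) (by ring)
      _ ≤ (ENNReal.ofReal (1 / a) * G) ^ θ * (G * G) ^ (1 - θ) := by
          refine mul_le_mul' (ENNReal.rpow_le_rpow ?_ hθ0.le) (ENNReal.rpow_le_rpow ?_ (by linarith))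
          · exact LX.trans (by gcongr)
          · exact LY.trans (by gcongr)
      _ = _ := by
          rw [ENNReal.mul_rpow_of_nonneg _ _ hθ0.le, ENNReal.ofReal_rpow_of_nonneg (by positivity) hθ0.le, mul_assoc,
            ← sq, ← ENNReal.rpow_two, ← ENNReal.rpow_mul, ← ENNReal.rpow_add_of_nonneg _ _ hθ0.le (by linarith)]
          congr 2; rw [hp]; ring
  set DD := ∫⁻ z in Qd l, ENNReal.ofReal (z.1 ^ n * (|pds h z| + |pdt h z|) ^ 2) with hDD
  have s2 : G ≤ ENNReal.ofReal γ * (N ^ (1 / 2 : ℝ) * DD ^ (1 / 2 : ℝ)) := by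
    calc G = ∫⁻ z in Qd l, ENNReal.ofReal γ * ((ENNReal.ofReal (z.1 ^ (n - 1)) * ENNReal.ofReal (h z ^ (2 + 2 / (n : ℝ)))) ^ (1 / 2 : ℝ) *
          ENNReal.ofReal (z.1 ^ n * (|pds h z| + |pdt h z|) ^ 2) ^ (1 / 2 : ℝ)) := by
          refine setLIntegral_congr_fun (Qd_meas l) (fun z hz => ?_)
          have hs : 0 < z.1 := hz.1
          have hx := h0 z
          simp only [hP, hR]
          rw [← ENNReal.ofReal_add (by positivity) (by positivity), ← ENNReal.ofReal_mul (by positivity),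
            ← ENNReal.ofReal_mul (by positivity), ENNReal.ofReal_rpow_of_nonneg (by positivity) (by norm_num),
            ENNReal.ofReal_rpow_of_nonneg (by positivity) (by norm_num), ← ENNReal.ofReal_mul (by positivity), ← ENNReal.ofReal_mul (by positivity)]
          congr 1
          rw [abs_mul, abs_mul _ (pdt h z), abs_of_nonneg (show 0 ≤ γ * h z ^ (γ - 1) by positivity), ← mul_add,
            mul_rpow (by positivity) (by positivity), mul_rpow (by positivity) (by positivity),
            ← sqrt_eq_rpow ((|pds h z| + |pdt h z|) ^ 2), sqrt_sq (by positivity), ← rpow_mul hx, ← rpow_natCast, ← rpow_natCast, ← rpow_mul hs.le, ← rpow_mul hs.le]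
          have e1 : z.1 ^ a = z.1 ^ (((n - 1 : ℕ) : ℝ) * (1 / 2)) * z.1 ^ ((n : ℝ) * (1 / 2)) := by
            rw [← rpow_add hs]; congr 1; rw [ha]; push_cast [hn]; ring
          rw [e1, show (2 + 2 / (n : ℝ)) * (1 / 2) = γ - 1 by rw [hγ]; ring]; ring
      _ ≤ _ := by
          rw [lintegral_const_mul _ (by fun_prop)]
          gcongr
          exact ENNReal.lintegral_mul_norm_pow_le (by fun_prop) (by fun_prop) (by norm_num) (by norm_num) (by norm_num)
  have hNt : N ≠ ⊤ := by
    have : Integrable fun z : ℝ × ℝ => z.1 ^ (n - 1) * h z ^ (2 + 2 / (n : ℝ)) := by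
      refine (Continuous.mul (by fun_prop) (c0.rpow_const (fun _ => Or.inr (by positivity)))).integrable_of_hasCompactSupport
        (cut_hcs hc (fun z hz => ?_))
      simp only [Pi.mul_apply]
      rw [(zero_of_nt hz).1, zero_rpow (by positivity), mul_zero]
    have h2 := this.integrableOn (s := Qd l) |>.lintegral_lt_top
    refine ne_of_lt (lt_of_le_of_lt (le_of_eq ?_) h2)
    refine setLIntegral_congr_fun (Qd_meas l) (fun z hz => ?_)
    have hs : 0 < z.1 := hz.1
    rw [ENNReal.ofReal_mul (by positivity)]
  have s3 : N ≤ ENNReal.ofReal K * (N ^ (1 / 2 : ℝ) * DD ^ (1 / 2 : ℝ)) ^ p := by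
    refine s1.trans ?_
    rw [hK, ENNReal.ofReal_mul (by positivity), mul_assoc, ← ENNReal.ofReal_rpow_of_nonneg (by positivity) hp0.le,
      ← ENNReal.mul_rpow_of_nonneg _ _ hp0.le]
    gcongr
  have s4 := absorb hp0 (by linarith) hNt s3
  have e : (2 - p) / p = (n : ℝ) / (n + 1) := by
    have : p = (2 * n + 2) / (2 * n + 1) := by rw [hp, hθ]; field_simp; ring
    rw [show 2 - p = θ by rw [hp]; ring, this, hθ]; field_simp
  rw [e] at s4
  refine s4.trans ?_
  have iD : Integrable fun z : ℝ × ℝ => z.1 ^ n * (pds h z ^ 2 + pdt h z ^ 2) := 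
    (by fun_prop : Continuous fun z : ℝ × ℝ => z.1 ^ n * (pds h z ^ 2 + pdt h z ^ 2)).integrable_of_hasCompactSupport
      (cut_hcs hc (fun z hz => by simp [zero_of_nt hz]))
  have hDle : DD ≤ ENNReal.ofReal (2 * ∫ z in Qd l, z.1 ^ n * (pds h z ^ 2 + pdt h z ^ 2)) := by
    rw [← integral_const_mul, ofReal_integral_eq_lintegral_ofReal (iD.integrableOn.const_mul 2)]
    · refine setLIntegral_mono' (Qd_meas l) (fun z hz => ENNReal.ofReal_le_ofReal ?_)
      have hs : 0 < z.1 := hz.1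
      have : (|pds h z| + |pdt h z|) ^ 2 ≤ 2 * (pds h z ^ 2 + pdt h z ^ 2) := by
        rw [← sq_abs (pds h z), ← sq_abs (pdt h z)]; nlinarith [sq_nonneg (|pds h z| - |pdt h z|)]
      calc _ ≤ z.1 ^ n * (2 * (pds h z ^ 2 + pdt h z ^ 2)) := by gcongr
        _ = _ := by ring
    · filter_upwards [ae_restrict_mem (Qd_meas l)] with z hz
      have hs : 0 < z.1 := hz.1
      simp only [Pi.zero_apply]; positivity
  rw [ENNReal.ofReal_rpow_of_nonneg hK0.le (by positivity), mul_assoc, ENNReal.ofReal_mul (by positivity)]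
  gcongr

end Heisenberg

namespace Heisenberg
open scoped ContDiff ENNReal

lemma st_deriv : ∃ M : ℝ, 0 < M ∧ (∀ x, |deriv smoothTransition x| ≤ M) ∧
    ∀ x, x < 0 ∨ 1 < x → deriv smoothTransition x = 0 := by
  have h0 : ∀ x, x < 0 ∨ 1 < x → deriv smoothTransition x = 0 := by
    rintro x (hx | hx)
    · have : smoothTransition =ᶠ[𝓝 x] fun _ => 0 := by
        filter_upwards [Iio_mem_nhds hx] with y hy using smoothTransition.zero_of_nonpos (le_of_lt hy)
      rw [this.deriv_eq]; simp
    · have : smoothTransition =ᶠ[𝓝 x] fun _ => 1 := by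
        filter_upwards [Ioi_mem_nhds hx] with y hy using smoothTransition.one_of_one_le (le_of_lt hy)
      rw [this.deriv_eq]; simp
  have hc : Continuous (deriv smoothTransition) :=
    (smoothTransition.contDiff (n := 1)).continuous_deriv le_rfl
  obtain ⟨M, hM⟩ := (isCompact_Icc (a := (0:ℝ)) (b := 1)).exists_bound_of_continuousOn hc.continuousOn
  refine ⟨max M 1, by positivity, fun x => ?_, h0⟩
  by_cases hx : x ∈ Icc (0:ℝ) 1
  · exact (hM x hx).trans (le_max_left _ _)
  · have : x < 0 ∨ 1 < x := by
      by_contra hcon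
      push Not at hcon
      exact hx hcon
    rw [h0 x this]; simp

def annS (J : ℝ) : Set (ℝ × ℝ) := {z | J ^ 2 ≤ na z ∧ na z ≤ 2 * J ^ 2}
def boxS (l J : ℝ) : Set (ℝ × ℝ) := {z | J ^ 2 * na (z - (0, 2 * l)) ≤ 2}

lemma cutoff {l : ℝ} (hl : 0 < l) : ∃ C : ℝ, 0 < C ∧ ∀ J : ℝ, 1 ≤ J → ∃ ζ : ℝ × ℝ → ℝ,
    ContDiff ℝ 1 ζ ∧ HasCompactSupport ζ ∧ tsupport ζ ⊆ Udom l ∧ (∀ z, 0 ≤ ζ z) ∧ (∀ z, ζ z ≤ 1) ∧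
    (∀ z ∈ Qd l, na z ≤ J ^ 2 → 2 ≤ J ^ 2 * na (z - (0, 2 * l)) → ζ z = 1) ∧
    (∀ z ∈ Qd l, |pds ζ z| ≤ C * ((annS J).indicator (fun _ => 1 / J) z + (boxS l J).indicator (fun _ => J) z)) ∧
    (∀ z ∈ Qd l, |pdt ζ z| ≤ C * ((annS J).indicator (fun _ => 1 / J) z + (boxS l J).indicator (fun _ => J) z)) := by
  obtain ⟨M, hM0, hM, hM'⟩ := st_deriv
  refine ⟨4 * M, by positivity, fun J hJ => ?_⟩
  have hJ0 : 0 < J := by linarith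
  set A : ℝ × ℝ → ℝ := fun z => smoothTransition (2 - na z / J ^ 2) with hA
  set B : ℝ × ℝ → ℝ := fun z => smoothTransition (J ^ 2 * na (z - (0, 2 * l)) - 1) with hB
  set χ : ℝ × ℝ → ℝ := fun z => smoothTransition (4 * z.2 / l - 1) with hχ
  have cst := smoothTransition.contDiff (n := 1)
  have cna : ContDiff ℝ 1 na := by unfold na; fun_prop
  have cA : ContDiff ℝ 1 A := cst.comp (by fun_prop)
  have cB : ContDiff ℝ 1 B := cst.comp (by fun_prop)
  have cχ : ContDiff ℝ 1 χ := cst.comp (by fun_prop)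
  have A01 : ∀ z, 0 ≤ A z ∧ A z ≤ 1 := fun z => ⟨smoothTransition.nonneg _, smoothTransition.le_one _⟩
  have B01 : ∀ z, 0 ≤ B z ∧ B z ≤ 1 := fun z => ⟨smoothTransition.nonneg _, smoothTransition.le_one _⟩
  have χ01 : ∀ z, 0 ≤ χ z ∧ χ z ≤ 1 := fun z => ⟨smoothTransition.nonneg _, smoothTransition.le_one _⟩
  have χ1 : ∀ z : ℝ × ℝ, l / 2 ≤ z.2 → χ z = 1 := by
    intro z hz
    refine smoothTransition.one_of_one_le ?_
    have : 2 ≤ 4 * z.2 / l := by rw [le_div_iff₀ hl]; linarith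
    linarith
  have hts : tsupport (fun z => χ z * (A z * B z)) ⊆ {z : ℝ × ℝ | na z ≤ 2 * J ^ 2} ∩ {z | l / 4 ≤ z.2} ∩ {z | 1 ≤ J ^ 2 * na (z - (0, 2 * l))} := by
    have cn := continuous_na
    refine closure_minimal ?_ (((isClosed_le (by fun_prop) (by fun_prop)).inter (isClosed_le (by fun_prop) (by fun_prop))).inter
      (isClosed_le (by fun_prop) (by fun_prop)))
    intro z hz
    have hz : χ z * (A z * B z) ≠ 0 := hz
    have h1 := left_ne_zero_of_mul hz
    have h2 := left_ne_zero_of_mul (right_ne_zero_of_mul hz)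
    have h3 := right_ne_zero_of_mul (right_ne_zero_of_mul hz)
    refine ⟨⟨?_, ?_⟩, ?_⟩
    · by_contra hcon
      simp only [mem_ofPred_eq, not_le] at hcon
      refine h2 (smoothTransition.zero_of_nonpos ?_)
      have : 2 ≤ na z / J ^ 2 := by rw [le_div_iff₀ (by positivity)]; linarith
      linarith
    · by_contra hcon
      simp only [mem_ofPred_eq, not_le] at hcon
      refine h1 (smoothTransition.zero_of_nonpos ?_)
      have : 4 * z.2 / l ≤ 1 := by rw [div_le_iff₀ (by positivity)]; linarith
      linarith
    · by_contra hcon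
      simp only [mem_ofPred_eq, not_le] at hcon
      refine h3 (smoothTransition.zero_of_nonpos ?_)
      linarith
  refine ⟨fun z => χ z * (A z * B z), cχ.mul (cA.mul cB), ?_, ?_, ?_, ?_, ?_, ?_⟩
  · refine HasCompactSupport.of_support_subset_isCompact (isCompact_closedBall (0 : ℝ × ℝ) (2 * J)) ?_
    intro z hz
    have h1 := (hts (subset_tsupport _ hz)).1.1
    simp only [mem_ofPred_eq, na] at h1
    rw [mem_closedBall_zero_iff, Prod.norm_def]
    refine max_le ?_ ?_
    · exact abs_le_of_sq_le_sq (by nlinarith) (by positivity)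
    · exact abs_le_of_sq_le_sq (by nlinarith) (by positivity)
  · intro z hz
    obtain ⟨⟨h1, h2⟩, h3⟩ := hts hz
    simp only [mem_ofPred_eq] at h2 h3
    refine ⟨?_, ?_⟩
    · rintro rfl; simp at h2; linarith
    · intro h
      have : z = (0, 2 * l) := by
        have a1 := congrArg Prod.fst h
        have a2 := congrArg Prod.snd h
        simp [refl] at a1 a2
        ext
        · exact a1
        · simp; linarith
      rw [this] at h3
      simp [na] at h3
      linarith
  · intro z; exact mul_nonneg (χ01 z).1 (mul_nonneg (A01 z).1 (B01 z).1)
  · intro z; exact mul_le_one₀ (χ01 z).2 (mul_nonneg (A01 z).1 (B01 z).1) (mul_le_one₀ (A01 z).2 (B01 z).1 (B01 z).2)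
  · intro z hz h1 h2
    have hz2 : l < z.2 := hz.2
    have e1 : A z = 1 := smoothTransition.one_of_one_le (by
      have : na z / J ^ 2 ≤ 1 := by rw [div_le_iff₀ (by positivity)]; linarith
      linarith)
    have e2 : B z = 1 := smoothTransition.one_of_one_le (by linarith)
    simp only [χ1 z (by linarith), e1, e2]; norm_num
  · have main : ∀ z ∈ Qd l, ∃ a b : ℝ, HasFDerivAt (fun z => χ z * (A z * B z)) (lin2 a b) z ∧
      |a| ≤ 4 * M * ((annS J).indicator (fun _ => 1 / J) z + (boxS l J).indicator (fun _ => J) z) ∧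
      |b| ≤ 4 * M * ((annS J).indicator (fun _ => 1 / J) z + (boxS l J).indicator (fun _ => J) z) := by
      intro z hz
      have hz2 : l < z.2 := hz.2
      have hst : ∀ x, HasDerivAt smoothTransition (deriv smoothTransition x) x :=
        fun x => (cst.differentiable (by norm_num) x).hasDerivAt
      have DA : HasFDerivAt A (lin2 (deriv smoothTransition (2 - na z / J ^ 2) * (-(2 * z.1 / J ^ 2))) (deriv smoothTransition (2 - na z / J ^ 2) * (-(2 * z.2 / J ^ 2)))) z := by
        refine l2_comp1 (f := fun z => 2 - na z / J ^ 2) (l2_congr (l2_sub (l2_const 2 z) (l2_comp1 (g := fun x => x / J ^ 2) (l2_na z) ((hasDerivAt_id _).div_const _))) ?_ ?_) (hst _)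
        · ring
        · ring
      have Dn : HasFDerivAt (fun z => na (z - (0, 2 * l))) (lin2 (2 * z.1) (2 * (z.2 - 2 * l))) z := by
        have := l2_comp (z := z) (W := na) (P := fun z => z.1 - 0) (R := fun z => z.2 - 2 * l) (l2_na _) (l2_sub (l2_fst z) (l2_const _ z)) (l2_sub (l2_snd z) (l2_const _ z))
        refine l2_congr this ?_ ?_ <;> simp
      have DB : HasFDerivAt B (lin2 (deriv smoothTransition (J ^ 2 * na (z - (0, 2 * l)) - 1) * (J ^ 2 * (2 * z.1))) (deriv smoothTransition (J ^ 2 * na (z - (0, 2 * l)) - 1) * (J ^ 2 * (2 * (z.2 - 2 * l))))) z := by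
        refine l2_comp1 (f := fun z => J ^ 2 * na (z - (0, 2 * l)) - 1) (l2_congr (l2_sub (l2_mul (l2_const (J ^ 2) z) Dn) (l2_const 1 z)) ?_ ?_) (hst _)
        · ring
        · ring
      have eA : ∀ x, x ^ 2 ≤ na z → |deriv smoothTransition (2 - na z / J ^ 2) * (-(2 * x / J ^ 2))| ≤ 4 * M * (annS J).indicator (fun _ => 1 / J) z := by
        intro x hx
        by_cases hz : z ∈ annS J
        · rw [indicator_of_mem hz, abs_mul]
          have : |(-(2 * x / J ^ 2))| ≤ 4 * (1 / J) := by
            rw [abs_neg, abs_div, abs_of_pos (show 0 < J ^ 2 by positivity), div_le_iff₀ (by positivity)]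
            have : |x| ≤ 2 * J := abs_le_of_sq_le_sq (by nlinarith [hz.2]) (by positivity)
            rw [abs_mul, abs_two]
            calc 2 * |x| ≤ 2 * (2 * J) := by linarith
              _ = _ := by field_simp; norm_num
          calc _ ≤ M * (4 * (1 / J)) := mul_le_mul (hM _) this (abs_nonneg _) hM0.le
            _ = _ := by ring
        · rw [hM', indicator_of_notMem hz]
          · simp
          · simp only [annS, mem_ofPred_eq, not_and_or, not_le] at hz
            rcases hz with hz | hz
            · right
              have : na z / J ^ 2 < 1 := by rw [div_lt_iff₀ (by positivity)]; linarith
              linarith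
            · left
              have : 2 < na z / J ^ 2 := by rw [lt_div_iff₀ (by positivity)]; linarith
              linarith
      have eB : ∀ x, x ^ 2 ≤ na (z - (0, 2 * l)) → |deriv smoothTransition (J ^ 2 * na (z - (0, 2 * l)) - 1) * (J ^ 2 * (2 * x))| ≤ 4 * M * (boxS l J).indicator (fun _ => J) z := by
        intro x hx
        by_cases hz : z ∈ boxS l J
        · rw [indicator_of_mem hz, abs_mul]
          have : |(J ^ 2 * (2 * x))| ≤ 4 * J := by
            have hz' : J ^ 2 * na (z - (0, 2 * l)) ≤ 2 := hz
            have : |J * x| ≤ 2 := abs_le_of_sq_le_sq (by nlinarith [mul_le_mul_of_nonneg_left hx (sq_nonneg J)]) (by positivity)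
            rw [show J ^ 2 * (2 * x) = (2 * J) * (J * x) by ring, abs_mul, abs_of_pos (show 0 < 2 * J by positivity)]
            nlinarith
          calc _ ≤ M * (4 * J) := mul_le_mul (hM _) this (abs_nonneg _) hM0.le
            _ = _ := by ring
        · rw [hM', indicator_of_notMem hz]
          · simp
          · simp only [boxS, mem_ofPred_eq, not_le] at hz
            right; linarith
      have hAB := l2_mul DA DB
      have ev : (fun z => χ z * (A z * B z)) =ᶠ[𝓝 z] fun z => A z * B z := by
        have : {z : ℝ × ℝ | l < z.2} ∈ 𝓝 z := (isOpen_lt continuous_const continuous_snd).mem_nhds hz2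
        filter_upwards [this] with y hy
        have hy : l < y.2 := hy
        rw [χ1 y (by linarith), one_mul]
      have fin : ∀ a b p q : ℝ, 0 ≤ a → a ≤ 1 → 0 ≤ b → b ≤ 1 → |a * p + b * q| ≤ |q| + |p| := by
        intro a b p q h1 h2 h3 h4
        calc |a * p + b * q| ≤ |a * p| + |b * q| := abs_add_le _ _
          _ ≤ |p| + |q| := by
            rw [abs_mul, abs_mul, abs_of_nonneg h1, abs_of_nonneg h3]
            nlinarith [abs_nonneg p, abs_nonneg q]
          _ = _ := add_comm _ _
      refine ⟨_, _, hAB.congr_of_eventuallyEq ev, ?_, ?_⟩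
      · refine (fin _ _ _ _ (A01 z).1 (A01 z).2 (B01 z).1 (B01 z).2).trans ?_
        rw [mul_add]
        refine add_le_add (eA z.1 ?_) (eB z.1 ?_)
        · unfold na; nlinarith [sq_nonneg z.2]
        · simp only [na, Prod.fst_sub, Prod.snd_sub]; nlinarith [sq_nonneg (z.2 - 2 * l)]
      · refine (fin _ _ _ _ (A01 z).1 (A01 z).2 (B01 z).1 (B01 z).2).trans ?_
        rw [mul_add]
        refine add_le_add (eA z.2 ?_) (eB (z.2 - 2 * l) ?_)
        · unfold na; nlinarith [sq_nonneg z.1]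
        · simp only [na, Prod.fst_sub, Prod.snd_sub]; nlinarith [sq_nonneg (z.1 - 0)]
    constructor
    · intro z hz
      obtain ⟨a, b, h1, h2, h3⟩ := main z hz
      rw [pds_of h1]; exact h2
    · intro z hz
      obtain ⟨a, b, h1, h2, h3⟩ := main z hz
      rw [pdt_of h1]; exact h3

end Heisenberg

namespace Heisenberg
open scoped ContDiff ENNReal

def Kz (l : ℝ) (ζ : ℝ × ℝ → ℝ) : Set (ℝ × ℝ) := tsupport ζ ∩ (Ici 0 ×ˢ Ici l)

lemma Kz_compact {l : ℝ} {ζ : ℝ × ℝ → ℝ} (hζc : HasCompactSupport ζ) : IsCompact (Kz l ζ) :=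
  hζc.isCompact.inter_right (isClosed_Ici.prod isClosed_Ici)

lemma rhs_lim {n : ℕ} {l α β δ : ℝ} (hδ : 0 < δ) {ζ : ℝ × ℝ → ℝ} (hζ : ContDiff ℝ 1 ζ) (hζc : HasCompactSupport ζ)
    {w b : ℕ → ℝ × ℝ → ℝ} {U B : ℝ × ℝ → ℝ}
    (cw : ∀ m, ContinuousOn (w m) (Kz l ζ)) (cb : ∀ m, ContinuousOn (b m) (Kz l ζ))
    (cU : ContinuousOn U (Kz l ζ)) (cB : ContinuousOn B (Kz l ζ))
    (tw : TendstoUniformlyOn w U atTop (Kz l ζ)) (tb : TendstoUniformlyOn b B atTop (Kz l ζ)) :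
    IntegrableOn (rhsE n α β δ U B ζ) (Qd l) ∧
    Tendsto (fun m => ∫ z in Qd l, rhsE n α β δ (w m) (b m) ζ z) atTop (𝓝 (∫ z in Qd l, rhsE n α β δ U B ζ z)) := by
  have cs := pds_cont' hζ
  have ct := pdt_cont' hζ
  have c0 := hζ.continuous
  have cj := jT_cont hδ
  set Ψ : (ℝ × ℝ) × ℝ × ℝ → ℝ := fun q => 
    q.1.1 ^ (n - 1) * q.2.2 * jT δ q.2.1 * ζ q.1 ^ 2 * (α + β * q.1.2) +
    10 * q.1.1 ^ n * (max q.2.1 0) ^ 2 * (α + β * q.1.2) * (pds ζ q.1 ^ 2 + pdt ζ q.1 ^ 2) +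
    8 * β * q.1.1 ^ n * (max q.2.1 0) ^ 2 * |ζ q.1| * |pdt ζ q.1| with hΨ
  have cΨ : Continuous Ψ := by fun_prop
  have e : ∀ W D : ℝ × ℝ → ℝ, ∀ z, rhsE n α β δ W D ζ z = Ψ (z, W z, D z) := fun W D z => rfl
  set K' := Qd l ∩ tsupport ζ with hK'
  have mK' : MeasurableSet K' := (Qd_meas l).inter (isClosed_tsupport ζ).measurableSet
  have hsub : K' ⊆ Kz l ζ := fun z hz => ⟨hz.2, prod_mono Ioi_subset_Ici_self Ioi_subset_Ici_self hz.1⟩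
  have hK := Kz_compact (l := l) hζc
  have fin : volume K' < ⊤ := (measure_mono hsub).trans_lt hK.measure_lt_top
  have hz : ∀ W D : ℝ × ℝ → ℝ, ∀ z ∈ Qd l \ K', rhsE n α β δ W D ζ z = 0 := by
    intro W D z hz
    have : z ∉ tsupport ζ := fun h => hz.2 ⟨hz.1, h⟩
    simp [rhsE, zero_of_nt this]
  have hnt : ∀ W D : ℝ × ℝ → ℝ, ∫ z in Qd l, rhsE n α β δ W D ζ z = ∫ z in K', Ψ (z, W z, D z) := fun W D =>
    setIntegral_eq_of_subset_of_forall_sdiff_eq_zero (Qd_meas l) inter_subset_left (hz W D)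
  have cc : ∀ W D : ℝ × ℝ → ℝ, ContinuousOn W (Kz l ζ) → ContinuousOn D (Kz l ζ) → ContinuousOn (fun z => Ψ (z, W z, D z)) (Kz l ζ) :=
    fun W D h1 h2 => cΨ.comp_continuousOn (continuousOn_id.prodMk (h1.prodMk h2))
  constructor
  · have : IntegrableOn (rhsE n α β δ U B ζ) K' := ((cc U B cU cB).integrableOn_compact hK).mono_set hsub
    exact this.of_forall_sdiff_eq_zero (Qd_meas l) (hz U B)
  simp only [hnt]
  obtain ⟨M1, hM1⟩ := hK.exists_bound_of_continuousOn cU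
  obtain ⟨M2, hM2⟩ := hK.exists_bound_of_continuousOn cB
  obtain ⟨M, hM⟩ := ((hK.prod ((isCompact_Icc (a := -(M1 + 1)) (b := M1 + 1)).prod (isCompact_Icc (a := -(M2 + 1)) (b := M2 + 1))))).exists_bound_of_continuousOn cΨ.continuousOn
  refine tendsto_integral_filter_of_dominated_convergence (fun _ => M) ?_ ?_ ?_ ?_
  · exact Eventually.of_forall fun m => ((cc _ _ (cw m) (cb m)).mono hsub).aestronglyMeasurable mK'
  · filter_upwards [Metric.tendstoUniformlyOn_iff.1 tw 1 one_pos, Metric.tendstoUniformlyOn_iff.1 tb 1 one_pos] with m h1 h2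
    filter_upwards [ae_restrict_mem mK'] with z hz
    refine hM _ ⟨hsub hz, ?_, ?_⟩
    · have a1 := hM1 z (hsub hz)
      have a2 := h1 z (hsub hz)
      rw [Real.dist_eq, abs_lt] at a2
      rw [Real.norm_eq_abs, abs_le] at a1
      constructor <;> simp only <;> linarith [a1.1, a1.2, a2.1, a2.2]
    · have a1 := hM2 z (hsub hz)
      have a2 := h2 z (hsub hz)
      rw [Real.dist_eq, abs_lt] at a2
      rw [Real.norm_eq_abs, abs_le] at a1
      constructor <;> simp only <;> linarith [a1.1, a1.2, a2.1, a2.2]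
  · exact integrableOn_const (by exact fin.ne)
  · filter_upwards [ae_restrict_mem mK'] with z hz
    refine (cΨ.tendsto _).comp ?_
    exact tendsto_const_nhds.prodMk_nhds ((tw.tendsto_at (hsub hz)).prodMk_nhds (tb.tendsto_at (hsub hz)))

/-- measure of the two error regions -/
lemma vol_rect (a b c d : ℝ) (h : a ≤ b) (h' : c ≤ d) : (volume (Icc a b ×ˢ Icc c d : Set (ℝ × ℝ))).toReal = (b - a) * (d - c) := by
  rw [Measure.volume_eq_prod, Measure.prod_prod, ENNReal.toReal_mul, Real.volume_Icc, Real.volume_Icc,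
    ENNReal.toReal_ofReal (by linarith), ENNReal.toReal_ofReal (by linarith)]

lemma mK_anti {n : ℕ} {z : ℝ × ℝ} {J : ℝ} (hn : 1 ≤ n) (hz : 0 < z.1) (hJ : 1 ≤ J) (h : J ^ 2 ≤ na z) :
    z.1 ^ n * mK n z ^ 2 ≤ 1 / J := by
  have hr : J ≤ √(na z) := Real.le_sqrt_of_sq_le h
  have hs : z.1 ≤ √(na z) := Real.le_sqrt_of_sq_le (by unfold na; nlinarith [sq_nonneg z.2])
  unfold mK
  set r := √(na z)
  have hr0 : 0 < r := by linarith
  calc z.1 ^ n * (r ^ n)⁻¹ ^ 2 ≤ r ^ n * (r ^ n)⁻¹ ^ 2 := by gcongr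
    _ = 1 / r ^ n := by field_simp
    _ ≤ 1 / J := by
      apply one_div_le_one_div_of_le (by linarith)
      calc J ≤ r := hr
        _ = r ^ 1 := (pow_one r).symm
        _ ≤ r ^ n := pow_le_pow_right₀ (by linarith) hn

lemma abs_sq_le_aux {x y : ℝ} (h : x ^ 2 ≤ y ^ 2) (hy : 0 ≤ y) : x ≤ y :=
  (le_abs_self _).trans (abs_le_of_sq_le_sq h hy)

set_option maxHeartbeats 4000000 in
lemma err_bound {n : ℕ} (hn : 1 ≤ n) {l : ℝ} (hl : 0 < l) {C0 : ℝ} (hC0 : 0 ≤ C0) {C1 : ℝ} (hC1 : 0 ≤ C1) :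
    ∃ C : ℝ, 0 ≤ C ∧ ∀ α β δ J : ℝ, 0 ≤ α → 0 ≤ β → 0 < δ → 1 ≤ J → ∀ ζ U B E : ℝ × ℝ → ℝ, 
    (∀ z, 0 ≤ ζ z) → (∀ z, ζ z ≤ 1) →
    (∀ z ∈ Qd l, |pds ζ z| ≤ C1 * ((annS J).indicator (fun _ => 1 / J) z + (boxS l J).indicator (fun _ => J) z)) →
    (∀ z ∈ Qd l, |pdt ζ z| ≤ C1 * ((annS J).indicator (fun _ => 1 / J) z + (boxS l J).indicator (fun _ => J) z)) →
    (∀ z ∈ Qd l, max (U z) 0 ≤ C0 * mK n z) → (∀ z ∈ Qd l, B z ≤ E z) → (∀ z ∈ Qd l, 0 ≤ E z) →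
    IntegrableOn (rhsE n α β δ U B ζ) (Qd l) → IntegrableOn (fun z => z.1 ^ (n - 1) * E z * max (U z) 0 * (α + β * z.2)) (Qd l) →
    ∫ z in Qd l, rhsE n α β δ U B ζ z ≤ (∫ z in Qd l, z.1 ^ (n - 1) * E z * max (U z) 0 * (α + β * z.2)) + C * (α / J + β) := by
  -- pointwise constants
  obtain ⟨M, hM⟩ : ∃ M, M = C0 ^ 2 * (l⁻¹ ^ n) ^ 2 := ⟨_, rfl⟩
  obtain ⟨A, hA⟩ : ∃ A, A = 50 * C1 ^ 2 * C0 ^ 2 + 40 * C1 * C0 ^ 2 := ⟨_, rfl⟩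
  have hM0 : 0 ≤ M := by rw [hM]; positivity
  have hA0 : 0 ≤ A := by rw [hA]; positivity
  obtain ⟨D, hD⟩ : ∃ D, D = (2:ℝ) ^ n * (50 * C1 ^ 2 * M * (1 + 2 * l + 2) + 40 * C1 * M) := ⟨_, rfl⟩
  have hD0 : 0 ≤ D := by rw [hD]; positivity
  refine ⟨48 * A + 48 * D, by positivity, ?_⟩
  intro α β δ J hα hβ hδ hJ ζ U B E hζ0 hζ1 hs ht hU hBE hE hi1 hi2
  have hJ0 : 0 < J := by linarith
  set R1 : Set (ℝ × ℝ) := Icc 0 (2 * J) ×ˢ Icc 0 (2 * J) with hR1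
  set R2 : Set (ℝ × ℝ) := Icc 0 (2 / J) ×ˢ Icc (2 * l - 2 / J) (2 * l + 2 / J) with hR2
  obtain ⟨k1, hk1⟩ : ∃ k1, k1 = 4 * A * (α + β * (2 * J)) / J ^ 3 + 4 * A * β / J ^ 2 := ⟨_, rfl⟩
  obtain ⟨k2, hk2⟩ : ∃ k2, k2 = 4 * D * (α + β) * J := ⟨_, rfl⟩
  have m1 : MeasurableSet R1 := measurableSet_Icc.prod measurableSet_Icc
  have m2 : MeasurableSet R2 := measurableSet_Icc.prod measurableSet_Icc
  have f1 : volume R1 ≠ ⊤ := (isCompact_Icc.prod isCompact_Icc).measure_lt_top.ne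
  have f2 : volume R2 ≠ ⊤ := (isCompact_Icc.prod isCompact_Icc).measure_lt_top.ne
  have i1 : Integrable (R1.indicator fun _ => k1) := (integrable_indicator_iff m1).2 (integrableOn_const f1)
  have i2 : Integrable (R2.indicator fun _ => k2) := (integrable_indicator_iff m2).2 (integrableOn_const f2)
  have hk10 : 0 ≤ k1 := by rw [hk1]; positivity
  have hk20 : 0 ≤ k2 := by rw [hk2]; positivity
  have pt : ∀ z ∈ Qd l, rhsE n α β δ U B ζ z ≤ z.1 ^ (n - 1) * E z * max (U z) 0 * (α + β * z.2) +
      (R1.indicator (fun _ => k1) z + R2.indicator (fun _ => k2) z) := by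
    intro z hz
    have hz1 : 0 < z.1 := hz.1
    have hz2 : l < z.2 := hz.2
    have hz20 : 0 < z.2 := hl.trans hz2
    have hU0 : 0 ≤ max (U z) 0 := le_max_right _ _
    have h1 : z.1 ^ (n - 1) * B z * jT δ (U z) * ζ z ^ 2 * (α + β * z.2) ≤ z.1 ^ (n - 1) * E z * max (U z) 0 * (α + β * z.2) := by
      have a1 : B z * jT δ (U z) ≤ E z * max (U z) 0 :=
        (mul_le_mul_of_nonneg_right (hBE z hz) (jT_nonneg hδ _)).trans (mul_le_mul_of_nonneg_left (jT_le' hδ _) (hE z hz))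
      have a2 : ζ z ^ 2 ≤ 1 := pow_le_one₀ (hζ0 z) (hζ1 z)
      have a3 : B z * jT δ (U z) * ζ z ^ 2 ≤ E z * max (U z) 0 :=
        (mul_le_mul_of_nonneg_right a1 (sq_nonneg _)).trans (mul_le_of_le_one_right (mul_nonneg (hE z hz) hU0) a2)
      have := mul_le_mul_of_nonneg_left a3 (show 0 ≤ z.1 ^ (n - 1) * (α + β * z.2) by positivity)
      linarith
    obtain ⟨Us, hUs⟩ : ∃ Us, Us = z.1 ^ n * max (U z) 0 ^ 2 := ⟨_, rfl⟩
    have hUs0 : 0 ≤ Us := by rw [hUs]; positivity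
    have hUs1 : Us ≤ C0 ^ 2 * (z.1 ^ n * mK n z ^ 2) := by
      rw [hUs]
      calc z.1 ^ n * max (U z) 0 ^ 2 ≤ z.1 ^ n * (C0 * mK n z) ^ 2 := by gcongr; exact hU z hz
        _ = _ := by ring
    have hE1 : rhsE n α β δ U B ζ z ≤ z.1 ^ (n - 1) * E z * max (U z) 0 * (α + β * z.2) + 
        (10 * Us * (α + β * z.2) * (|pds ζ z| ^ 2 + |pdt ζ z| ^ 2) + 8 * β * Us * |pdt ζ z|) := by
      unfold rhsE
      rw [sq_abs, sq_abs, abs_of_nonneg (hζ0 z)]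
      have : 8 * β * z.1 ^ n * max (U z) 0 ^ 2 * ζ z * |pdt ζ z| ≤ 8 * β * Us * |pdt ζ z| := by
        have : 8 * β * Us * |pdt ζ z| * ζ z ≤ 8 * β * Us * |pdt ζ z| := mul_le_of_le_one_right (by positivity) (hζ1 z)
        rw [hUs] at this ⊢; linarith
      have e : 10 * z.1 ^ n * max (U z) 0 ^ 2 * (α + β * z.2) * (pds ζ z ^ 2 + pdt ζ z ^ 2) = 10 * Us * (α + β * z.2) * (pds ζ z ^ 2 + pdt ζ z ^ 2) := by
        rw [hUs]; ring
      linarith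
    refine hE1.trans (add_le_add_right ?_ _)
    -- now bound by the two indicators
    set I1 := (annS J).indicator (fun _ => 1 / J) z with hI1
    set I2 := (boxS l J).indicator (fun _ => J) z with hI2
    have hI10 : 0 ≤ I1 := indicator_nonneg (fun _ _ => by positivity) _
    have hI20 : 0 ≤ I2 := indicator_nonneg (fun _ _ => by positivity) _
    have q1 : |pds ζ z| ^ 2 + |pdt ζ z| ^ 2 ≤ 4 * C1 ^ 2 * (I1 ^ 2 + I2 ^ 2) := by
      have a1 := pow_le_pow_left₀ (abs_nonneg _) (hs z hz) 2
      have a2 := pow_le_pow_left₀ (abs_nonneg _) (ht z hz) 2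
      have a3 : (C1 * (I1 + I2)) ^ 2 ≤ 2 * C1 ^ 2 * (I1 ^ 2 + I2 ^ 2) := by
        nlinarith [mul_nonneg (sq_nonneg C1) (sq_nonneg (I1 - I2))]
      linarith
    have step : 10 * Us * (α + β * z.2) * (|pds ζ z| ^ 2 + |pdt ζ z| ^ 2) + 8 * β * Us * |pdt ζ z| ≤
      (40 * C1 ^ 2 * Us * (α + β * z.2) * I1 ^ 2 + 8 * C1 * β * Us * I1) + (40 * C1 ^ 2 * Us * (α + β * z.2) * I2 ^ 2 + 8 * C1 * β * Us * I2) := by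
      have a1 := mul_le_mul_of_nonneg_left q1 (show 0 ≤ 10 * Us * (α + β * z.2) by positivity)
      have a2 := mul_le_mul_of_nonneg_left (ht z hz) (show 0 ≤ 8 * β * Us by positivity)
      linarith
    refine step.trans (add_le_add ?_ ?_)
    · by_cases h : z ∈ annS J
      · have hzR : z ∈ R1 := by
          have := h.2
          unfold na at this
          refine ⟨⟨hz1.le, ?_⟩, ⟨hz20.le, ?_⟩⟩
          · exact abs_sq_le_aux (by nlinarith) (by positivity)
          · exact abs_sq_le_aux (by nlinarith) (by positivity)
        have hz2J : z.2 ≤ 2 * J := hzR.2.2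
        rw [hI1, indicator_of_mem h, indicator_of_mem hzR]
        have b1 := hUs1.trans (mul_le_mul_of_nonneg_left (mK_anti hn hz1 hJ h.1) (sq_nonneg C0))
        calc 40 * C1 ^ 2 * Us * (α + β * z.2) * (1 / J) ^ 2 + 8 * C1 * β * Us * (1 / J) 
            ≤ 40 * C1 ^ 2 * (C0 ^ 2 * (1 / J)) * (α + β * (2 * J)) * (1 / J) ^ 2 + 8 * C1 * β * (C0 ^ 2 * (1 / J)) * (1 / J) := by gcongr
          _ = 40 * C1 ^ 2 * C0 ^ 2 * ((α + β * (2 * J)) / J ^ 3) + 8 * C1 * C0 ^ 2 * (β / J ^ 2) := by field_simp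
          _ ≤ 4 * A * ((α + β * (2 * J)) / J ^ 3) + 4 * A * (β / J ^ 2) := by
              have x1 : 0 ≤ (α + β * (2 * J)) / J ^ 3 := by positivity
              have x2 : 0 ≤ β / J ^ 2 := by positivity
              have x3 : 0 ≤ C1 ^ 2 * C0 ^ 2 := by positivity
              have x4 : 0 ≤ C1 * C0 ^ 2 := by positivity
              refine add_le_add (mul_le_mul_of_nonneg_right ?_ x1) (mul_le_mul_of_nonneg_right ?_ x2) <;> (rw [hA]; linarith)
          _ = k1 := by rw [hk1]; ring
      · rw [hI1, indicator_of_notMem h]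
        have : 0 ≤ R1.indicator (fun _ => k1) z := indicator_nonneg (fun _ _ => hk10) _
        simpa using this
    · by_cases h : z ∈ boxS l J
      · have h' : J ^ 2 * na (z - (0, 2 * l)) ≤ 2 := h
        simp only [na, Prod.fst_sub, Prod.snd_sub, sub_zero] at h'
        have y1 : z.1 ≤ 2 / J := by
          rw [le_div_iff₀ hJ0]
          exact abs_sq_le_aux (by nlinarith [sq_nonneg (J * (z.2 - 2 * l))]) (by positivity)
        have y2 : |z.2 - 2 * l| ≤ 2 / J := by
          rw [le_div_iff₀ hJ0]
          exact abs_sq_le_aux (by rw [mul_pow, sq_abs]; nlinarith [sq_nonneg (J * z.1)]) (by positivity)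
        rw [abs_le] at y2
        have hzR : z ∈ R2 := ⟨⟨hz1.le, y1⟩, ⟨by linarith [y2.1], by linarith [y2.2]⟩⟩
        have hJ2 : 2 / J ≤ 2 := by rw [div_le_iff₀ hJ0]; linarith
        rw [hI2, indicator_of_mem h, indicator_of_mem hzR]
        have zl : z.2 ≤ 2 * l + 2 := by linarith [y2.2]
        have b0 : mK n z ≤ l⁻¹ ^ n := by
          unfold mK
          rw [← inv_pow]
          have : l ≤ √(na z) := Real.le_sqrt_of_sq_le (by unfold na; nlinarith [sq_nonneg z.1])
          gcongr
        have b00 : 0 ≤ mK n z := by unfold mK; positivity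
        have b2 : z.1 ^ n ≤ 2 ^ n / J := by
          calc z.1 ^ n ≤ (2 / J) ^ n := by gcongr
            _ = 2 ^ n / J ^ n := div_pow _ _ _
            _ ≤ 2 ^ n / J := by
              gcongr
              calc J = J ^ 1 := (pow_one J).symm
                _ ≤ J ^ n := pow_le_pow_right₀ hJ hn
        have b1 : Us ≤ 2 ^ n * M / J := by
          refine hUs1.trans ?_
          calc C0 ^ 2 * (z.1 ^ n * mK n z ^ 2) ≤ C0 ^ 2 * (2 ^ n / J * (l⁻¹ ^ n) ^ 2) := by gcongr
            _ = _ := by rw [hM]; ring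
        calc 40 * C1 ^ 2 * Us * (α + β * z.2) * J ^ 2 + 8 * C1 * β * Us * J
            ≤ 40 * C1 ^ 2 * (2 ^ n * M / J) * (α + β * (2 * l + 2)) * J ^ 2 + 8 * C1 * β * (2 ^ n * M / J) * J := by gcongr
          _ = 2 ^ n * (40 * C1 ^ 2 * M * (α + β * (2 * l + 2)) * J + 8 * C1 * M * β) := by field_simp
          _ ≤ 2 ^ n * (40 * C1 ^ 2 * M * ((α + β) * (1 + 2 * l + 2)) * J + 8 * C1 * M * ((α + β) * J)) := by
              have g1 : α + β * (2 * l + 2) ≤ (α + β) * (1 + 2 * l + 2) := by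
                have : 0 ≤ α * (2 * l + 2) := by positivity
                linarith
              have g2 : β ≤ (α + β) * J :=
                calc β ≤ (α + β) * 1 := by linarith
                  _ ≤ (α + β) * J := mul_le_mul_of_nonneg_left hJ (by linarith)
              have g3 : 0 ≤ 40 * C1 ^ 2 * M := by positivity
              have g4 : 0 ≤ 8 * C1 * M := by positivity
              exact mul_le_mul_of_nonneg_left (add_le_add (mul_le_mul_of_nonneg_right (mul_le_mul_of_nonneg_left g1 g3) hJ0.le)
                (mul_le_mul_of_nonneg_left g2 g4)) (by positivity)
          _ ≤ k2 := by
              rw [hk2, hD]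
              have x1 : 0 ≤ 2 ^ n * (C1 ^ 2 * M * (1 + 2 * l + 2)) * ((α + β) * J) := by positivity
              have x2 : 0 ≤ 2 ^ n * (C1 * M) * ((α + β) * J) := by positivity
              linarith
      · rw [hI2, indicator_of_notMem h]
        have : 0 ≤ R2.indicator (fun _ => k2) z := indicator_nonneg (fun _ _ => hk20) _
        simpa using this
  have i3 : IntegrableOn (fun z => R1.indicator (fun _ => k1) z + R2.indicator (fun _ => k2) z) (Qd l) := (i1.add i2).integrableOn
  refine (setIntegral_mono_on hi1 (hi2.add i3) (Qd_meas l) pt).trans ?_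
  simp only [Pi.add_apply]
  rw [integral_add hi2 i3]
  gcongr
  calc ∫ z in Qd l, (R1.indicator (fun _ => k1) z + R2.indicator (fun _ => k2) z) ≤ ∫ z, (R1.indicator (fun _ => k1) z + R2.indicator (fun _ => k2) z) := by
        refine setIntegral_le_integral (i1.add i2) (ae_of_all _ fun z => ?_)
        exact add_nonneg (indicator_nonneg (fun _ _ => hk10) _) (indicator_nonneg (fun _ _ => hk20) _)
    _ = (2 * J - 0) * (2 * J - 0) * k1 + (2 / J - 0) * ((2 * l + 2 / J) - (2 * l - 2 / J)) * k2 := by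
        rw [integral_add i1 i2, integral_indicator_const _ m1, integral_indicator_const _ m2, Measure.real, Measure.real, hR1, hR2,
          vol_rect _ _ _ _ (by positivity) (by positivity), vol_rect _ _ _ _ (by positivity) (by linarith [show 0 < 2 / J by positivity]), smul_eq_mul, smul_eq_mul]
    _ = 16 * A * (α / J + 3 * β) + 32 * D * (α / J + β / J) := by
        rw [hk1, hk2]; field_simp; ring
    _ ≤ _ := by
        have x : β / J ≤ β := div_le_self hβ hJ
        have y : 0 ≤ α / J := by positivity
        nlinarith [mul_nonneg hA0 hβ, mul_nonneg hA0 y, mul_nonneg hD0 y, mul_nonneg hD0 hβ, mul_le_mul_of_nonneg_left x hD0]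

end Heisenberg

namespace Heisenberg
open scoped ContDiff ENNReal

lemma mK_le {n : ℕ} {l : ℝ} (hl : 0 < l) {z : ℝ × ℝ} (hz : l ≤ z.2) : mK n z ≤ l⁻¹ ^ n := by
  unfold mK
  rw [← inv_pow]
  have : l ≤ √(na z) := Real.le_sqrt_of_sq_le (by unfold na; nlinarith [sq_nonneg z.1])
  gcongr

lemma max_lip (x y : ℝ) : |max x 0 - max y 0| ≤ |x - y| := by
  simpa using abs_max_sub_max_le_abs x y 0

theorem approx {n : ℕ} (hn : 1 ≤ n) {l : ℝ} (hl : 0 < l) {w b : ℕ → ℝ × ℝ → ℝ} {U B E : ℝ × ℝ → ℝ}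
    (hcls : ∀ m, Cls n (Udom l) (w m) (b m)) (hb : ∀ m, ContinuousOn (b m) (Udom l))
    (hw : ∀ m s, w m (s, l) = 0)
    (cU : ContinuousOn U (Udom l ∩ {z | 0 ≤ z.1})) (cB : ContinuousOn B (Udom l ∩ {z | 0 ≤ z.1}))
    (tw : ∀ K, IsCompact K → K ⊆ Udom l ∩ {z | 0 ≤ z.1} → TendstoUniformlyOn w U atTop K)
    (tb : ∀ K, IsCompact K → K ⊆ Udom l ∩ {z | 0 ≤ z.1} → TendstoUniformlyOn b B atTop K)
    {C0 : ℝ} (hC0 : 0 ≤ C0) (hU : ∀ z ∈ Qd l, max (U z) 0 ≤ C0 * mK n z)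
    (hBE : ∀ z ∈ Qd l, B z ≤ E z) (hE : ∀ z ∈ Qd l, 0 ≤ E z)
    (hi0 : IntegrableOn (fun z => z.1 ^ (n - 1) * E z * max (U z) 0) (Qd l))
    (hi1 : IntegrableOn (fun z => z.1 ^ (n - 1) * E z * max (U z) 0 * z.2) (Qd l)) :
    ∃ (h : ℕ → ℝ × ℝ → ℝ) (C : ℝ), (∀ j, ContDiff ℝ 1 (h j)) ∧ (∀ j, HasCompactSupport (h j)) ∧
      (∀ j z, 0 ≤ h j z) ∧ (∀ j s, h j (s, l) = 0) ∧
      (∀ z ∈ Qd l, Tendsto (fun j => h j z) atTop (𝓝 (max (U z) 0))) ∧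
      (∀ j, ∀ z ∈ Qd l, h j z ≤ C) ∧
      (∀ j, ∫ z in Qd l, z.1 ^ n * (pds (h j) z ^ 2 + pdt (h j) z ^ 2) ≤
        (∫ z in Qd l, z.1 ^ (n - 1) * E z * max (U z) 0) + C / (j + 1)) ∧
      (∀ j, ∫ z in Qd l, z.1 ^ n * z.2 * (pds (h j) z ^ 2 + pdt (h j) z ^ 2) ≤ C) := by
  obtain ⟨C1, hC1, hcut⟩ := cutoff hl
  obtain ⟨C2, hC2, herr⟩ := err_bound hn hl hC0 hC1.le
  choose ζ z1 z2 z3 z4 z5 z6 z7 z8 using fun j : ℕ => hcut (j + 1) (by linarith [Nat.cast_nonneg (α := ℝ) j])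
  have hJ : ∀ j : ℕ, (1 : ℝ) ≤ j + 1 := fun j => by linarith [Nat.cast_nonneg (α := ℝ) j]
  have hJ0 : ∀ j : ℕ, (0 : ℝ) < j + 1 := fun j => by positivity
  set δ : ℕ → ℝ := fun j => 1 / ((j : ℝ) + 1) with hδd
  have hδ : ∀ j, 0 < δ j := fun j => by simp only [hδd]; positivity
  have hδ1 : ∀ j, δ j ≤ 1 := fun j => by simp only [hδd]; rw [div_le_one (hJ0 j)]; exact hJ j
  have hKs : ∀ j, Kz l (ζ j) ⊆ Udom l ∩ {z | 0 ≤ z.1} := fun j z hz => ⟨z3 j hz.1, hz.2.1⟩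
  have hKc : ∀ j, IsCompact (Kz l (ζ j)) := fun j => Kz_compact (z2 j)
  have lim := fun (j : ℕ) (α β : ℝ) => rhs_lim (n := n) (l := l) (α := α) (β := β) (hδ j) (z1 j) (z2 j)
    (fun m => (hcls m).c1.continuousOn.mono ((hKs j).trans inter_subset_left)) (fun m => (hb m).mono ((hKs j).trans inter_subset_left))
    (cU.mono (hKs j)) (cB.mono (hKs j)) (tw _ (hKc j) (hKs j)) (tb _ (hKc j) (hKs j))
  have ex : ∀ j, ∃ m, (∀ z ∈ Kz l (ζ j), dist (U z) (w m z) < δ j) ∧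
      (∫ z in Qd l, rhsE n 1 0 (δ j) (w m) (b m) (ζ j) z < (∫ z in Qd l, rhsE n 1 0 (δ j) U B (ζ j) z) + δ j) ∧
      (∫ z in Qd l, rhsE n 0 1 (δ j) (w m) (b m) (ζ j) z < (∫ z in Qd l, rhsE n 0 1 (δ j) U B (ζ j) z) + δ j) := by
    intro j
    have e1 := Metric.tendstoUniformlyOn_iff.1 (tw _ (hKc j) (hKs j)) (δ j) (hδ j)
    have e2 := (lim j 1 0).2.eventually_lt_const (lt_add_of_pos_right _ (hδ j))
    have e3 := (lim j 0 1).2.eventually_lt_const (lt_add_of_pos_right _ (hδ j))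
    exact (e1.and (e2.and e3)).exists
  choose m hm1 hm2 hm3 using ex
  have i0 : IntegrableOn (fun z => z.1 ^ (n - 1) * E z * max (U z) 0 * (1 + 0 * z.2)) (Qd l) := by simpa using hi0
  have i1 : IntegrableOn (fun z => z.1 ^ (n - 1) * E z * max (U z) 0 * (0 + 1 * z.2)) (Qd l) := by simpa using hi1
  set M2 := ∫ z in Qd l, z.1 ^ (n - 1) * E z * max (U z) 0 * z.2 with hM2
  set CC := max (C0 * l⁻¹ ^ n + 1) (max (C2 + 1) (M2 + C2 + 1)) with hCC
  have en := fun (j : ℕ) (α β : ℝ) (hα : 0 ≤ α) (hβ : 0 ≤ β) => energy hn (hδ j) hl hα hβ (isOpen_Udom l) (hcls (m j)) (hb (m j)) (fun s _ => hw _ s) (z1 j) (z2 j) (z3 j)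
  refine ⟨fun j z => kT (δ j) (w (m j) z) * ζ j z, CC, fun j => ?_, fun j => ?_, fun j z => ?_, fun j s => ?_, fun z hz => ?_, fun j z hz => ?_, fun j => ?_, fun j => ?_⟩
  · exact h_contDiff (hδ j) (isOpen_Udom l) (hcls (m j)).c1 (z1 j) (z3 j)
  · exact (z2 j).mul_left
  · exact mul_nonneg (kT_nonneg (hδ j) _) (z4 j z)
  · simp only [hw, kT_zero, zero_mul]
  · -- convergence
    have hz1 : 0 < z.1 := hz.1
    have hna : 0 < na (z - (0, 2 * l)) := by
      simp only [na, Prod.fst_sub, Prod.snd_sub]; nlinarith [sq_nonneg (z.2 - 2 * l)]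
    have tJ : Tendsto (fun j : ℕ => ((j : ℝ) + 1) ^ 2) atTop atTop :=
      (tendsto_pow_atTop (by norm_num)).comp (tendsto_atTop_add_const_right _ _ tendsto_natCast_atTop_atTop)
    have e1 := tJ.eventually_ge_atTop (na z)
    have e2 := (tJ.atTop_mul_const hna).eventually_ge_atTop 2
    have tδ : Tendsto (fun j => 2 * δ j) atTop (𝓝 0) := by
      have := (tendsto_one_div_add_atTop_nhds_zero_nat (𝕜 := ℝ)).const_mul 2
      simpa [hδd] using this
    refine tendsto_iff_dist_tendsto_zero.2 (squeeze_zero' (Eventually.of_forall fun j => dist_nonneg) ?_ tδ)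
    filter_upwards [e1, e2] with j h1 h2
    have hζ1 := z6 j z hz h1 h2
    have hK : z ∈ Kz l (ζ j) := ⟨subset_tsupport _ (by simp [hζ1]), hz1.le, mem_Ici.2 (le_of_lt hz.2)⟩
    have a := hm1 j z hK
    rw [hζ1, mul_one, Real.dist_eq]
    rw [Real.dist_eq] at a
    have b1 := kT_le (hδ j) (w (m j) z)
    have b2 := le_kT (hδ j) (w (m j) z)
    have b3 := max_lip (w (m j) z) (U z)
    rw [abs_sub_comm] at a
    have b4 := abs_le.1 (b3.trans a.le)
    rw [abs_le]; constructor <;> linarith [b4.1, b4.2]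
  · by_cases hzt : z ∈ tsupport (ζ j)
    · have hK : z ∈ Kz l (ζ j) := ⟨hzt, mem_Ici.2 (le_of_lt hz.1), mem_Ici.2 (le_of_lt hz.2)⟩
      have a := hm1 j z hK
      rw [Real.dist_eq, abs_sub_comm] at a
      have b3 := abs_le.1 ((max_lip (w (m j) z) (U z)).trans a.le)
      have b1 := kT_le (hδ j) (w (m j) z)
      have b5 := hU z hz
      have b6 := mul_le_mul_of_nonneg_left (mK_le (n := n) hl (le_of_lt hz.2)) hC0
      have b7 : kT (δ j) (w (m j) z) * ζ j z ≤ kT (δ j) (w (m j) z) := mul_le_of_le_one_right (kT_nonneg (hδ j) _) (z5 j z)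
      refine le_trans ?_ (le_max_left _ _)
      linarith [hδ1 j, b3.2]
    · show kT (δ j) (w (m j) z) * ζ j z ≤ CC
      rw [(zero_of_nt hzt).1, mul_zero]
      refine le_trans ?_ (le_max_left _ _)
      positivity
  · have a1 := en j 1 0 (by norm_num) (by norm_num)
    have a2 := herr 1 0 (δ j) (j + 1) (by norm_num) (by norm_num) (hδ j) (hJ j) (ζ j) U B E (z4 j) (z5 j) (z7 j) (z8 j) hU hBE hE (lim j 1 0).1 i0
    have a3 := hm2 j
    simp only [zero_mul, add_zero, mul_one] at a1 a2
    refine a1.trans (a3.le.trans ?_)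
    have a4 : C2 * (1 / ((j : ℝ) + 1)) + δ j ≤ CC / (j + 1) := by
      simp only [hδd]
      rw [← add_one_mul, mul_one_div]
      gcongr
      exact (le_max_left _ _).trans (le_max_right _ _)
    linarith
  · have a1 := en j 0 1 (by norm_num) (by norm_num)
    have a2 := herr 0 1 (δ j) (j + 1) (by norm_num) (by norm_num) (hδ j) (hJ j) (ζ j) U B E (z4 j) (z5 j) (z7 j) (z8 j) hU hBE hE (lim j 0 1).1 i1
    have a3 := hm3 j
    simp only [one_mul, zero_add, zero_div, mul_one] at a1 a2
    refine a1.trans (a3.le.trans ?_)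
    have : M2 + C2 + 1 ≤ CC := (le_max_right _ _).trans (le_max_right _ _)
    linarith [hδ1 j]

end Heisenberg

namespace Heisenberg
open scoped ContDiff ENNReal

lemma moll : ∃ κ : ℕ → ℝ → ℝ, (∀ m, IsK (κ m)) ∧ ∀ w : ℝ × ℝ → ℝ, Continuous w → ∀ K, IsCompact K →
    TendstoUniformlyOn (fun m => Mo (κ m) w) w atTop K := by
  let φ : ℕ → ContDiffBump (0 : ℝ) := fun m => ⟨1 / (2 * ((m : ℝ) + 1)), 1 / ((m : ℝ) + 1), by positivity, by
    apply one_div_lt_one_div_of_lt <;> [positivity; nlinarith [Nat.cast_nonneg (α := ℝ) m]]⟩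
  refine ⟨fun m => (φ m).normed volume, fun m => ⟨(φ m).contDiff_normed, ?_⟩, fun w hw K hK => ?_⟩
  · rw [ContDiffBump.tsupport_normed_eq, Real.closedBall_eq_Icc]
    have : (φ m).rOut ≤ 1 := by
      show 1 / ((m : ℝ) + 1) ≤ 1
      rw [div_le_one (by positivity)]; linarith [Nat.cast_nonneg (α := ℝ) m]
    apply Icc_subset_Icc <;> linarith
  · rw [Metric.tendstoUniformlyOn_iff]
    intro ε hε
    have hK1 : IsCompact (Metric.cthickening 1 K) := hK.cthickening
    have uc := hK1.uniformContinuousOn_of_continuous hw.continuousOn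
    rw [Metric.uniformContinuousOn_iff] at uc
    obtain ⟨δ, hδ, H⟩ := uc (ε / 2) (by positivity)
    have e1 : ∀ᶠ m : ℕ in atTop, 1 / ((m : ℝ) + 1) < min δ 1 :=
      tendsto_one_div_add_atTop_nhds_zero_nat.eventually_lt_const (by positivity)
    filter_upwards [e1] with m hm z hz
    have eq : Mo ((φ m).normed volume) w z = (convolution ((φ m).normed volume) (fun τ => w (z.1, τ)) (ContinuousLinearMap.lsmul ℝ ℝ) volume) z.2 := by
      unfold Mo convolution
      rw [← integral_sub_left_eq_self (fun τ => w (z.1, τ) * ((φ m).normed volume) (z.2 - τ)) volume z.2]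
      congr 1; ext τ; simp; ring
    have := ContDiffBump.dist_normed_convolution_le (φ := φ m) (μ := (volume : Measure ℝ)) (g := fun τ => w (z.1, τ)) (x₀ := z.2) (ε := ε / 2)
      (by fun_prop : Continuous fun τ => w (z.1, τ)).aestronglyMeasurable (fun x hx => by
        have hx' : dist x z.2 < 1 / ((m : ℝ) + 1) := hx
        have d : dist (z.1, x) z < min δ 1 := by
          rw [Prod.dist_eq]; simp only [dist_self]; exact max_lt (by positivity) (hx'.trans hm)
        exact (H (z.1, x) (Metric.mem_cthickening_of_dist_le _ z _ _ hz (d.le.trans (min_le_right _ _))) z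
          (Metric.self_subset_cthickening _ hz) (d.trans_le (min_le_left _ _))).le)
    rw [dist_comm, eq]
    linarith

lemma unif_mul {K : Set (ℝ × ℝ)} (hK : IsCompact K) {a : ℝ × ℝ → ℝ} (ha : ContinuousOn a K)
    {T : ℝ × ℝ → ℝ × ℝ} {W : ℕ → ℝ × ℝ → ℝ} {W0 : ℝ × ℝ → ℝ}
    (h : TendstoUniformlyOn W W0 atTop (T '' K)) :
    TendstoUniformlyOn (fun m z => a z * W m (T z)) (fun z => a z * W0 (T z)) atTop K := by
  obtain ⟨M, hM⟩ := hK.exists_bound_of_continuousOn ha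
  rw [Metric.tendstoUniformlyOn_iff] at *
  intro ε hε
  filter_upwards [h (ε / (|M| + 1)) (by positivity)] with m hm z hz
  have h1 := hm (T z) (mem_image_of_mem _ hz)
  have h2 := hM z hz
  rw [Real.dist_eq, ← mul_sub, abs_mul]
  rw [Real.dist_eq] at h1
  rw [Real.norm_eq_abs] at h2
  calc |a z| * |W0 (T z) - W m (T z)| ≤ |M| * |W0 (T z) - W m (T z)| := by
        exact mul_le_mul_of_nonneg_right (h2.trans (le_abs_self _)) (abs_nonneg _)
    _ ≤ |M| * (ε / (|M| + 1)) := by gcongr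
    _ < (|M| + 1) * (ε / (|M| + 1)) := by gcongr; linarith
    _ = ε := by field_simp

lemma unif_dif {l : ℝ} {K : Set (ℝ × ℝ)} {W : ℕ → ℝ × ℝ → ℝ} {W0 : ℝ × ℝ → ℝ}
    (h : TendstoUniformlyOn W W0 atTop K) (h2 : TendstoUniformlyOn W W0 atTop (refl l '' K)) :
    TendstoUniformlyOn (fun m => dif l (W m)) (dif l W0) atTop K := by
  rw [Metric.tendstoUniformlyOn_iff] at *
  intro ε hε
  filter_upwards [h (ε / 2) (by positivity), h2 (ε / 2) (by positivity)] with m hm hm2 z hz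
  have h1 := hm z hz
  have h2 := hm2 (refl l z) (mem_image_of_mem _ hz)
  rw [Real.dist_eq] at *
  unfold dif
  rw [abs_lt] at *
  constructor <;> linarith [h1.1, h1.2, h2.1, h2.2]

lemma Tinv_nonneg {z : ℝ × ℝ} (hz : 0 ≤ z.1) : 0 ≤ (Tinv z).1 := div_nonneg hz (na_nonneg z)

lemma mKna_cont {n : ℕ} : ContinuousOn (fun z => mK n z / na z) {0}ᶜ :=
  (mK_contDiffOn (k := 1)).continuousOn.div continuous_na.continuousOn (fun _ hz => (na_pos hz).ne')

theorem approxU {n : ℕ} (hn : 1 ≤ n) {l : ℝ} (hl : 0 < l) {u F : H n → ℝ} (hu : Continuous u) (hF : Continuous F)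
    (hcyl : IsCylindrical u) (hsol : IsWeakSol univ u F) {u0 F0 : ℝ × ℝ → ℝ} (hu0 : Continuous u0)
    (hF0 : Continuous F0) (eu : ∀ ξ, u ξ = u0 (piH ξ)) (eF : ∀ ξ, F ξ = F0 (piH ξ)) {U E : ℝ × ℝ → ℝ}
    (eU : U = dif l (kel n u0))
    {C0 : ℝ} (hC0 : 0 ≤ C0) (hU : ∀ z ∈ Qd l, max (U z) 0 ≤ C0 * mK n z)
    (hBE : ∀ z ∈ Qd l, dif l (kelB n F0) z ≤ E z) (hE : ∀ z ∈ Qd l, 0 ≤ E z)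
    (hi0 : IntegrableOn (fun z => z.1 ^ (n - 1) * E z * max (U z) 0) (Qd l))
    (hi1 : IntegrableOn (fun z => z.1 ^ (n - 1) * E z * max (U z) 0 * z.2) (Qd l)) :
    ∃ (h : ℕ → ℝ × ℝ → ℝ) (C : ℝ), (∀ j, ContDiff ℝ 1 (h j)) ∧ (∀ j, HasCompactSupport (h j)) ∧
      (∀ j z, 0 ≤ h j z) ∧ (∀ j s, h j (s, l) = 0) ∧
      (∀ z ∈ Qd l, Tendsto (fun j => h j z) atTop (𝓝 (max (U z) 0))) ∧
      (∀ j, ∀ z ∈ Qd l, h j z ≤ C) ∧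
      (∀ j, ∫ z in Qd l, z.1 ^ n * (pds (h j) z ^ 2 + pdt (h j) z ^ 2) ≤
        (∫ z in Qd l, z.1 ^ (n - 1) * E z * max (U z) 0) + C / (j + 1)) ∧
      (∀ j, ∫ z in Qd l, z.1 ^ n * z.2 * (pds (h j) z ^ 2 + pdt (h j) z ^ 2) ≤ C) := by
  subst eU
  obtain ⟨κ, hκ, tκ⟩ := moll
  have cT : ContinuousOn Tinv {0}ᶜ := (Tinv_contDiffOn (k := 1)).continuousOn
  have cm : ContinuousOn (mK n) {0}ᶜ := (mK_contDiffOn (k := 1)).continuousOn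
  have ckel : ∀ W, Continuous W → ContinuousOn (kel n W) {0}ᶜ := fun W hW => cm.mul (hW.comp_continuousOn cT)
  have ckelB : ∀ W, Continuous W → ContinuousOn (kelB n W) {0}ᶜ := fun W hW => mKna_cont.mul (hW.comp_continuousOn cT)
  have cdif : ∀ W, ContinuousOn W {0}ᶜ → ContinuousOn (dif l W) (Udom l) := fun W hW =>
    (hW.mono (fun z hz => hz.1)).sub (hW.comp (continuous_refl l).continuousOn (fun z hz => hz.2))
  have hcl := fun m => uK_cls hn hu hF hcyl hsol hu0 hF0 eu eF (hκ m)
  have key : ∀ (a : ℝ × ℝ → ℝ) (W : ℕ → ℝ × ℝ → ℝ) (W0 : ℝ × ℝ → ℝ), ContinuousOn a {0}ᶜ →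
      (∀ K, IsCompact K → K ⊆ {z | 0 ≤ z.1} → TendstoUniformlyOn W W0 atTop K) →
      ∀ K, IsCompact K → K ⊆ Udom l ∩ {z | 0 ≤ z.1} →
      TendstoUniformlyOn (fun m => dif l (fun z => a z * W m (Tinv z))) (dif l (fun z => a z * W0 (Tinv z))) atTop K := by
    intro a W W0 ha hW K hK hKs
    have k0 : ∀ K, IsCompact K → K ⊆ {0}ᶜ → K ⊆ {z | 0 ≤ z.1} →
        TendstoUniformlyOn (fun m z => a z * W m (Tinv z)) (fun z => a z * W0 (Tinv z)) atTop K := by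
      intro K hK h1 h2
      refine unif_mul hK (ha.mono h1) (hW _ (hK.image_of_continuousOn (cT.mono h1)) ?_)
      rintro _ ⟨z, hz, rfl⟩
      exact Tinv_nonneg (h2 hz)
    refine unif_dif (k0 K hK (fun z hz => (hKs hz).1.1) (fun z hz => (hKs hz).2))
      (k0 _ (hK.image (continuous_refl l)) ?_ ?_)
    · rintro _ ⟨z, hz, rfl⟩; exact (hKs hz).1.2
    · rintro _ ⟨z, hz, rfl⟩; exact (hKs hz).2
  refine approx hn hl (w := fun m => dif l (kel n (uK n (κ m) u0 F0))) (b := fun m => dif l (kelB n (Mo (κ m) F0)))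
    (B := dif l (kelB n F0)) (fun m => dif_cls (kel_cls (hcl m))) (fun m => cdif _ (ckelB _ (Mo_cont (hκ m) hF0)))
    (fun m s => ?_) ((cdif _ (ckel _ hu0)).mono inter_subset_left) ((cdif _ (ckelB _ hF0)).mono inter_subset_left)
    (fun K hK hKs => key (mK n) _ _ cm ?_ K hK hKs)
    (fun K hK hKs => key (fun z => mK n z / na z) _ _ mKna_cont ?_ K hK hKs) hC0 hU hBE hE hi0 hi1
  · simp [dif, refl, show 2 * l - l = l by ring]
  · intro K hK hKs
    exact (tκ u0 hu0 K hK).congr (Eventually.of_forall fun m z hz =>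
      (uK_eq hn hu hF hcyl hsol hu0 hF0 eu eF (hκ m) z (hKs hz)).symm)
  · intro K hK hKs
    exact tκ F0 hF0 K hK

end Heisenberg

namespace Heisenberg
open scoped ContDiff ENNReal

lemma f_nonneg {τ : ℝ} (hτ : 0 < τ) {f : ℝ → ℝ} (hm : ∀ s t : ℝ, 0 < s → s ≤ t → f s ≤ f t)
    (ha : ∀ s t : ℝ, 0 < s → s ≤ t → f t / t ^ τ ≤ f s / s ^ τ) {s : ℝ} (hs : 0 < s) : 0 ≤ f s := by
  by_contra hf
  push Not at hf
  have h1 := hm s (2 * s) hs (by linarith)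
  have h2 := ha s (2 * s) hs (by linarith)
  have hp : 0 < s ^ τ := rpow_pos_of_pos hs _
  have hq : 1 < (2 : ℝ) ^ τ := one_lt_rpow (by norm_num) hτ
  rw [mul_rpow (by norm_num) hs.le] at h2
  have h3 : f s / (2 ^ τ * s ^ τ) ≤ f s / s ^ τ := le_trans (by gcongr) h2
  rw [div_le_div_iff₀ (by positivity) hp] at h3
  have : f s * s ^ τ < 0 := mul_neg_of_neg_of_pos hf hp
  nlinarith

lemma tau_eq {n : ℕ} (hn : 1 ≤ n) : tau n = 1 + 2 / n := by
  unfold tau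
  have : (0:ℝ) < n := by exact_mod_cast hn
  field_simp; ring

lemma mK_pos {n : ℕ} {z : ℝ × ℝ} (hz : z ≠ 0) : 0 < mK n z := by
  unfold mK
  have := Real.sqrt_pos.2 (na_pos hz)
  positivity

lemma mK_rpow {n : ℕ} (hn : 1 ≤ n) {z : ℝ × ℝ} (hz : z ≠ 0) : mK n z ^ (2 / (n : ℝ)) = (na z)⁻¹ := by
  have hp := na_pos hz
  have : (0:ℝ) < n := by exact_mod_cast hn
  unfold mK
  rw [inv_rpow (by positivity), ← rpow_natCast, ← rpow_mul (by positivity)]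
  rw [show (n : ℝ) * (2 / n) = (2 : ℕ) by field_simp; norm_num, rpow_natCast, sq_sqrt hp.le]

lemma mK_tau {n : ℕ} (hn : 1 ≤ n) {z : ℝ × ℝ} (hz : z ≠ 0) : mK n z ^ (tau n) = mK n z / na z := by
  rw [tau_eq hn, rpow_add (mK_pos hz), rpow_one, mK_rpow hn hz]; rfl

lemma bern {τ x y : ℝ} (hτ : 1 ≤ τ) (hx : 0 < x) (hy : 0 ≤ y) : x ^ τ - y ^ τ ≤ τ * x ^ (τ - 1) * (x - y) := by
  have h := one_add_mul_self_le_rpow_one_add (s := y / x - 1) (by linarith [div_nonneg hy hx.le]) hτ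
  rw [show 1 + (y / x - 1) = y / x by ring, div_rpow hy hx.le] at h
  have hp : 0 < x ^ τ := rpow_pos_of_pos hx _
  rw [le_div_iff₀ hp] at h
  have e : x ^ (τ - 1) = x ^ τ / x := by rw [rpow_sub hx, rpow_one]
  rw [e]
  have e2 : τ * (x ^ τ / x) * (x - y) = - (τ * (y / x - 1) * x ^ τ) := by field_simp; ring
  rw [e2]; linarith

lemma ptwise {n : ℕ} (hn : 1 ≤ n) {f : ℝ → ℝ} (hm : ∀ s t : ℝ, 0 < s → s ≤ t → f s ≤ f t)
    (ha : ∀ s t : ℝ, 0 < s → s ≤ t → f t / t ^ tau n ≤ f s / s ^ tau n) {z z' : ℝ × ℝ} (hz : z ≠ 0) (hz' : z' ≠ 0)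
    (hna : na z' ≤ na z) {a a' C : ℝ} (ha0 : 0 < a) (ha1 : 0 < a') (hC : tau n * (f a / a) ≤ C) :
    mK n z / na z * f a - mK n z' / na z' * f a' ≤
      C * ((if 0 < f a ∧ 0 < mK n z * a - mK n z' * a' then (na z)⁻¹ else 0) * max (mK n z * a - mK n z' * a') 0) := by
  have hn' : (0:ℝ) < n := by exact_mod_cast hn
  have hτ : 1 ≤ tau n := by rw [tau_eq hn]; linarith [show 0 < 2 / (n:ℝ) by positivity]
  have hτ0 : 0 < tau n := by linarith
  have hm0 := mK_pos (n := n) hz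
  have hm1 := mK_pos (n := n) hz'
  have hmm : mK n z ≤ mK n z' := by
    unfold mK
    have := Real.sqrt_pos.2 (na_pos hz')
    gcongr
  rw [← mK_tau hn hz, ← mK_tau hn hz']
  have fa := f_nonneg hτ0 hm ha ha0
  have fa' := f_nonneg hτ0 hm ha ha1
  have pa : 0 < a ^ tau n := rpow_pos_of_pos ha0 _
  have pa' : 0 < a' ^ tau n := rpow_pos_of_pos ha1 _
  have pm : 0 < mK n z ^ tau n := rpow_pos_of_pos hm0 _
  have pm' : 0 < mK n z' ^ tau n := rpow_pos_of_pos hm1 _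
  have e1 : mK n z ^ tau n * f a = (mK n z * a) ^ tau n * (f a / a ^ tau n) := by
    rw [mul_rpow hm0.le ha0.le]; field_simp
  have e2 : mK n z' ^ tau n * f a' = (mK n z' * a') ^ tau n * (f a' / a' ^ tau n) := by
    rw [mul_rpow hm1.le ha1.le]; field_simp
  have hC0 : 0 ≤ C := le_trans (by positivity) hC
  by_cases hV : 0 < mK n z * a - mK n z' * a'
  · have haa : a' ≤ a := by
      by_contra hlt
      push Not at hlt
      nlinarith
    have hh := ha a' a ha1 haa
    have step : mK n z ^ tau n * f a - mK n z' ^ tau n * f a' ≤ (f a / a ^ tau n) * ((mK n z * a) ^ tau n - (mK n z' * a') ^ tau n) := by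
      rw [e1, e2]
      have : (mK n z' * a') ^ tau n * (f a / a ^ tau n) ≤ (mK n z' * a') ^ tau n * (f a' / a' ^ tau n) := by gcongr
      linarith
    rcases fa.eq_or_lt with h0 | h0
    · refine step.trans ?_
      rw [← h0]; simp
    · rw [if_pos ⟨h0, hV⟩, max_eq_left hV.le]
      refine step.trans ?_
      have b := bern hτ (mul_pos hm0 ha0) (mul_pos hm1 ha1).le
      calc _ ≤ (f a / a ^ tau n) * (tau n * (mK n z * a) ^ (tau n - 1) * (mK n z * a - mK n z' * a')) := by gcongr
        _ = tau n * (f a / a) * ((na z)⁻¹ * (mK n z * a - mK n z' * a')) := by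
            have : (mK n z * a) ^ (tau n - 1) = (na z)⁻¹ * (a ^ tau n / a) := by
              rw [mul_rpow hm0.le ha0.le, ← mK_rpow hn hz, rpow_sub ha0, rpow_one, tau_eq hn]; ring_nf
            rw [this]; field_simp
        _ ≤ _ := by
            have := na_pos hz
            gcongr
  · rw [if_neg (fun h => hV h.2), zero_mul, mul_zero]
    push Not at hV
    rcases le_total a a' with h | h
    · have := hm a a' ha0 h
      have h2 : mK n z ^ tau n ≤ mK n z' ^ tau n := by gcongr
      have h3 : mK n z ^ tau n * f a ≤ mK n z' ^ tau n * f a' := by gcongr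
      linarith
    · rw [e1, e2]
      have := ha a' a ha1 h
      have h2 : (mK n z * a) ^ tau n ≤ (mK n z' * a') ^ tau n := by
        apply rpow_le_rpow (by positivity) (by linarith) hτ0.le
      have h3 : (mK n z * a) ^ tau n * (f a / a ^ tau n) ≤ (mK n z' * a') ^ tau n * (f a' / a' ^ tau n) := by gcongr
      linarith

lemma norm_le_na (z : ℝ × ℝ) : ‖z‖ ≤ √(na z) := by
  rw [Prod.norm_def]
  apply max_le <;> apply Real.le_sqrt_of_sq_le <;> rw [Real.norm_eq_abs, sq_abs] <;> unfold na <;> nlinarith [sq_nonneg z.1, sq_nonneg z.2]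

lemma int_dec {l : ℝ} (hl : 0 < l) {G : ℝ × ℝ → ℝ} (hG : Measurable G) {C : ℝ}
    (h : ∀ z ∈ Qd l, |G z| ≤ C * (√(na z) ^ 3)⁻¹) : IntegrableOn G (Qd l) := by
  have i0 : Integrable (fun z : ℝ × ℝ => (1 + ‖z‖) ^ (-(3:ℝ))) := integrable_one_add_norm (by simp; norm_num)
  have i1 : IntegrableOn (fun z : ℝ × ℝ => |C| * (1 / l + 1) ^ 3 * (1 + ‖z‖) ^ (-(3:ℝ))) (Qd l) := (i0.const_mul _).integrableOn
  refine Integrable.mono' i1 hG.aestronglyMeasurable ?_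
  filter_upwards [ae_restrict_mem (Qd_meas l)] with z hz
  rw [Real.norm_eq_abs]
  have hz2 : l < z.2 := hz.2
  have h1 : l ≤ √(na z) := Real.le_sqrt_of_sq_le (by unfold na; nlinarith [sq_nonneg z.1])
  have hp : 0 < √(na z) := hl.trans_le h1
  have h2 : 1 + ‖z‖ ≤ (1 / l + 1) * √(na z) := by
    have : 1 ≤ 1 / l * √(na z) := by rw [one_div, ← div_eq_inv_mul, le_div_iff₀ hl]; linarith
    linarith [norm_le_na z]
  rw [rpow_neg (by positivity), show (3:ℝ) = (3:ℕ) by norm_num, rpow_natCast]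
  refine (h z hz).trans ?_
  rw [mul_assoc]
  have h3 : (√(na z) ^ 3)⁻¹ ≤ (1 / l + 1) ^ 3 * ((1 + ‖z‖) ^ 3)⁻¹ := by
    rw [← div_eq_mul_inv, inv_eq_one_div, div_le_div_iff₀ (by positivity) (by positivity), one_mul, ← mul_pow]
    gcongr
  gcongr
  exact le_abs_self C

lemma na_Tinv {z : ℝ × ℝ} (hz : z ≠ 0) : na (Tinv z) = (na z)⁻¹ := by
  have h := (na_pos hz).ne'
  have : na (Tinv z) = (z.1 ^ 2 + z.2 ^ 2) / na z ^ 2 := by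
    show (z.1 / na z) ^ 2 + (-z.2 / na z) ^ 2 = _
    ring
  rw [this, show z.1 ^ 2 + z.2 ^ 2 = na z from rfl]; field_simp

def Dl (l : ℝ) : Set (ℝ × ℝ) := {z | na z ≤ (l ^ 2)⁻¹}

lemma Dl_compact (l : ℝ) : IsCompact (Dl l) := by
  refine Metric.isCompact_of_isClosed_isBounded (isClosed_le continuous_na continuous_const) ?_
  refine (Metric.isBounded_closedBall (x := (0 : ℝ × ℝ)) (r := √((l ^ 2)⁻¹))).subset ?_
  intro z hz
  rw [mem_closedBall_zero_iff]
  exact (norm_le_na z).trans (Real.sqrt_le_sqrt hz)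

lemma Dl_anti {l m : ℝ} (hl : 0 < l) (h : l ≤ m) : Dl m ⊆ Dl l := fun z hz => by
  have hz' : na z ≤ (m ^ 2)⁻¹ := hz
  show na z ≤ (l ^ 2)⁻¹
  exact hz'.trans (by gcongr)

lemma zero_mem_Dl (l : ℝ) : (0 : ℝ × ℝ) ∈ Dl l := by
  show na 0 ≤ _
  simp [na]; positivity

lemma ne_of_snd {l : ℝ} (hl : 0 < l) {z : ℝ × ℝ} (hz : l ≤ z.2) : z ≠ 0 := by
  rintro rfl; simp at hz; linarith

lemma Tinv_mem {l : ℝ} (hl : 0 < l) {z : ℝ × ℝ} (hz : l ≤ z.2) : Tinv z ∈ Dl l := by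
  show na _ ≤ _
  rw [na_Tinv (ne_of_snd hl hz)]
  have : l ^ 2 ≤ na z := by unfold na; nlinarith [sq_nonneg z.1]
  gcongr

lemma Dl_bound {W : ℝ × ℝ → ℝ} (hW : Continuous W) (l : ℝ) : ∃ C, 0 < C ∧ ∀ z ∈ Dl l, |W z| ≤ C := by
  obtain ⟨M, hM⟩ := (Dl_compact l).exists_bound_of_continuousOn hW.continuousOn
  exact ⟨|M| + 1, by positivity, fun z hz => (hM z hz).trans (by linarith [le_abs_self M])⟩

/-- the constant -/
def Cst (W : ℝ × ℝ → ℝ) (l : ℝ) : ℝ := sSup (W '' Dl l)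

lemma Cst_le {W : ℝ × ℝ → ℝ} (hW : Continuous W) {l : ℝ} {z : ℝ × ℝ} (hz : z ∈ Dl l) : W z ≤ Cst W l :=
  le_csSup ((Dl_compact l).image hW).bddAbove (mem_image_of_mem _ hz)

lemma Cst_anti {W : ℝ × ℝ → ℝ} (hW : Continuous W) {l m : ℝ} (hl : 0 < l) (h : l ≤ m) : Cst W m ≤ Cst W l :=
  csSup_le_csSup ((Dl_compact l).image hW).bddAbove ⟨_, mem_image_of_mem _ (zero_mem_Dl m)⟩ (image_mono (Dl_anti hl h))

lemma measurable_na : Measurable na := continuous_na.measurable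
lemma measurable_mK {n : ℕ} : Measurable (mK n) := by
  unfold mK
  exact ((measurable_na.sqrt).pow_const n).inv
lemma measurable_Tinv : Measurable Tinv := by
  unfold Tinv
  exact (measurable_fst.div measurable_na).prodMk (measurable_snd.neg.div measurable_na)
lemma measurable_kel {n : ℕ} {W : ℝ × ℝ → ℝ} (hW : Measurable W) : Measurable (kel n W) :=
  measurable_mK.mul (hW.comp measurable_Tinv)
lemma measurable_dif {l : ℝ} {W : ℝ × ℝ → ℝ} (hW : Measurable W) : Measurable (dif l W) :=
  hW.sub (hW.comp (continuous_refl l).measurable)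

end Heisenberg

namespace Heisenberg
open scoped ContDiff ENNReal

lemma dec_aux {n : ℕ} (hn : 1 ≤ n) {l : ℝ} (hl : 0 < l) {z : ℝ × ℝ} (hz : z ∈ Qd l) :
    z.1 ^ (n - 1) * mK n z ^ 2 * (na z)⁻¹ * z.2 ≤ l⁻¹ ^ (n - 1) * (√(na z) ^ 3)⁻¹ ∧
    z.1 ^ (n - 1) * mK n z ^ 2 * (na z)⁻¹ ≤ l⁻¹ ^ n * (√(na z) ^ 3)⁻¹ := by
  have hz1 : 0 < z.1 := hz.1
  have hz2 : l < z.2 := hz.2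
  obtain ⟨k, rfl⟩ : ∃ k, n = k + 1 := ⟨n - 1, by omega⟩
  have hr : 0 < √(na z) := Real.sqrt_pos.2 (na_pos (ne_of_snd hl hz2.le))
  have h1 : z.1 ≤ √(na z) := Real.le_sqrt_of_sq_le (by unfold na; nlinarith [sq_nonneg z.2])
  have h2 : z.2 ≤ √(na z) := Real.le_sqrt_of_sq_le (by unfold na; nlinarith [sq_nonneg z.1])
  have hna : na z = √(na z) ^ 2 := (sq_sqrt (na_nonneg z)).symm
  have hz20 : 0 < z.2 := hl.trans hz2
  simp only [add_tsub_cancel_right]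
  unfold mK
  generalize √(na z) = r at *
  rw [hna]
  have hlr : l ≤ r := by linarith
  have e1 : z.1 ^ k * (r ^ (k + 1))⁻¹ ^ 2 * (r ^ 2)⁻¹ ≤ (r ^ (k + 4))⁻¹ := by
    calc _ ≤ r ^ k * (r ^ (k + 1))⁻¹ ^ 2 * (r ^ 2)⁻¹ := by gcongr
      _ = _ := by field_simp; ring
  have e2 : r⁻¹ ≤ l⁻¹ := by gcongr
  have e2' : 0 < r⁻¹ := by positivity
  constructor
  · calc _ ≤ (r ^ (k + 4))⁻¹ * r := by gcongr
      _ = r⁻¹ ^ k * (r ^ 3)⁻¹ := by rw [inv_pow]; field_simp; ring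
      _ ≤ _ := by gcongr
  · calc _ ≤ (r ^ (k + 4))⁻¹ := e1
      _ = r⁻¹ ^ (k + 1) * (r ^ 3)⁻¹ := by rw [inv_pow]; field_simp; ring
      _ ≤ _ := by gcongr

lemma mK_ex {n : ℕ} (hn : 1 ≤ n) {z : ℝ × ℝ} (hz : z ≠ 0) : mK n z ^ (2 + 2 / (n : ℝ)) = mK n z ^ 2 * (na z)⁻¹ := by
  rw [rpow_add (mK_pos hz), mK_rpow hn hz, rpow_two]

lemma intN {n : ℕ} (hn : 1 ≤ n) {l : ℝ} (hl : 0 < l) {W : ℝ × ℝ → ℝ} (hW : Measurable W) {C0 : ℝ} (hC0 : 0 ≤ C0)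
    (h : ∀ z ∈ Qd l, |W z| ≤ C0 * mK n z) :
    IntegrableOn (fun z => z.1 ^ (n - 1) * |W z| ^ (2 + 2 / (n : ℝ))) (Qd l) := by
  refine int_dec hl (C := C0 ^ (2 + 2 / (n : ℝ)) * l⁻¹ ^ n) ?_ fun z hz => ?_
  · have : Measurable fun z => |W z| := hW.norm
    exact (measurable_fst.pow_const _).mul (this.pow_const _)
  have hz1 : 0 < z.1 := hz.1
  have hz0 : z ≠ 0 := ne_of_snd hl (le_of_lt hz.2)
  have hm := mK_pos (n := n) hz0
  rw [abs_of_nonneg (by positivity)]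
  calc z.1 ^ (n - 1) * |W z| ^ (2 + 2 / (n : ℝ)) ≤ z.1 ^ (n - 1) * (C0 * mK n z) ^ (2 + 2 / (n : ℝ)) := by
        have := h z hz
        gcongr
    _ = C0 ^ (2 + 2 / (n : ℝ)) * (z.1 ^ (n - 1) * mK n z ^ 2 * (na z)⁻¹) := by
        rw [mul_rpow hC0 hm.le, mK_ex hn hz0]; ring
    _ ≤ C0 ^ (2 + 2 / (n : ℝ)) * (l⁻¹ ^ n * (√(na z) ^ 3)⁻¹) := by
        have := (dec_aux hn hl hz).2
        gcongr
    _ = _ := by ring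

/-- weighted measure -/
def muQ (n : ℕ) (l : ℝ) : Measure (ℝ × ℝ) := (volume.restrict (Qd l)).withDensity (fun z => ENNReal.ofReal (z.1 ^ (n - 1)))

lemma muQ_lint {n : ℕ} {l : ℝ} {F : ℝ × ℝ → ℝ≥0∞} (hF : Measurable F) :
    ∫⁻ z, F z ∂(muQ n l) = ∫⁻ z in Qd l, ENNReal.ofReal (z.1 ^ (n - 1)) * F z := by
  unfold muQ
  rw [lintegral_withDensity_eq_lintegral_mul _ (by fun_prop) hF]; rfl

lemma holder3 {α : Type*} [MeasurableSpace α] (μ : Measure α) {n : ℕ} (hn : 1 ≤ n) {A P R : α → ℝ} (hA : Measurable A) (hP : Measurable P)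
    (hR : Measurable R) (A0 : ∀ z, 0 ≤ A z) (P0 : ∀ z, 0 ≤ P z) (R0 : ∀ z, 0 ≤ R z) :
    ∫⁻ z, ENNReal.ofReal (A z * P z * R z) ∂μ ≤
      (∫⁻ z, ENNReal.ofReal (A z ^ (n + 1)) ∂μ) ^ (1 / ((n : ℝ) + 1)) *
      (∫⁻ z, ENNReal.ofReal (P z ^ (2 + 2 / (n : ℝ))) ∂μ) ^ ((n : ℝ) / (2 * n + 2)) *
      (∫⁻ z, ENNReal.ofReal (R z ^ (2 + 2 / (n : ℝ))) ∂μ) ^ ((n : ℝ) / (2 * n + 2)) := by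
  have hn' : (0:ℝ) < n := by exact_mod_cast hn
  have h := ENNReal.lintegral_prod_norm_pow_le (μ := μ) (Finset.univ : Finset (Fin 3))
    (f := ![fun z => ENNReal.ofReal (A z ^ (n + 1)), fun z => ENNReal.ofReal (P z ^ (2 + 2 / (n : ℝ))),
      fun z => ENNReal.ofReal (R z ^ (2 + 2 / (n : ℝ)))])
    (p := ![1 / ((n : ℝ) + 1), (n : ℝ) / (2 * n + 2), (n : ℝ) / (2 * n + 2)])
    (by
      intro i _
      fin_cases i
      · exact (hA.pow_const _).ennreal_ofReal.aemeasurable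
      · exact (hP.pow_const _).ennreal_ofReal.aemeasurable
      · exact (hR.pow_const _).ennreal_ofReal.aemeasurable)
    (by simp [Fin.sum_univ_three]; field_simp; ring)
    (by intro i _; fin_cases i <;> simp <;> positivity)
  simp only [Fin.prod_univ_three, Matrix.cons_val_zero, Matrix.cons_val_one, Matrix.cons_val] at h
  refine le_trans (le_of_eq ?_) h
  congr 1; ext z
  have q : ∀ x : ℝ, 0 ≤ x → ENNReal.ofReal (x ^ (2 + 2 / (n : ℝ))) ^ ((n : ℝ) / (2 * n + 2)) = ENNReal.ofReal x := by
    intro x hx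
    rw [ENNReal.ofReal_rpow_of_nonneg (by positivity) (by positivity), ← rpow_mul hx]
    congr 1
    rw [show (2 + 2 / (n : ℝ)) * (n / (2 * n + 2)) = 1 by field_simp, rpow_one]
  have q2 : ENNReal.ofReal (A z ^ (n + 1)) ^ (1 / ((n : ℝ) + 1)) = ENNReal.ofReal (A z) := by
    rw [ENNReal.ofReal_rpow_of_nonneg (pow_nonneg (A0 z) _) (by positivity), ← rpow_natCast, ← rpow_mul (A0 z)]
    congr 1
    push_cast
    rw [show ((n : ℝ) + 1) * (1 / (n + 1)) = 1 by field_simp, rpow_one]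
  rw [q2, q _ (P0 z), q _ (R0 z), ENNReal.ofReal_mul (mul_nonneg (A0 z) (P0 z)), ENNReal.ofReal_mul (A0 z)]

end Heisenberg

namespace Heisenberg
open scoped ContDiff ENNReal

/-- the bad set, in the reduced variables -/
def Sset (n : ℕ) (l : ℝ) (F0 v0 : ℝ × ℝ → ℝ) : Set (ℝ × ℝ) := {z | 0 < F0 (Tinv z) ∧ 0 < dif l (kel n v0) z}

lemma Sset_meas {n : ℕ} {l : ℝ} {F0 v0 : ℝ × ℝ → ℝ} (hF0 : Continuous F0) (hv0 : Continuous v0) : MeasurableSet (Sset n l F0 v0) :=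
  (measurableSet_lt measurable_const (hF0.measurable.comp measurable_Tinv)).inter
    (measurableSet_lt measurable_const (measurable_dif (measurable_kel hv0.measurable)))

lemma refl_ne {l : ℝ} {z : ℝ × ℝ} (hz : z ∈ Qd l) : refl l z ≠ 0 := by
  intro h
  have h1 : (refl l z).1 = 0 := by rw [h]; rfl
  have hz1 : 0 < z.1 := hz.1
  exact hz1.ne' h1

lemma kel_bd {n : ℕ} {l : ℝ} (hl : 0 < l) {W : ℝ × ℝ → ℝ} {C0 : ℝ} (hC : ∀ z ∈ Dl l, |W z| ≤ C0) {z : ℝ × ℝ} (hz : l ≤ z.2) :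
    |kel n W z| ≤ C0 * mK n z := by
  unfold kel
  have hm := mK_pos (n := n) (ne_of_snd hl hz)
  rw [abs_mul, abs_of_pos hm, mul_comm]
  have := hC _ (Tinv_mem hl hz)
  gcongr

lemma mK_nonneg {n : ℕ} (z : ℝ × ℝ) : 0 ≤ mK n z := by unfold mK; positivity

lemma pos_bd {n : ℕ} {l : ℝ} (hl : 0 < l) {W : ℝ × ℝ → ℝ} (W0 : ∀ z, 0 < W z) {C0 : ℝ} (hC0 : 0 ≤ C0) (hC : ∀ z ∈ Dl l, |W z| ≤ C0) {z : ℝ × ℝ} (hz : l ≤ z.2) :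
    max (dif l (kel n W) z) 0 ≤ C0 * mK n z := by
  refine max_le ?_ (mul_nonneg hC0 (mK_nonneg _))
  refine le_trans ?_ (kel_bd (n := n) hl hC hz)
  refine le_trans ?_ (le_abs_self _)
  unfold dif
  have : 0 ≤ kel n W (refl l z) := mul_nonneg (mK_nonneg _) (W0 _).le
  linarith

theorem main2 {n : ℕ} (hn : 1 ≤ n) : ∃ S0 : ℝ, 0 < S0 ∧ ∀ (l : ℝ) (_ : 0 < l) (u v : H n → ℝ) (f : ℝ → ℝ) (_ : Continuous u)
    (_ : Continuous (fun ξ => f (v ξ)))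
    (_ : IsCylindrical u) (_ : IsWeakSol univ u (fun ξ => f (v ξ))) (u0 v0 : ℝ × ℝ → ℝ) (_ : Continuous u0) (_ : Continuous v0)
    (_ : Continuous (fun z => f (v0 z))) (_ : ∀ z, 0 < u0 z) (_ : ∀ z, 0 < v0 z)
    (_ : ∀ ξ, u ξ = u0 (piH ξ)) (_ : ∀ ξ, v ξ = v0 (piH ξ))
    (_ : ∀ s t : ℝ, 0 < s → s ≤ t → f s ≤ f t)
    (_ : ∀ s t : ℝ, 0 < s → s ≤ t → f t / t ^ tau n ≤ f s / s ^ tau n),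
    (∃ (h : ℕ → ℝ × ℝ → ℝ) (C : ℝ), (∀ j, ContDiff ℝ 1 (h j)) ∧ (∀ j, HasCompactSupport (h j)) ∧
      (∀ j z, 0 ≤ h j z) ∧ (∀ j s, h j (s, l) = 0) ∧
      (∀ z ∈ Qd l, Tendsto (fun j => h j z) atTop (𝓝 (max (dif l (kel n u0) z) 0))) ∧
      (∀ j, ∀ z ∈ Qd l, h j z ≤ C) ∧
      (∀ j, ∫ z in Qd l, z.1 ^ n * (pds (h j) z ^ 2 + pdt (h j) z ^ 2) ≤ C) ∧
      (∀ j, ∫ z in Qd l, z.1 ^ n * z.2 * (pds (h j) z ^ 2 + pdt (h j) z ^ 2) ≤ C)) ∧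
    (∫⁻ z, ENNReal.ofReal (max (dif l (kel n u0) z) 0 ^ (2 + 2 / (n : ℝ))) ∂(muQ n l)) ^ ((n : ℝ) / (2 * n + 2)) ≤
      ENNReal.ofReal (S0 * (tau n * Cst (fun z => f (v0 z) / v0 z) l)) *
      (∫⁻ z, ENNReal.ofReal ((Sset n l (fun z => f (v0 z)) v0).indicator (fun z => (na z)⁻¹) z ^ (n + 1)) ∂(muQ n l)) ^ (1 / ((n : ℝ) + 1)) *
      (∫⁻ z, ENNReal.ofReal (max (dif l (kel n v0) z) 0 ^ (2 + 2 / (n : ℝ))) ∂(muQ n l)) ^ ((n : ℝ) / (2 * n + 2)) := by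
  obtain ⟨S0, hS0, sob⟩ := sobolev hn
  refine ⟨S0, hS0, ?_⟩
  intro l hl u v f hu hF hcyl hsol u0 v0 hu0 hv0 hF0 u0p v0p eu ev hm ha
  have hn' : (0:ℝ) < n := by exact_mod_cast hn
  have hτ0 : 0 < tau n := by rw [tau_eq hn]; positivity
  obtain ⟨U, hUd⟩ : ∃ U, U = dif l (kel n u0) := ⟨_, rfl⟩
  obtain ⟨V, hVd⟩ : ∃ V, V = dif l (kel n v0) := ⟨_, rfl⟩
  obtain ⟨F0, hF0d⟩ : ∃ F0 : ℝ × ℝ → ℝ, F0 = fun z => f (v0 z) := ⟨_, rfl⟩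
  rw [← hF0d] at hF0 ⊢
  have hq : Continuous (fun z => f (v0 z) / v0 z) := by
    have : (fun z => f (v0 z) / v0 z) = fun z => F0 z / v0 z := by rw [hF0d]
    rw [this]; exact hF0.div hv0 (fun z => (v0p z).ne')
  obtain ⟨Cl, hCl⟩ : ∃ Cl, Cl = tau n * Cst (fun z => f (v0 z) / v0 z) l := ⟨_, rfl⟩
  have hClz : ∀ z ∈ Dl l, tau n * (f (v0 z) / v0 z) ≤ Cl := fun z hz => by
    rw [hCl]; exact mul_le_mul_of_nonneg_left (Cst_le hq hz) hτ0.le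
  have hCl0 : 0 ≤ Cl := by
    refine le_trans ?_ (hClz 0 (zero_mem_Dl l))
    have := f_nonneg hτ0 hm ha (v0p 0)
    have := v0p 0
    positivity
  rw [← hCl]
  have mU : Measurable U := by rw [hUd]; exact measurable_dif (measurable_kel hu0.measurable)
  have mV : Measurable V := by rw [hVd]; exact measurable_dif (measurable_kel hv0.measurable)
  have mS := Sset_meas (n := n) (l := l) hF0 hv0
  obtain ⟨A, hA⟩ : ∃ A, A = (Sset n l F0 v0).indicator (fun z => (na z)⁻¹) := ⟨_, rfl⟩
  have mA : Measurable A := by rw [hA]; exact (measurable_na.inv).indicator mS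
  have A0 : ∀ z, 0 ≤ A z := fun z => by rw [hA]; exact indicator_nonneg (fun z _ => inv_nonneg.2 (na_nonneg z)) z
  have A1 : ∀ z, A z ≤ (na z)⁻¹ := fun z => by
    rw [hA]; exact indicator_le_self' (fun z _ => inv_nonneg.2 (na_nonneg z)) z
  obtain ⟨Cu, hCu0, hCu⟩ := Dl_bound hu0 l
  obtain ⟨Cv, hCv0, hCv⟩ := Dl_bound hv0 l
  have bU : ∀ z ∈ Qd l, max (U z) 0 ≤ Cu * mK n z := fun z hz => by rw [hUd]; exact pos_bd hl u0p hCu0.le hCu (le_of_lt hz.2)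
  have bV : ∀ z ∈ Qd l, max (V z) 0 ≤ Cv * mK n z := fun z hz => by rw [hVd]; exact pos_bd hl v0p hCv0.le hCv (le_of_lt hz.2)
  obtain ⟨E, hE⟩ : ∃ E : ℝ × ℝ → ℝ, E = fun z => Cl * (A z * max (V z) 0) := ⟨_, rfl⟩
  have mE : Measurable E := by rw [hE]; exact (mA.mul (mV.max measurable_const)).const_mul _
  have E0 : ∀ z, 0 ≤ E z := fun z => by rw [hE]; exact mul_nonneg hCl0 (mul_nonneg (A0 z) (le_max_right _ _))
  have EU : ∀ z ∈ Qd l, z.1 ^ (n - 1) * E z * max (U z) 0 ≤ Cl * Cu * Cv * (z.1 ^ (n - 1) * mK n z ^ 2 * (na z)⁻¹) := by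
    intro z hz
    have hz1 : 0 < z.1 := hz.1
    have := bU z hz
    have := bV z hz
    have := A1 z
    have := A0 z
    have := inv_nonneg.2 (na_nonneg z)
    have := mK_nonneg (n := n) z
    rw [hE]
    calc z.1 ^ (n - 1) * (Cl * (A z * max (V z) 0)) * max (U z) 0 ≤ z.1 ^ (n - 1) * (Cl * ((na z)⁻¹ * (Cv * mK n z))) * (Cu * mK n z) := by
          gcongr
      _ = _ := by ring
  have pUE : ∀ z ∈ Qd l, 0 ≤ z.1 ^ (n - 1) * E z * max (U z) 0 := fun z hz =>
    mul_nonneg (mul_nonneg (pow_nonneg (le_of_lt hz.1) _) (E0 z)) (le_max_right _ _)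
  have mUE : Measurable (fun z : ℝ × ℝ => z.1 ^ (n - 1) * E z * max (U z) 0) :=
    ((measurable_fst.pow_const _).mul mE).mul (mU.max measurable_const)
  have hi0 : IntegrableOn (fun z => z.1 ^ (n - 1) * E z * max (U z) 0) (Qd l) := by
    refine int_dec hl (C := Cl * Cu * Cv * l⁻¹ ^ n) mUE fun z hz => ?_
    rw [abs_of_nonneg (pUE z hz), mul_assoc (Cl * Cu * Cv)]
    exact (EU z hz).trans (mul_le_mul_of_nonneg_left (dec_aux hn hl hz).2 (by positivity))
  have hi1 : IntegrableOn (fun z => z.1 ^ (n - 1) * E z * max (U z) 0 * z.2) (Qd l) := by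
    refine int_dec hl (C := Cl * Cu * Cv * l⁻¹ ^ (n - 1)) (mUE.mul measurable_snd) fun z hz => ?_
    have hz2 : 0 ≤ z.2 := hl.le.trans (le_of_lt hz.2)
    rw [abs_of_nonneg (mul_nonneg (pUE z hz) hz2)]
    refine (mul_le_mul_of_nonneg_right (EU z hz) hz2).trans ?_
    have := mul_le_mul_of_nonneg_left (dec_aux hn hl hz).1 (show 0 ≤ Cl * Cu * Cv by positivity)
    linarith
  obtain ⟨h, C, h1, h2, h3, h4, h5, h6, h7, h8⟩ := approxU hn hl (F := fun ξ => f (v ξ)) hu hF hcyl hsol hu0 hF0 eu (fun ξ => by rw [hF0d, ev]) hUd hCu0.le bU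
    (E := E) (fun z hz => by
      have hz2 : l < z.2 := hz.2
      have := ptwise hn hm ha (ne_of_snd hl hz2.le) (refl_ne hz) (by
        simp only [na, refl]; nlinarith) (v0p (Tinv z)) (v0p (Tinv (refl l z))) (hClz _ (Tinv_mem hl hz2.le))
      rw [hE, hA]
      have e : (if 0 < f (v0 (Tinv z)) ∧ 0 < mK n z * v0 (Tinv z) - mK n (refl l z) * v0 (Tinv (refl l z)) then (na z)⁻¹ else 0) = (Sset n l F0 v0).indicator (fun z => (na z)⁻¹) z := by
        classical
        rw [indicator_apply, hF0d]
        exact if_congr Iff.rfl rfl rfl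
      rw [e] at this
      rw [hF0d, hVd]
      rw [hF0d] at this
      exact this) (fun z _ => E0 z) hi0 hi1
  obtain ⟨M, hM⟩ : ∃ M, M = ∫ z in Qd l, z.1 ^ (n - 1) * E z * max (U z) 0 := ⟨_, rfl⟩
  rw [← hM] at h7
  have hM0 : 0 ≤ M := by rw [hM]; exact setIntegral_nonneg (Qd_meas l) pUE
  have hC0 : 0 ≤ C := le_trans (h3 0 (1, l + 1)) (h6 0 (1, l + 1) ⟨mem_Ioi.2 (by norm_num), mem_Ioi.2 (by simp)⟩)
  rw [← hUd, ← hVd, ← hA]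
  refine ⟨⟨h, max C (M + C), h1, h2, h3, h4, h5, fun j z hz => (h6 j z hz).trans (le_max_left _ _), fun j => (h7 j).trans ?_, fun j => (h8 j).trans (le_max_left _ _)⟩, ?_⟩
  · refine le_trans ?_ (le_max_right _ _)
    have : C / ((j : ℝ) + 1) ≤ C := div_le_self hC0 (by linarith [Nat.cast_nonneg (α := ℝ) j])
    linarith
  -- Fatou and Sobolev
  obtain ⟨NU, hNU⟩ : ∃ N, N = ∫⁻ z, ENNReal.ofReal (max (U z) 0 ^ (2 + 2 / (n : ℝ))) ∂(muQ n l) := ⟨_, rfl⟩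
  have hp0 : 0 ≤ 2 + 2 / (n : ℝ) := by positivity
  have fat : NU ^ ((n : ℝ) / (n + 1)) ≤ ENNReal.ofReal (S0 * M) := by
    have e1 : NU ≤ liminf (fun j => ∫⁻ z in Qd l, ENNReal.ofReal (z.1 ^ (n - 1)) * ENNReal.ofReal (h j z ^ (2 + 2 / (n : ℝ)))) atTop := by
      rw [hNU, muQ_lint ((mU.max measurable_const).pow_const _).ennreal_ofReal]
      refine le_trans (le_of_eq ?_) (lintegral_liminf_le (fun j => ?_))
      · refine setLIntegral_congr_fun (Qd_meas l) (fun z hz => ?_)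
        have : Tendsto (fun j => ENNReal.ofReal (z.1 ^ (n - 1)) * ENNReal.ofReal (h j z ^ (2 + 2 / (n : ℝ)))) atTop
            (𝓝 (ENNReal.ofReal (z.1 ^ (n - 1)) * ENNReal.ofReal (max (U z) 0 ^ (2 + 2 / (n : ℝ))))) := by
          refine ENNReal.Tendsto.const_mul (ENNReal.tendsto_ofReal ((h5 z hz).rpow_const (Or.inr hp0))) (Or.inr ENNReal.ofReal_ne_top)
        exact this.liminf_eq.symm
      · have := (h1 j).continuous.measurable
        exact (measurable_fst.pow_const _).ennreal_ofReal.mul (this.pow_const _).ennreal_ofReal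
    have e2 : ∀ j, ∫⁻ z in Qd l, ENNReal.ofReal (z.1 ^ (n - 1)) * ENNReal.ofReal (h j z ^ (2 + 2 / (n : ℝ))) ≤
        ENNReal.ofReal (S0 * (M + C / (j + 1))) ^ (((n : ℝ) + 1) / n) := by
      intro j
      have := sob l (h j) (h1 j) (h2 j) (h3 j)
      have t2 := this.trans (ENNReal.ofReal_le_ofReal (mul_le_mul_of_nonneg_left (h7 j) hS0.le))
      have t3 := ENNReal.rpow_le_rpow t2 (show 0 ≤ ((n : ℝ) + 1) / n by positivity)
      rwa [← ENNReal.rpow_mul, show (n : ℝ) / (n + 1) * ((n + 1) / n) = 1 by field_simp, ENNReal.rpow_one] at t3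
    have e3 : Tendsto (fun j : ℕ => ENNReal.ofReal (S0 * (M + C / (j + 1))) ^ (((n : ℝ) + 1) / n)) atTop
        (𝓝 (ENNReal.ofReal (S0 * M) ^ (((n : ℝ) + 1) / n))) := by
      have t : Tendsto (fun j : ℕ => S0 * (M + C * (1 / ((j:ℝ) + 1)))) atTop (𝓝 (S0 * (M + C * 0))) :=
        ((tendsto_one_div_add_atTop_nhds_zero_nat.const_mul C).const_add M).const_mul S0
      simp only [mul_one_div, mul_zero, add_zero] at t
      exact (ENNReal.continuous_rpow_const.tendsto _).comp (ENNReal.tendsto_ofReal t)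
    have e4 : NU ≤ ENNReal.ofReal (S0 * M) ^ (((n : ℝ) + 1) / n) := by
      refine e1.trans ?_
      rw [← e3.liminf_eq]
      exact liminf_le_liminf (Eventually.of_forall e2)
    have t3 := ENNReal.rpow_le_rpow e4 (show 0 ≤ (n : ℝ) / (n + 1) by positivity)
    rwa [← ENNReal.rpow_mul, show ((n : ℝ) + 1) / n * (n / (n + 1)) = 1 by field_simp, ENNReal.rpow_one] at t3
  have hol := holder3 (muQ n l) hn mA (mV.max measurable_const) (mU.max measurable_const) A0 (fun z => le_max_right _ _) (fun z => le_max_right _ _)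
  have eM : ENNReal.ofReal M = ENNReal.ofReal Cl * ∫⁻ z, ENNReal.ofReal (A z * max (V z) 0 * max (U z) 0) ∂(muQ n l) := by
    have mm : Measurable (fun z => ENNReal.ofReal (A z * max (V z) 0 * max (U z) 0)) :=
      ((mA.mul (mV.max measurable_const)).mul (mU.max measurable_const)).ennreal_ofReal
    have m2 : Measurable (fun z : ℝ × ℝ => ENNReal.ofReal (z.1 ^ (n - 1)) * ENNReal.ofReal (A z * max (V z) 0 * max (U z) 0)) :=
      (measurable_fst.pow_const _).ennreal_ofReal.mul mm
    rw [muQ_lint mm, ← lintegral_const_mul _ m2, hM,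
      ofReal_integral_eq_lintegral_ofReal hi0 ((ae_restrict_iff' (Qd_meas l)).2 (Eventually.of_forall pUE))]
    refine setLIntegral_congr_fun (Qd_meas l) (fun z hz => ?_)
    have hz1 : 0 < z.1 := hz.1
    rw [← ENNReal.ofReal_mul (by positivity), ← ENNReal.ofReal_mul hCl0, hE]
    congr 1; ring
  rw [← hNU] at hol ⊢
  have NUfin : NU ≠ ⊤ := by
    have := intN hn hl (mU.max measurable_const) hCu0.le (fun z hz => by rw [abs_of_nonneg (le_max_right _ _)]; exact bU z hz)
    have t := this.lintegral_lt_top.ne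
    rw [hNU, muQ_lint ((mU.max measurable_const).pow_const _).ennreal_ofReal]
    convert t using 1
    refine setLIntegral_congr_fun (Qd_meas l) (fun z hz => ?_)
    have hz1 : 0 < z.1 := hz.1
    rw [← ENNReal.ofReal_mul (by positivity), abs_of_nonneg (le_max_right _ _)]
  rcases eq_or_ne NU 0 with h0 | h0
  · rw [h0, ENNReal.zero_rpow_of_pos (by positivity)]; exact zero_le
  generalize (∫⁻ z, ENNReal.ofReal (A z ^ (n + 1)) ∂(muQ n l)) ^ (1 / ((n : ℝ) + 1)) = I at *
  generalize (∫⁻ z, ENNReal.ofReal (max (V z) 0 ^ (2 + 2 / (n : ℝ))) ∂(muQ n l)) ^ ((n : ℝ) / (2 * n + 2)) = NV at *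
  have hx0 : NU ^ ((n : ℝ) / (2 * n + 2)) ≠ 0 := by
    rw [Ne, ENNReal.rpow_eq_zero_iff]; push Not; exact ⟨fun h => absurd h h0, fun h => absurd h NUfin⟩
  have hx1 : NU ^ ((n : ℝ) / (2 * n + 2)) ≠ ⊤ := ENNReal.rpow_ne_top_of_nonneg (by positivity) NUfin
  have hsq : NU ^ ((n : ℝ) / (n + 1)) = NU ^ ((n : ℝ) / (2 * n + 2)) * NU ^ ((n : ℝ) / (2 * n + 2)) := by
    rw [← ENNReal.rpow_add _ _ h0 NUfin]; congr 1; field_simp; ring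
  rw [hsq] at fat
  generalize NU ^ ((n : ℝ) / (2 * n + 2)) = X at *
  have fin : X * X ≤ (ENNReal.ofReal (S0 * Cl) * I * NV) * X := by
    refine fat.trans ?_
    rw [ENNReal.ofReal_mul hS0.le, eM, ENNReal.ofReal_mul hS0.le]
    calc _ ≤ ENNReal.ofReal S0 * (ENNReal.ofReal Cl * (I * NV * X)) := by gcongr
      _ = _ := by ring
  exact (ENNReal.mul_le_mul_iff_left hx0 hx1).1 fin

end Heisenberg

namespace Heisenberg
open scoped ContDiff ENNReal

/-- profile of a cylindrical function -/
def prof {n : ℕ} (hn : 1 ≤ n) (u : H n → ℝ) (z : ℝ × ℝ) : ℝ := u (Pi.single (⟨0, hn⟩ : Fin n) (√z.1), 0, z.2)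

lemma prof_cont {n : ℕ} (hn : 1 ≤ n) {u : H n → ℝ} (hu : Continuous u) : Continuous (prof hn u) := by
  unfold prof
  refine hu.comp ?_
  refine Continuous.prodMk ?_ (Continuous.prodMk continuous_const continuous_snd)
  exact (continuous_single (A := fun _ : Fin n => ℝ) (⟨0, hn⟩ : Fin n)).comp (continuous_fst.sqrt)

lemma prof_eq {n : ℕ} (hn : 1 ≤ n) {u : H n → ℝ} (hc : IsCylindrical u) (ξ : H n) : u ξ = prof hn u (piH ξ) := by
  unfold prof
  apply hc
  · have : ∑ i, (Pi.single (⟨0, hn⟩ : Fin n) (√(rsq ξ)) : Fin n → ℝ) i ^ 2 = rsq ξ := by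
      rw [Finset.sum_eq_single (⟨0, hn⟩ : Fin n)]
      · simp [sq_sqrt (rsq_nonneg ξ)]
      · intro b _ hb; simp [hb]
      · simp
    show rsq ξ = ∑ i, (Pi.single (⟨0, hn⟩ : Fin n) (√(rsq ξ)) : Fin n → ℝ) i ^ 2 + ∑ i : Fin n, ((0 : Fin n → ℝ) i) ^ 2
    rw [this]; simp
  · rfl

lemma gauge_four {n : ℕ} (ξ : H n) : gaugeH ξ ^ 4 = na (piH ξ) := by
  have h : gaugeH ξ = na (piH ξ) ^ ((4 : ℝ)⁻¹) := rfl
  rw [h, ← rpow_natCast, ← rpow_mul (na_nonneg _)]; norm_num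

lemma gauge_nonneg {n : ℕ} (ξ : H n) : 0 ≤ gaugeH ξ := rpow_nonneg (na_nonneg (piH ξ)) _

lemma gauge_sq {n : ℕ} (ξ : H n) : gaugeH ξ ^ 2 = √(na (piH ξ)) := by
  rw [← gauge_four, show gaugeH ξ ^ 4 = (gaugeH ξ ^ 2) ^ 2 by ring, Real.sqrt_sq (by positivity)]

lemma gauge_2n {n : ℕ} (ξ : H n) : gaugeH ξ ^ (2 * n) = √(na (piH ξ)) ^ n := by
  rw [pow_mul, gauge_sq]

lemma gauge_4n {n : ℕ} (ξ : H n) : (gaugeH ξ ^ (4 * n + 4))⁻¹ = (na (piH ξ))⁻¹ ^ (n + 1) := by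
  rw [show 4 * n + 4 = 4 * (n + 1) by ring, pow_mul, gauge_four, inv_pow]

lemma piH_tilde {n : ℕ} (ξ : H n) : piH (tilde ξ) = Tinv (piH ξ) := by
  apply Prod.ext
  · show rsq (tilde ξ) = rsq ξ / na (piH ξ)
    unfold tilde
    rw [gauge_four]
    obtain ⟨N, hN⟩ : ∃ N, N = na (piH ξ) := ⟨_, rfl⟩
    have hN' : N = rsq ξ ^ 2 + ξ.2.2 ^ 2 := hN
    rw [← hN]
    have : rsq ((fun i => (ξ.1 i * ξ.2.2 + ξ.2.1 i * rsq ξ) / N, fun i => (ξ.2.1 i * ξ.2.2 - ξ.1 i * rsq ξ) / N, -ξ.2.2 / N) : H n) =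
        rsq ξ * N / N ^ 2 := by
      conv_rhs => rw [show rsq ξ * N / N ^ 2 = (∑ i, (ξ.1 i) ^ 2 + ∑ i, (ξ.2.1 i) ^ 2) * (N / N ^ 2) by unfold rsq; ring]
      show ∑ i, _ + ∑ i, _ = _
      rw [← Finset.sum_add_distrib, ← Finset.sum_add_distrib, Finset.sum_mul]
      refine Finset.sum_congr rfl fun i _ => ?_
      rw [show N / N ^ 2 = (rsq ξ ^ 2 + ξ.2.2 ^ 2) / N ^ 2 by rw [← hN']]
      simp only [div_pow]
      ring
    rw [this]
    rcases eq_or_ne N 0 with h | h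
    · simp [h]
    · field_simp
  · show -ξ.2.2 / gaugeH ξ ^ 4 = -ξ.2.2 / na (piH ξ)
    rw [gauge_four]

lemma crInv_eq {n : ℕ} {u : H n → ℝ} {u0 : ℝ × ℝ → ℝ} (eu : ∀ ξ, u ξ = u0 (piH ξ)) (ξ : H n) : crInv u ξ = kel n u0 (piH ξ) := by
  unfold crInv kel mK
  rw [eu, piH_tilde, gauge_2n, div_eq_inv_mul]

lemma piH_hRefl {n : ℕ} (l : ℝ) (ξ : H n) : piH (hRefl l ξ) = refl l (piH ξ) := by
  apply Prod.ext
  · show rsq (hRefl l ξ) = rsq ξ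
    unfold rsq hRefl; simp only; ring
  · rfl

lemma Ulam_eq {n : ℕ} {u : H n → ℝ} {u0 : ℝ × ℝ → ℝ} (eu : ∀ ξ, u ξ = u0 (piH ξ)) (l : ℝ) (ξ : H n) :
    Ulam u l ξ = dif l (kel n u0) (piH ξ) := by
  unfold Ulam dif
  rw [crInv_eq eu, crInv_eq eu, piH_hRefl]

lemma Sig_meas {n : ℕ} (l : ℝ) : MeasurableSet (Sig l : Set (H n)) := by
  have : Measurable fun ξ : H n => ξ.2.2 := by fun_prop
  exact measurableSet_lt measurable_const this

lemma Sig_lint {n : ℕ} (hn : 1 ≤ n) : ∃ c : ℝ, 0 < c ∧ ∀ (l : ℝ) (F : ℝ × ℝ → ℝ≥0∞), Measurable F →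
    ∫⁻ ξ in (Sig l : Set (H n)), F (piH ξ) = ENNReal.ofReal c * ∫⁻ z, F z ∂(muQ n l) := by
  obtain ⟨c, hc, h1, -⟩ := lintegral_piH hn
  refine ⟨c, hc, fun l F hF => ?_⟩
  have hS : MeasurableSet {z : ℝ × ℝ | l < z.2} := measurableSet_lt measurable_const measurable_snd
  rw [← lintegral_indicator (Sig_meas l), muQ_lint hF]
  have e : (fun ξ : H n => (Sig l).indicator (fun ξ => F (piH ξ)) ξ) = fun ξ => ({z : ℝ × ℝ | l < z.2}.indicator F) (piH ξ) := by
    ext ξ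
    simp only [indicator_apply]
    rfl
  rw [e, h1 _ (hF.indicator hS)]
  congr 1
  have e2 : Qd l = (Ioi (0:ℝ) ×ˢ univ) ∩ {z : ℝ × ℝ | l < z.2} := by
    ext z; simp [Qd, and_comm]
  rw [e2, inter_comm, ← Measure.restrict_restrict hS, ← lintegral_indicator hS]
  congr 1; ext z
  simp only [indicator_apply]
  split_ifs <;> simp

lemma Sig_int {n : ℕ} (hn : 1 ≤ n) {l : ℝ} {G : ℝ × ℝ → ℝ} (hG : Measurable G) (hi : IntegrableOn (fun z => z.1 ^ (n - 1) * G z) (Qd l)) :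
    IntegrableOn (fun ξ : H n => G (piH ξ)) (Sig l) := by
  obtain ⟨c, hc, h⟩ := Sig_lint hn
  refine ⟨(hG.comp continuous_piH.measurable).aestronglyMeasurable, ?_⟩
  unfold HasFiniteIntegral
  have := h l (fun z => ‖G z‖ₑ) hG.enorm
  rw [this, muQ_lint hG.enorm]
  refine ENNReal.mul_lt_top ENNReal.ofReal_lt_top ?_
  refine lt_of_le_of_lt (le_of_eq ?_) hi.2
  refine setLIntegral_congr_fun (Qd_meas l) (fun z hz => ?_)
  have hz1 : 0 < z.1 := hz.1
  simp only [enorm_mul]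
  congr 1
  rw [Real.enorm_of_nonneg (by positivity)]

lemma memLt {n : ℕ} (hn : 1 ≤ n) {l : ℝ} (hl : 0 < l) {W : ℝ × ℝ → ℝ} (hW : Measurable W) {C0 : ℝ} (hC0 : 0 ≤ C0)
    (h : ∀ z : ℝ × ℝ, l < z.2 → |W z| ≤ C0 * mK n z) {w : H n → ℝ} (hw : ∀ ξ, w ξ = W (piH ξ)) : MemLtau1Linf l w := by
  obtain rfl : w = fun ξ => W (piH ξ) := funext hw
  constructor
  · have : tau n + 1 = 2 + 2 / (n : ℝ) := by rw [tau_eq hn]; ring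
    rw [this]
    have mm : Measurable fun z => |W z| := hW.norm
    exact Sig_int hn (mm.pow_const _) (intN hn hl hW hC0 (fun z hz => h z hz.2))
  · refine ⟨C0 * l⁻¹ ^ n, fun ξ hξ => ?_⟩
    have hξ' : l < (piH ξ).2 := hξ
    exact (h _ hξ').trans (mul_le_mul_of_nonneg_left (mK_le hl hξ'.le) hC0)

end Heisenberg

namespace Heisenberg
open scoped ContDiff ENNReal

lemma muQ_fin {n : ℕ} {l : ℝ} {G : ℝ × ℝ → ℝ} (hG : Measurable G) (hG0 : ∀ z, 0 ≤ G z)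
    (hi : IntegrableOn (fun z => z.1 ^ (n - 1) * G z) (Qd l)) : ∫⁻ z, ENNReal.ofReal (G z) ∂(muQ n l) ≠ ⊤ := by
  rw [muQ_lint hG.ennreal_ofReal]
  have t := hi.lintegral_lt_top.ne
  convert t using 1
  refine setLIntegral_congr_fun (Qd_meas l) (fun z hz => ?_)
  have hz1 : 0 < z.1 := hz.1
  rw [← ENNReal.ofReal_mul (by positivity)]

theorem ineqH {n : ℕ} (hn : 1 ≤ n) : ∃ S1 : ℝ, 0 < S1 ∧ ∀ (l : ℝ) (_ : 0 < l) (u v : H n → ℝ) (f : ℝ → ℝ) (_ : Continuous u)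
    (_ : Continuous (fun ξ => f (v ξ)))
    (_ : IsCylindrical u) (_ : IsWeakSol univ u (fun ξ => f (v ξ))) (u0 v0 : ℝ × ℝ → ℝ) (_ : Continuous u0) (_ : Continuous v0)
    (_ : Continuous (fun z => f (v0 z))) (_ : ∀ z, 0 < u0 z) (_ : ∀ z, 0 < v0 z)
    (_ : ∀ ξ, u ξ = u0 (piH ξ)) (_ : ∀ ξ, v ξ = v0 (piH ξ))
    (_ : ∀ s t : ℝ, 0 < s → s ≤ t → f s ≤ f t)
    (_ : ∀ s t : ℝ, 0 < s → s ≤ t → f t / t ^ tau n ≤ f s / s ^ tau n),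
    (∃ (h : ℕ → ℝ × ℝ → ℝ) (C : ℝ), (∀ j, ContDiff ℝ 1 (h j)) ∧ (∀ j, HasCompactSupport (h j)) ∧
      (∀ j z, 0 ≤ h j z) ∧ (∀ j s, h j (s, l) = 0) ∧
      (∀ z ∈ Qd l, Tendsto (fun j => h j z) atTop (𝓝 (max (dif l (kel n u0) z) 0))) ∧
      (∀ j, ∀ z ∈ Qd l, h j z ≤ C) ∧
      (∀ j, ∫ z in Qd l, z.1 ^ n * (pds (h j) z ^ 2 + pdt (h j) z ^ 2) ≤ C) ∧
      (∀ j, ∫ z in Qd l, z.1 ^ n * z.2 * (pds (h j) z ^ 2 + pdt (h j) z ^ 2) ≤ C)) ∧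
     0 ≤ Cst (fun z => f (v0 z) / v0 z) l ∧
     ((∫ ξ in Sig l, max (Ulam u l ξ) 0 ^ ((4 * (n : ℝ) + 4) / (2 * n))) ^
            ((2 * (n : ℝ)) / (4 * n + 4)) ≤
          S1 * Cst (fun z => f (v0 z) / v0 z) l *
            (∫ ξ in {ξ : H n | ξ ∈ Sig l ∧ ξ ≠ zl l ∧
                0 < f (gaugeH ξ ^ (2 * n) * crInv v ξ) /
                    (gaugeH ξ ^ (2 * n) * crInv v ξ) ^ tau n ∧
                0 < Ulam v l ξ},
                (gaugeH ξ ^ (4 * n + 4))⁻¹) ^ ((2 : ℝ) / (2 * n + 2)) *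
            (∫ ξ in Sig l, max (Ulam v l ξ) 0 ^ ((4 * (n : ℝ) + 4) / (2 * n))) ^
              ((2 * (n : ℝ)) / (4 * n + 4))) := by
  obtain ⟨S0, hS0, main⟩ := main2 hn
  obtain ⟨c, hc, hSig⟩ := Sig_lint hn
  have hn' : (0:ℝ) < n := by exact_mod_cast hn
  have hτ0 : 0 < tau n := by rw [tau_eq hn]; positivity
  refine ⟨S0 * tau n * (c ^ (1 / ((n : ℝ) + 1)))⁻¹, by positivity, ?_⟩
  intro l hl u v f hu hF hcyl hsol u0 v0 hu0 hv0 hF0 u0p v0p eu ev hm ha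
  obtain ⟨hh, hmain⟩ := main l hl u v f hu hF hcyl hsol u0 v0 hu0 hv0 hF0 u0p v0p eu ev hm ha
  have hq : Continuous (fun z => f (v0 z) / v0 z) := hF0.div hv0 (fun z => (v0p z).ne')
  obtain ⟨K, hK⟩ : ∃ K, K = Cst (fun z => f (v0 z) / v0 z) l := ⟨_, rfl⟩
  rw [← hK] at hmain ⊢
  have hK0 : 0 ≤ K := by
    rw [hK]
    refine le_trans ?_ (Cst_le hq (zero_mem_Dl l))
    have := f_nonneg hτ0 hm ha (v0p 0)
    have := v0p 0
    positivity
  refine ⟨hh, hK0, ?_⟩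
  have mU : Measurable (dif l (kel n u0)) := measurable_dif (measurable_kel hu0.measurable)
  have mV : Measurable (dif l (kel n v0)) := measurable_dif (measurable_kel hv0.measurable)
  have mS := Sset_meas (n := n) (l := l) hF0 hv0
  -- integral conversion
  have cv : ∀ W : ℝ × ℝ → ℝ, Measurable W → (∀ z, 0 ≤ W z) → ∫ ξ in (Sig l : Set (H n)), W (piH ξ) = c * (∫⁻ z, ENNReal.ofReal (W z) ∂(muQ n l)).toReal := by
    intro W hW W0
    rw [integral_eq_lintegral_of_nonneg_ae (Eventually.of_forall fun ξ => W0 _) (hW.comp continuous_piH.measurable).aestronglyMeasurable]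
    rw [hSig l (fun z => ENNReal.ofReal (W z)) hW.ennreal_ofReal, ENNReal.toReal_mul, ENNReal.toReal_ofReal hc.le]
  have ex1 : (4 * (n : ℝ) + 4) / (2 * n) = 2 + 2 / (n : ℝ) := by field_simp; ring
  have ex2 : (2 * (n : ℝ)) / (4 * n + 4) = (n : ℝ) / (2 * n + 2) := by field_simp; ring
  have ex3 : (2 : ℝ) / (2 * n + 2) = 1 / ((n : ℝ) + 1) := by field_simp
  have finN : ∀ (w0 : ℝ × ℝ → ℝ), Continuous w0 → (∀ z, 0 < w0 z) →
      ∫⁻ z, ENNReal.ofReal (max (dif l (kel n w0) z) 0 ^ (2 + 2 / (n : ℝ))) ∂(muQ n l) ≠ ⊤ := by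
    intro w0 hw0 w0p
    have mW : Measurable (dif l (kel n w0)) := measurable_dif (measurable_kel hw0.measurable)
    obtain ⟨Cu, hCu0, hCu⟩ := Dl_bound hw0 l
    refine muQ_fin ((mW.max measurable_const).pow_const _) (fun z => rpow_nonneg (le_max_right _ _) _) ?_
    have := intN hn hl (mW.max measurable_const) hCu0.le (fun z hz => by
      rw [abs_of_nonneg (le_max_right _ _)]; exact pos_bd hl w0p hCu0.le hCu (le_of_lt hz.2))
    simpa only [abs_of_nonneg (le_max_right _ (0:ℝ))] using this
  have finI : ∫⁻ z, ENNReal.ofReal ((Sset n l (fun z => f (v0 z)) v0).indicator (fun z => (na z)⁻¹) z ^ (n + 1)) ∂(muQ n l) ≠ ⊤ := by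
    have mA : Measurable ((Sset n l (fun z => f (v0 z)) v0).indicator (fun z => (na z)⁻¹)) := (measurable_na.inv).indicator mS
    have A0 : ∀ z, 0 ≤ (Sset n l (fun z => f (v0 z)) v0).indicator (fun z => (na z)⁻¹) z := indicator_nonneg (fun z _ => inv_nonneg.2 (na_nonneg z))
    refine muQ_fin (mA.pow_const _) (fun z => pow_nonneg (A0 z) _) ?_
    refine int_dec hl (C := l⁻¹ ^ n) ((measurable_fst.pow_const _).mul (mA.pow_const _)) (fun z hz => ?_)
    have hz1 : 0 < z.1 := hz.1
    rw [abs_of_nonneg (mul_nonneg (by positivity) (pow_nonneg (A0 z) _))]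
    refine le_trans ?_ (dec_aux hn hl hz).2
    rw [mul_assoc]
    refine mul_le_mul_of_nonneg_left ?_ (by positivity)
    have : (Sset n l (fun z => f (v0 z)) v0).indicator (fun z => (na z)⁻¹) z ≤ (na z)⁻¹ :=
      indicator_le_self' (fun z _ => inv_nonneg.2 (na_nonneg z)) z
    refine (pow_le_pow_left₀ (A0 z) this _).trans (le_of_eq ?_)
    unfold mK
    rw [← inv_pow, ← pow_mul, mul_comm n 2, pow_mul, inv_pow (√(na z)) 2, sq_sqrt (na_nonneg z), pow_succ]
  have eI : ∫ ξ in {ξ : H n | ξ ∈ Sig l ∧ ξ ≠ zl l ∧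
                0 < f (gaugeH ξ ^ (2 * n) * crInv v ξ) /
                    (gaugeH ξ ^ (2 * n) * crInv v ξ) ^ tau n ∧
                0 < Ulam v l ξ}, (gaugeH ξ ^ (4 * n + 4))⁻¹ =
      ∫ ξ in (Sig l : Set (H n)), (Sset n l (fun z => f (v0 z)) v0).indicator (fun z => (na z)⁻¹) (piH ξ) ^ (n + 1) := by
    have s1 : ∀ ξ ∈ (Sig l : Set (H n)), (0 < f (gaugeH ξ ^ (2 * n) * crInv v ξ) / (gaugeH ξ ^ (2 * n) * crInv v ξ) ^ tau n ∧
        0 < Ulam v l ξ) ↔ piH ξ ∈ Sset n l (fun z => f (v0 z)) v0 := by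
      intro ξ hξ
      have hξ' : l < (piH ξ).2 := hξ
      have hne := ne_of_snd hl hξ'.le
      have hp : 0 < √(na (piH ξ)) ^ n := pow_pos (Real.sqrt_pos.2 (na_pos hne)) _
      have e1 : gaugeH ξ ^ (2 * n) * crInv v ξ = v0 (Tinv (piH ξ)) := by
        rw [crInv_eq ev, gauge_2n]; unfold kel mK; field_simp
      rw [e1, Ulam_eq ev, div_pos_iff_of_pos_right (rpow_pos_of_pos (v0p _) _)]
      rfl
    have s2 : ({ξ : H n | ξ ∈ Sig l ∧ ξ ≠ zl l ∧
                0 < f (gaugeH ξ ^ (2 * n) * crInv v ξ) /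
                    (gaugeH ξ ^ (2 * n) * crInv v ξ) ^ tau n ∧
                0 < Ulam v l ξ} : Set (H n)) = (Sig l ∩ piH ⁻¹' (Sset n l (fun z => f (v0 z)) v0)) \ {zl l} := by
      ext ξ
      constructor
      · rintro ⟨h1, h2, h3⟩
        exact ⟨⟨h1, (s1 ξ h1).1 h3⟩, h2⟩
      · rintro ⟨⟨h1, h3⟩, h2⟩
        exact ⟨h1, h2, (s1 ξ h1).2 h3⟩
    have hzl : volume ({zl l} : Set (H n)) = 0 := by
      have e : ({zl l} : Set (H n)) = {(0 : Fin n → ℝ)} ×ˢ (({(0 : Fin n → ℝ)} : Set (Fin n → ℝ)) ×ˢ ({2 * l} : Set ℝ)) := by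
        rw [singleton_prod_singleton, singleton_prod_singleton]; rfl
      rw [e, Measure.volume_eq_prod, Measure.prod_prod, Measure.volume_eq_prod, Measure.prod_prod]
      simp
    rw [s2, setIntegral_congr_set (sdiff_null_ae_eq_self hzl)]
    rw [inter_comm, ← Measure.restrict_restrict (continuous_piH.measurable mS), ← integral_indicator (continuous_piH.measurable mS)]
    refine integral_congr_ae (Eventually.of_forall fun ξ => ?_)
    show (piH ⁻¹' Sset n l (fun z => f (v0 z)) v0).indicator (fun x => (gaugeH x ^ (4 * n + 4))⁻¹) ξ = (Sset n l (fun z => f (v0 z)) v0).indicator (fun z => (na z)⁻¹) (piH ξ) ^ (n + 1)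
    by_cases h : piH ξ ∈ Sset n l (fun z => f (v0 z)) v0
    · rw [indicator_of_mem h]
      refine (indicator_of_mem (show ξ ∈ piH ⁻¹' Sset n l (fun z => f (v0 z)) v0 from h) _).trans (gauge_4n ξ)
    · rw [indicator_of_notMem h]
      refine (indicator_of_notMem (show ξ ∉ piH ⁻¹' Sset n l (fun z => f (v0 z)) v0 from h) _).trans ?_
      simp
  have mA : Measurable (fun z => (Sset n l (fun z => f (v0 z)) v0).indicator (fun z => (na z)⁻¹) z ^ (n + 1)) := ((measurable_na.inv).indicator mS).pow_const _
  rw [eI, ex1, ex2, ex3]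
  simp only [Ulam_eq eu, Ulam_eq ev]
  rw [cv (fun z => max (dif l (kel n u0) z) 0 ^ (2 + 2 / (n : ℝ))) ((mU.max measurable_const).pow_const _) (fun z => rpow_nonneg (le_max_right _ _) _),
    cv (fun z => max (dif l (kel n v0) z) 0 ^ (2 + 2 / (n : ℝ))) ((mV.max measurable_const).pow_const _) (fun z => rpow_nonneg (le_max_right _ _) _),
    cv (fun z => (Sset n l (fun z => f (v0 z)) v0).indicator (fun z => (na z)⁻¹) z ^ (n + 1)) mA
      (fun z => pow_nonneg (indicator_nonneg (fun z _ => inv_nonneg.2 (na_nonneg z)) z) _)]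
  have fV := finN v0 hv0 v0p
  generalize (∫⁻ z, ENNReal.ofReal (max (dif l (kel n u0) z) 0 ^ (2 + 2 / (n : ℝ))) ∂(muQ n l)) = NU at *
  generalize (∫⁻ z, ENNReal.ofReal (max (dif l (kel n v0) z) 0 ^ (2 + 2 / (n : ℝ))) ∂(muQ n l)) = NV at *
  generalize (∫⁻ z, ENNReal.ofReal ((Sset n l (fun z => f (v0 z)) v0).indicator (fun z => (na z)⁻¹) z ^ (n + 1)) ∂(muQ n l)) = I at *
  have t := ENNReal.toReal_mono (ENNReal.mul_ne_top (ENNReal.mul_ne_top ENNReal.ofReal_ne_top (ENNReal.rpow_ne_top_of_nonneg (by positivity) finI))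
    (ENNReal.rpow_ne_top_of_nonneg (by positivity) fV)) hmain
  rw [ENNReal.toReal_mul, ENNReal.toReal_mul, ENNReal.toReal_ofReal (by positivity), ← ENNReal.toReal_rpow, ← ENNReal.toReal_rpow, ← ENNReal.toReal_rpow] at t
  rw [mul_rpow hc.le ENNReal.toReal_nonneg, mul_rpow hc.le ENNReal.toReal_nonneg, mul_rpow hc.le ENNReal.toReal_nonneg]
  have hcp : 0 < c ^ (1 / ((n : ℝ) + 1)) := rpow_pos_of_pos hc _
  have hca : 0 < c ^ ((n : ℝ) / (2 * n + 2)) := rpow_pos_of_pos hc _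
  refine (mul_le_mul_of_nonneg_left t hca.le).trans (le_of_eq ?_)
  field_simp

end Heisenberg

namespace Heisenberg
open scoped ContDiff ENNReal

lemma weakL2 {α : Type*} [MeasurableSpace α] {μ : Measure α} {g : ℕ → α → ℝ} (hg : ∀ j, MemLp (g j) 2 μ) {K : ℝ}
    (hK : ∀ j, ∫ x, g j x ^ 2 ∂μ ≤ K) : ∃ G : α → ℝ, MemLp G 2 μ ∧ ∀ φ : α → ℝ, MemLp φ 2 μ → ∀ a : ℝ,
      Tendsto (fun j => ∫ x, g j x * φ x ∂μ) atTop (𝓝 a) → ∫ x, G x * φ x ∂μ = a := by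
  have inn : ∀ (a b : α → ℝ) (ha : MemLp a 2 μ) (hb : MemLp b 2 μ), inner ℝ (ha.toLp a) (hb.toLp b) = ∫ x, a x * b x ∂μ := by
    intro a b ha hb
    rw [L2.inner_def]
    refine integral_congr_ae ?_
    filter_upwards [ha.coeFn_toLp, hb.coeFn_toLp] with x h1 h2
    rw [h1, h2]; simp [mul_comm]
  have nb : ∀ j, ‖(hg j).toLp (g j)‖ ≤ √K := by
    intro j
    refine Real.le_sqrt_of_sq_le ?_
    rw [← real_inner_self_eq_norm_sq, inn]
    simpa [sq] using hK j
  obtain ⟨L, hL⟩ : ∃ L : ℕ → WeakDual ℝ (Lp ℝ 2 μ), L = fun j => StrongDual.toWeakDual (InnerProductSpace.toDual ℝ (Lp ℝ 2 μ) ((hg j).toLp (g j))) := ⟨_, rfl⟩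
  have hmem : ∀ j, L j ∈ (WeakDual.toStrongDual ⁻¹' Metric.closedBall (0 : StrongDual ℝ (Lp ℝ 2 μ)) (√K)) := by
    intro j
    rw [hL, mem_preimage, mem_closedBall_zero_iff]
    simpa using nb j
  obtain ⟨l, -, hl⟩ := (WeakDual.isCompact_closedBall (𝕜 := ℝ) (0 : StrongDual ℝ (Lp ℝ 2 μ)) (√K)).ultrafilter_le_nhds'
    ((hyperfilter ℕ).map L) (by
      rw [Ultrafilter.mem_map]; exact Filter.univ_mem' hmem)
  obtain ⟨G, hG⟩ : ∃ G : Lp ℝ 2 μ, G = (InnerProductSpace.toDual ℝ (Lp ℝ 2 μ)).symm (WeakDual.toStrongDual l) := ⟨_, rfl⟩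
  refine ⟨G, Lp.memLp G, fun φ hφ a ha => ?_⟩
  have h1 : Tendsto (fun j => L j (hφ.toLp φ)) (hyperfilter ℕ) (𝓝 (l (hφ.toLp φ))) :=
    ((WeakDual.eval_continuous (hφ.toLp φ)).tendsto l).comp hl
  have h2 : l (hφ.toLp φ) = ∫ x, G x * φ x ∂μ := by
    have e : l (hφ.toLp φ) = inner ℝ G (hφ.toLp φ) := by
      rw [hG, InnerProductSpace.toDual_symm_apply]; rfl
    rw [e]
    have := inn G φ (Lp.memLp G) hφ
    rwa [Lp.toLp_coeFn] at this
  have h3 : ∀ j, L j (hφ.toLp φ) = ∫ x, g j x * φ x ∂μ := by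
    intro j
    rw [← inn (g j) φ (hg j) hφ, hL]
    rfl
  simp only [h3] at h1
  rw [← h2]
  exact tendsto_nhds_unique h1 (ha.mono_left Nat.hyperfilter_le_atTop)

lemma int_fderiv_zero {n : ℕ} {Φ : H n → ℝ} (hΦ : ContDiff ℝ 1 Φ) (hc : HasCompactSupport Φ) (e : H n) :
    ∫ ξ, fderiv ℝ Φ ξ e = 0 := by
  have hi : Integrable (fun ξ => fderiv ℝ Φ ξ e) :=
    ((hΦ.continuous_fderiv (by simp)).clm_apply continuous_const).integrable_of_hasCompactSupport
      (hc.fderiv_apply (𝕜 := ℝ) e)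
  haveI : (volume : Measure ((Fin n → ℝ) × ℝ)).IsAddHaarMeasure := by
    rw [Measure.volume_eq_prod]; infer_instance
  haveI : (volume : Measure (H n)).IsAddHaarMeasure :=
    Measure.prod.instIsAddHaarMeasure (volume : Measure (Fin n → ℝ)) (volume : Measure ((Fin n → ℝ) × ℝ))
  have := integral_mul_fderiv_eq_neg_fderiv_mul_of_integrable (𝕜 := ℝ) (μ := (volume : Measure (H n))) (f := fun _ => (1:ℝ)) (g := Φ) (v := e)
    (by simp) (by simpa using hi)
    (by simpa using hΦ.continuous.integrable_of_hasCompactSupport hc) (fun _ _ => by fun_prop) (fun x _ => (hΦ.differentiable (by simp)) x)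
  simpa using this

def ek {n : ℕ} (k : Fin n ⊕ Fin n) : H n :=
  match k with
  | .inl i => (Pi.single i 1, 0, 0)
  | .inr i => (0, Pi.single i 1, 0)

lemma dirv_eq {n : ℕ} (k : Fin n ⊕ Fin n) (ξ : H n) : dirv k ξ = ek k + (2 * yk k ξ) • ((0, 0, 1) : H n) := by
  rcases k with i | i <;> simp [dirv, ek, yk]

lemma yk_t {n : ℕ} (k : Fin n ⊕ Fin n) (ξ : H n) : fderiv ℝ (yk k) ξ ((0, 0, 1) : H n) = 0 := by
  rcases k with k | k
  · change fderiv ℝ (fun ξ : H n => ξ.2.1 k) ξ _ = _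
    rw [(hasFDerivAt_yk k ξ).fderiv]
    simp
  · change fderiv ℝ (fun ξ : H n => -ξ.1 k) ξ _ = _
    rw [(hasFDerivAt_xk k ξ).fun_neg.fderiv]
    simp

lemma int_Dk_zero {n : ℕ} {Φ : H n → ℝ} (hΦ : ContDiff ℝ 1 Φ) (hc : HasCompactSupport Φ) (k : Fin n ⊕ Fin n) :
    ∫ ξ, Dk k Φ ξ = 0 := by
  have hy : ContDiff ℝ 1 (yk (n := n) k) := (contDiff_yk k).of_le (by simp)
  have hP : ContDiff ℝ 1 (fun ξ => yk k ξ * Φ ξ) := hy.mul hΦ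
  have hPc : HasCompactSupport (fun ξ => yk k ξ * Φ ξ) := hc.mul_left
  have e : ∀ ξ, Dk k Φ ξ = fderiv ℝ Φ ξ (ek k) + 2 * fderiv ℝ (fun ξ => yk k ξ * Φ ξ) ξ (0, 0, 1) := by
    intro ξ
    rw [fderiv_fun_mul ((hy.differentiable (by simp)) ξ) ((hΦ.differentiable (by simp)) ξ)]
    unfold Dk
    rw [dirv_eq, map_add, map_smul]
    simp only [_root_.add_apply, _root_.smul_apply, yk_t, smul_eq_mul]
    ring
  simp only [e]
  rw [integral_add, integral_const_mul, int_fderiv_zero hΦ hc, int_fderiv_zero hP hPc]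
  · simp
  · exact ((hΦ.continuous_fderiv (by simp)).clm_apply continuous_const).integrable_of_hasCompactSupport
      (hc.fderiv_apply (𝕜 := ℝ) _)
  · exact (((hP.continuous_fderiv (by simp)).clm_apply continuous_const).integrable_of_hasCompactSupport
      (hPc.fderiv_apply (𝕜 := ℝ) _)).const_mul 2

lemma Dk_ibp {n : ℕ} {ψ φ : H n → ℝ} (hψ : ContDiff ℝ 1 ψ) (hφ : ContDiff ℝ 1 φ) (hc : HasCompactSupport φ) (k : Fin n ⊕ Fin n) :
    ∫ ξ, ψ ξ * Dk k φ ξ = - ∫ ξ, Dk k ψ ξ * φ ξ := by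
  have h := int_Dk_zero (hψ.mul hφ) (hc.mul_left (f := ψ)) k
  have e : ∀ ξ, Dk k (fun ξ => ψ ξ * φ ξ) ξ = ψ ξ * Dk k φ ξ + Dk k ψ ξ * φ ξ := by
    intro ξ
    rw [Dk_mul k ((hψ.differentiable (by simp)) ξ) ((hφ.differentiable (by simp)) ξ)]; ring
  simp only [e] at h
  rw [integral_add] at h
  · linarith
  · exact (hψ.continuous.mul (continuous_Dk k hφ)).integrable_of_hasCompactSupport (hcs_Dk k hc).mul_left
  · exact ((continuous_Dk k hψ).mul hφ.continuous).integrable_of_hasCompactSupport hc.mul_left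

lemma contDiff_piH {n : ℕ} : ContDiff ℝ 1 (piH (n := n)) := by
  unfold piH
  exact (contDiff_rsq.of_le (by simp)).prodMk (by fun_prop)

lemma Dk_piH {n : ℕ} {h : ℝ × ℝ → ℝ} (hh : ContDiff ℝ 1 h) (k : Fin n ⊕ Fin n) (ξ : H n) :
    Dk k (fun ξ => h (piH ξ)) ξ = 2 * xk k ξ * pds h (piH ξ) + 2 * yk k ξ * pdt h (piH ξ) := by
  have h1 : HasFDerivAt (piH (n := n)) ((fderiv ℝ rsq ξ).prod (fderiv ℝ (fun ξ : H n => ξ.2.2) ξ)) ξ :=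
    (differentiable_rsq ξ).hasFDerivAt.prodMk (differentiable_t ξ).hasFDerivAt
  have h2 := ((hh.differentiable (by simp)) (piH ξ)).hasFDerivAt.comp ξ h1
  unfold Dk
  have e : (fun ξ => h (piH ξ)) = h ∘ (piH (n := n)) := rfl
  rw [e, h2.fderiv]
  have a1 := Dk_rsq k ξ
  have a2 := Dk_t k ξ
  unfold Dk at a1 a2
  simp only [ContinuousLinearMap.comp_apply, ContinuousLinearMap.prod_apply, a1, a2]
  have : ((2 * xk k ξ, 2 * yk k ξ) : ℝ × ℝ) = (2 * xk k ξ) • ((1, 0) : ℝ × ℝ) + (2 * yk k ξ) • ((0, 1) : ℝ × ℝ) := by simp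
  rw [this, map_add, map_smul, map_smul]
  rfl

lemma Dk_piH_sq {n : ℕ} {h : ℝ × ℝ → ℝ} (hh : ContDiff ℝ 1 h) (k : Fin n ⊕ Fin n) (ξ : H n) :
    Dk k (fun ξ => h (piH ξ)) ξ ^ 2 ≤ 8 * (rsq ξ * (pds h (piH ξ) ^ 2 + pdt h (piH ξ) ^ 2)) := by
  rw [Dk_piH hh]
  have h1 : xk k ξ ^ 2 ≤ rsq ξ := by
    rw [← sum_xk_sq]; exact Finset.single_le_sum (f := fun k => xk k ξ ^ 2) (fun i _ => sq_nonneg _) (Finset.mem_univ k)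
  have h2 : yk k ξ ^ 2 ≤ rsq ξ := by
    rw [← sum_yk_sq]; exact Finset.single_le_sum (f := fun k => yk k ξ ^ 2) (fun i _ => sq_nonneg _) (Finset.mem_univ k)
  nlinarith [sq_nonneg (2 * xk k ξ * pds h (piH ξ) - 2 * yk k ξ * pdt h (piH ξ)),
    mul_le_mul_of_nonneg_right h1 (sq_nonneg (pds h (piH ξ))), mul_le_mul_of_nonneg_right h2 (sq_nonneg (pdt h (piH ξ)))]

end Heisenberg

namespace Heisenberg
open scoped ContDiff ENNReal

lemma hcs_piH {n : ℕ} {h : ℝ × ℝ → ℝ} (hc : HasCompactSupport h) : HasCompactSupport (fun ξ : H n => h (piH ξ)) := by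
  obtain ⟨R, hR⟩ := hcs_bound hc
  have hK : IsCompact (Prod.snd '' tsupport h) := IsCompact.image hc continuous_snd
  refine HasCompactSupport.intro (compact_cyl (n := n) R hK) (fun ξ hξ => ?_)
  by_contra h0
  have hm : piH ξ ∈ tsupport h := subset_tsupport h h0
  refine hξ ⟨?_, ⟨piH ξ, hm, rfl⟩⟩
  by_contra hlt
  exact hR (piH ξ) (Or.inl (le_of_not_ge hlt)) hm

lemma rsq_pos_ae {n : ℕ} (hn : 1 ≤ n) : ∀ᵐ ξ : H n, 0 < rsq ξ := by
  haveI : Nonempty (Fin n) := ⟨⟨0, hn⟩⟩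
  have h0 : volume (({(0 : Fin n → ℝ)} : Set (Fin n → ℝ)) ×ˢ (univ : Set ((Fin n → ℝ) × ℝ))) = 0 := by
    rw [Measure.volume_eq_prod, Measure.prod_prod]
    simp
  rw [ae_iff]
  refine measure_mono_null (fun ξ hξ => ?_) h0
  have h1 : rsq ξ ≤ 0 := not_lt.1 hξ
  refine ⟨?_, mem_univ _⟩
  have h2 : ∑ i, (ξ.1 i) ^ 2 = 0 := by
    unfold rsq at h1
    have a : 0 ≤ ∑ i, (ξ.1 i) ^ 2 := Finset.sum_nonneg fun i _ => sq_nonneg _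
    have b : 0 ≤ ∑ i, (ξ.2.1 i) ^ 2 := Finset.sum_nonneg fun i _ => sq_nonneg _
    linarith
  rw [mem_singleton_iff]
  ext i
  have := (Finset.sum_eq_zero_iff_of_nonneg (fun i _ => sq_nonneg (ξ.1 i))).1 h2 i (Finset.mem_univ i)
  simpa using this

lemma grad_int {n : ℕ} (hn : 1 ≤ n) : ∃ c : ℝ, 0 < c ∧ ∀ (l : ℝ) (h : ℝ × ℝ → ℝ), ContDiff ℝ 1 h → HasCompactSupport h →
    ∀ k : Fin n ⊕ Fin n, ∫ ξ in Sig l, Dk k (fun ξ => h (piH ξ)) ξ ^ 2 ≤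
      c * ∫ z in Qd l, z.1 ^ n * (pds h z ^ 2 + pdt h z ^ 2) := by
  obtain ⟨c, hc, hS⟩ := Sig_lint hn
  refine ⟨8 * c, by positivity, fun l h hh hhc k => ?_⟩
  have cs := pds_cont' hh
  have ct := pdt_cont' hh
  have cps : HasCompactSupport (fun z => pds h z ^ 2 + pdt h z ^ 2) := by
    refine HasCompactSupport.intro hhc (fun z hz => ?_)
    have : fderiv ℝ h z = 0 := by
      by_contra h0
      exact hz (support_fderiv_subset ℝ h0)
    simp [pds, pdt, this]
  obtain ⟨F, hF⟩ : ∃ F : ℝ × ℝ → ℝ, F = fun z => 8 * (z.1 * (pds h z ^ 2 + pdt h z ^ 2)) := ⟨_, rfl⟩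
  have cF : Continuous F := by rw [hF]; fun_prop
  have hFc : HasCompactSupport F := by
    rw [hF]
    exact (cps.mul_left (f := fun z : ℝ × ℝ => z.1)).mul_left (f := fun _ : ℝ × ℝ => (8:ℝ))
  have F0 : ∀ ξ : H n, 0 ≤ F (piH ξ) := by
    intro ξ
    rw [hF]
    have : 0 ≤ (piH ξ).1 := rsq_nonneg ξ
    positivity
  have i1 : IntegrableOn (fun ξ : H n => F (piH ξ)) (Sig l) :=
    ((cF.comp continuous_piH).integrable_of_hasCompactSupport (hcs_piH hFc)).integrableOn
  have cD : ContDiff ℝ 1 (fun ξ : H n => h (piH ξ)) := hh.comp contDiff_piH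
  have i2 : IntegrableOn (fun ξ : H n => Dk k (fun ξ => h (piH ξ)) ξ ^ 2) (Sig l) := by
    refine (((continuous_Dk k cD).pow 2).integrable_of_hasCompactSupport ?_).integrableOn
    have := (hcs_Dk k (hcs_piH (n := n) hhc)).mul_left (f := Dk k (fun ξ : H n => h (piH ξ)))
    simpa only [sq] using this
  have s1 : ∫ ξ in Sig l, Dk k (fun ξ => h (piH ξ)) ξ ^ 2 ≤ ∫ ξ in (Sig l : Set (H n)), F (piH ξ) := by
    refine integral_mono i2 i1 (fun ξ => ?_)
    rw [hF]; exact Dk_piH_sq hh k ξ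
  refine s1.trans (le_of_eq ?_)
  rw [integral_eq_lintegral_of_nonneg_ae (Eventually.of_forall F0) i1.aestronglyMeasurable]
  rw [hS l (fun z => ENNReal.ofReal (F z)) cF.measurable.ennreal_ofReal, muQ_lint cF.measurable.ennreal_ofReal]
  have s2 : ∫⁻ z in Qd l, ENNReal.ofReal (z.1 ^ (n - 1)) * ENNReal.ofReal (F z) =
      ∫⁻ z in Qd l, ENNReal.ofReal (8 * (z.1 ^ n * (pds h z ^ 2 + pdt h z ^ 2))) := by
    refine setLIntegral_congr_fun (Qd_meas l) (fun z hz => ?_)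
    have hz1 : 0 < z.1 := hz.1
    have hp : z.1 ^ n = z.1 ^ (n - 1) * z.1 := by rw [← pow_succ, Nat.sub_add_cancel hn]
    beta_reduce
    rw [← ENNReal.ofReal_mul (by positivity), hF, hp]
    congr 1; ring
  have cG : Continuous (fun z : ℝ × ℝ => 8 * (z.1 ^ n * (pds h z ^ 2 + pdt h z ^ 2))) := by fun_prop
  rw [s2, ENNReal.toReal_mul, ENNReal.toReal_ofReal hc.le,
    ← integral_eq_lintegral_of_nonneg_ae ?_ cG.aestronglyMeasurable, integral_const_mul]
  · ring
  · refine (ae_restrict_mem (Qd_meas l)).mono (fun z hz => ?_)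
    have hz1 : 0 < z.1 := hz.1
    show 0 ≤ 8 * (z.1 ^ n * (pds h z ^ 2 + pdt h z ^ 2))
    positivity

lemma sq_int {n : ℕ} (hn : 1 ≤ n) {l : ℝ} (hl : 0 < l) {U : ℝ × ℝ → ℝ} (mU : Measurable U) {h : ℕ → ℝ × ℝ → ℝ} {C : ℝ}
    (h1 : ∀ j, ContDiff ℝ 1 (h j)) (h2 : ∀ j, HasCompactSupport (h j)) (h4 : ∀ j s, h j (s, l) = 0)
    (h5 : ∀ z ∈ Qd l, Tendsto (fun j => h j z) atTop (𝓝 (U z)))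
    (h8 : ∀ j, ∫ z in Qd l, z.1 ^ n * z.2 * (pds (h j) z ^ 2 + pdt (h j) z ^ 2) ≤ C) :
    IntegrableOn (fun ξ : H n => U (piH ξ) ^ 2) (Sig l) := by
  have m2 : Measurable (fun z => U z ^ 2) := mU.pow_const 2
  refine Sig_int hn m2 ?_
  have mP : Measurable (fun z : ℝ × ℝ => z.1 ^ (n - 1)) := by fun_prop
  refine ⟨(mP.mul m2).aestronglyMeasurable, ?_⟩
  have nn : ∀ᵐ z ∂(volume.restrict (Qd l)), 0 ≤ z.1 ^ (n - 1) * U z ^ 2 := by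
    refine (ae_restrict_mem (Qd_meas l)).mono (fun z hz => ?_)
    have hz1 : 0 < z.1 := hz.1
    positivity
  rw [hasFiniteIntegral_iff_ofReal nn]
  have e : ∫⁻ z in Qd l, ENNReal.ofReal (z.1 ^ (n - 1) * U z ^ 2) =
      ∫⁻ z in Qd l, liminf (fun j => ENNReal.ofReal (z.1 ^ (n - 1) * h j z ^ 2)) atTop := by
    refine setLIntegral_congr_fun (Qd_meas l) (fun z hz => ?_)
    refine (Tendsto.liminf_eq ?_).symm
    exact (ENNReal.continuous_ofReal.tendsto _).comp (((h5 z hz).pow 2).const_mul _)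
  rw [e]
  have hb : ∀ j, ∫⁻ z in Qd l, ENNReal.ofReal (z.1 ^ (n - 1) * h j z ^ 2) ≤ ENNReal.ofReal (8 * C) := by
    intro j
    have hc := (h1 j).continuous
    have ci : Continuous (fun z : ℝ × ℝ => z.1 ^ (n - 1) * h j z ^ 2) := by fun_prop
    have hcs : HasCompactSupport (fun z : ℝ × ℝ => z.1 ^ (n - 1) * h j z ^ 2) := by
      have := ((h2 j).mul_left (f := h j)).mul_left (f := fun z : ℝ × ℝ => z.1 ^ (n - 1))
      simp only [sq]; exact this
    rw [← ofReal_integral_eq_lintegral_ofReal (ci.integrable_of_hasCompactSupport hcs).integrableOn]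
    · refine ENNReal.ofReal_le_ofReal ((hardyW hn hl (h1 j) (h2 j) (h4 j)).trans ?_)
      have := h8 j
      linarith
    · refine (ae_restrict_mem (Qd_meas l)).mono (fun z hz => ?_)
      have hz1 : 0 < z.1 := hz.1
      show 0 ≤ z.1 ^ (n - 1) * h j z ^ 2
      positivity
  refine lt_of_le_of_lt (lintegral_liminf_le' (fun j => ?_)) (lt_of_le_of_lt (liminf_le_of_frequently_le' (Frequently.of_forall hb)) ENNReal.ofReal_lt_top)
  have hc := (h1 j).continuous
  have ci : Continuous (fun z : ℝ × ℝ => z.1 ^ (n - 1) * h j z ^ 2) := by fun_prop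
  exact ci.measurable.ennreal_ofReal.aemeasurable

lemma weak_comp {n : ℕ} (hn : 1 ≤ n) {l : ℝ} {U : ℝ × ℝ → ℝ} {h : ℕ → ℝ × ℝ → ℝ} {C : ℝ}
    (h1 : ∀ j, ContDiff ℝ 1 (h j)) (h2 : ∀ j, HasCompactSupport (h j)) (h3 : ∀ j z, 0 ≤ h j z)
    (h5 : ∀ z ∈ Qd l, Tendsto (fun j => h j z) atTop (𝓝 (U z)))
    (h6 : ∀ j, ∀ z ∈ Qd l, h j z ≤ C)
    (h7 : ∀ j, ∫ z in Qd l, z.1 ^ n * (pds (h j) z ^ 2 + pdt (h j) z ^ 2) ≤ C) (k : Fin n ⊕ Fin n) :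
    ∃ G : H n → ℝ, MemLp G 2 volume ∧ ∀ φ : H n → ℝ, IsTest (Sig l) φ →
      ∫ ξ, U (piH ξ) * Dk k φ ξ = - ∫ ξ, G ξ * φ ξ := by
  obtain ⟨c, hc, hgi⟩ := grad_int hn
  have cD : ∀ j, ContDiff ℝ 1 (fun ξ : H n => h j (piH ξ)) := fun j => (h1 j).comp contDiff_piH
  have hD : ∀ j, HasCompactSupport (Dk k (fun ξ : H n => h j (piH ξ))) := fun j => hcs_Dk k (hcs_piH (h2 j))
  obtain ⟨G, hG, hGφ⟩ := weakL2 (μ := (volume : Measure (H n)))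
    (g := fun j => (Sig l).indicator (Dk k (fun ξ : H n => h j (piH ξ))))
    (fun j => ((continuous_Dk k (cD j)).memLp_of_hasCompactSupport (hD j)).indicator (Sig_meas l)) (K := c * C) (by
      intro j
      have e : (fun ξ => (Sig l).indicator (Dk k (fun ξ : H n => h j (piH ξ))) ξ ^ 2) =
          (Sig l).indicator (fun ξ => Dk k (fun ξ : H n => h j (piH ξ)) ξ ^ 2) := by
        ext ξ
        by_cases hξ : ξ ∈ (Sig l : Set (H n))
        · rw [indicator_of_mem hξ, indicator_of_mem hξ]
        · rw [indicator_of_notMem hξ, indicator_of_notMem hξ]; simp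
      rw [e, integral_indicator (Sig_meas l)]
      exact (hgi l (h j) (h1 j) (h2 j) k).trans (mul_le_mul_of_nonneg_left (h7 j) hc.le))
  refine ⟨G, hG, fun φ hφ => ?_⟩
  have z0 : ∀ ξ, ξ ∉ (Sig l : Set (H n)) → φ ξ = 0 ∧ Dk k φ ξ = 0 := by
    intro ξ hξ
    have hn : ξ ∉ tsupport φ := fun h => hξ (hφ.supportSubset h)
    refine ⟨image_eq_zero_of_notMem_tsupport hn, ?_⟩
    have : fderiv ℝ φ ξ = 0 := by
      by_contra h0
      exact hn (support_fderiv_subset ℝ h0)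
    simp [Dk, this]
  have key := hGφ φ (hφ.contDiff.continuous.memLp_of_hasCompactSupport hφ.compactSupport) (- ∫ ξ, U (piH ξ) * Dk k φ ξ) (by
    have e : ∀ j, ∫ ξ, (Sig l).indicator (Dk k (fun ξ : H n => h j (piH ξ))) ξ * φ ξ = - ∫ ξ, h j (piH ξ) * Dk k φ ξ := by
      intro j
      rw [Dk_ibp (cD j) hφ.contDiff hφ.compactSupport, neg_neg]
      refine integral_congr_ae (Eventually.of_forall fun ξ => ?_)
      by_cases hξ : ξ ∈ (Sig l : Set (H n))
      · simp only [indicator_of_mem hξ]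
      · simp only [(z0 ξ hξ).1, mul_zero]
    simp only [e]
    refine Tendsto.neg ?_
    refine tendsto_integral_of_dominated_convergence (fun ξ => C * |Dk k φ ξ|) (fun j => ?_) ?_ (fun j => ?_) ?_
    · exact ((cD j).continuous.mul (continuous_Dk k hφ.contDiff)).aestronglyMeasurable
    · exact (((continuous_Dk k hφ.contDiff).integrable_of_hasCompactSupport (hcs_Dk k hφ.compactSupport)).abs).const_mul C
    · filter_upwards [rsq_pos_ae hn] with ξ hp
      by_cases hξ : ξ ∈ (Sig l : Set (H n))
      · have hm : piH ξ ∈ Qd l := ⟨mem_Ioi.2 hp, hξ⟩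
        rw [norm_mul, Real.norm_eq_abs, Real.norm_eq_abs, abs_of_nonneg (h3 j _)]
        exact mul_le_mul_of_nonneg_right (h6 j _ hm) (abs_nonneg _)
      · simp [(z0 ξ hξ).2]
    · filter_upwards [rsq_pos_ae hn] with ξ hp
      by_cases hξ : ξ ∈ (Sig l : Set (H n))
      · have hm : piH ξ ∈ Qd l := ⟨mem_Ioi.2 hp, hξ⟩
        exact (h5 _ hm).mul_const _
      · simp [(z0 ξ hξ).2])
  rw [key, neg_neg]

lemma memH1 {n : ℕ} (hn : 1 ≤ n) {l : ℝ} (hl : 0 < l) {U : ℝ × ℝ → ℝ} (mU : Measurable U)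
    (hh : ∃ (h : ℕ → ℝ × ℝ → ℝ) (C : ℝ), (∀ j, ContDiff ℝ 1 (h j)) ∧ (∀ j, HasCompactSupport (h j)) ∧
      (∀ j z, 0 ≤ h j z) ∧ (∀ j s, h j (s, l) = 0) ∧
      (∀ z ∈ Qd l, Tendsto (fun j => h j z) atTop (𝓝 (U z))) ∧
      (∀ j, ∀ z ∈ Qd l, h j z ≤ C) ∧
      (∀ j, ∫ z in Qd l, z.1 ^ n * (pds (h j) z ^ 2 + pdt (h j) z ^ 2) ≤ C) ∧
      (∀ j, ∫ z in Qd l, z.1 ^ n * z.2 * (pds (h j) z ^ 2 + pdt (h j) z ^ 2) ≤ C)) :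
    MemH1 (Sig l) (fun ξ : H n => U (piH ξ)) := by
  obtain ⟨h, C, h1, h2, h3, h4, h5, h6, h7, h8⟩ := hh
  refine ⟨sq_int hn hl mU h1 h2 h4 h5 h8, ?_⟩
  choose G hG hGφ using weak_comp hn h1 h2 h3 h5 h6 h7
  refine ⟨fun ξ => (fun i => G (.inl i) ξ, fun i => G (.inr i) ξ), ?_, fun i φ hφ => hGφ (.inl i) φ hφ, fun i φ hφ => hGφ (.inr i) φ hφ⟩
  have hi : Integrable (fun ξ => ∑ k, G k ξ ^ 2) := integrable_finsetSum _ (fun k _ => (hG k).integrable_sq)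
  refine Integrable.integrableOn (hi.mono' ?_ (Eventually.of_forall fun ξ => ?_))
  · have a1 : AEMeasurable (fun ξ => ((fun i => G (.inl i) ξ, fun i => G (.inr i) ξ) : (Fin n → ℝ) × (Fin n → ℝ))) volume :=
      (aemeasurable_pi_lambda _ fun i => (hG (.inl i)).aestronglyMeasurable.aemeasurable).prodMk
        (aemeasurable_pi_lambda _ fun i => (hG (.inr i)).aestronglyMeasurable.aemeasurable)
    exact (a1.norm.pow_const 2).aestronglyMeasurable
  · have hk : ∀ k, ‖G k ξ‖ ≤ √(∑ k, G k ξ ^ 2) := fun k => by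
      rw [Real.norm_eq_abs]
      exact Real.abs_le_sqrt (Finset.single_le_sum (f := fun k => G k ξ ^ 2) (fun i _ => sq_nonneg _) (Finset.mem_univ k))
    have hN : ‖((fun i => G (.inl i) ξ, fun i => G (.inr i) ξ) : (Fin n → ℝ) × (Fin n → ℝ))‖ ≤ √(∑ k, G k ξ ^ 2) := by
      rw [norm_prod_le_iff]
      exact ⟨(pi_norm_le_iff_of_nonneg (Real.sqrt_nonneg _)).2 fun i => hk _, (pi_norm_le_iff_of_nonneg (Real.sqrt_nonneg _)).2 fun i => hk _⟩
    rw [Real.norm_eq_abs, abs_of_nonneg (sq_nonneg _)]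
    calc _ ≤ √(∑ k, G k ξ ^ 2) ^ 2 := pow_le_pow_left₀ (norm_nonneg _) hN 2
      _ = _ := Real.sq_sqrt (Finset.sum_nonneg fun i _ => sq_nonneg _)

end Heisenberg

namespace Heisenberg

/-- **Lemma 3.2.** Under the assumptions of Theorem 1.1, for every fixed `λ > 0` one has
`ū, v̄ ∈ L^{τ+1}(Σ_λ) ∩ L^∞(Σ_λ)` and `U_λ⁺, V_λ⁺ ∈ L^{τ+1}(Σ_λ) ∩ L^∞(Σ_λ) ∩ H¹(Σ_λ)`,
and there is `C_λ > 0`, nonincreasing in `λ`, with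
`‖U_λ⁺‖_{L^{2Q/(Q−2)}(Σ_λ)} ≤ C_λ (∫_{Σ_λ^v} |ξ|_ℍ^{−2Q})^{2/Q} ‖V_λ⁺‖_{L^{2Q/(Q−2)}(Σ_λ)}`
and symmetrically, where `Σ_λ^v = {ξ ∈ Σ_λ∖{0_λ} : h(|ξ|_ℍ^{Q−2}v̄(ξ)) > 0, V_λ(ξ) > 0}`
and `Σ_λ^u = {ξ ∈ Σ_λ∖{0_λ} : k(|ξ|_ℍ^{Q−2}ū(ξ)) > 0, U_λ(ξ) > 0}`, with
`h(t) = f(t)/t^τ`, `k(t) = g(t)/t^τ`, `τ = (Q+2)/(Q−2)`, `Q = 2n+2`. -/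
theorem integral_inequality_lemma (n : ℕ) (hn : 1 ≤ n)
    (u v : H n → ℝ) (f g : ℝ → ℝ)
    (hu_cont : Continuous u) (hv_cont : Continuous v)
    (hu_pos : ∀ ξ, 0 < u ξ) (hv_pos : ∀ ξ, 0 < v ξ)
    (hu_cyl : IsCylindrical u) (hv_cyl : IsCylindrical v)
    (hu_sol : IsWeakSol Set.univ u (fun ξ => f (v ξ)))
    (hv_sol : IsWeakSol Set.univ v (fun ξ => g (u ξ)))
    (hf_cont : ContinuousOn f (Set.Ici 0))
    (hg_cont : ContinuousOn g (Set.Ici 0))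
    (hf_mono : ∀ s t : ℝ, 0 < s → s ≤ t → f s ≤ f t)
    (hg_mono : ∀ s t : ℝ, 0 < s → s ≤ t → g s ≤ g t)
    (hh_anti : ∀ s t : ℝ, 0 < s → s ≤ t → f t / t ^ tau n ≤ f s / s ^ tau n)
    (hk_anti : ∀ s t : ℝ, 0 < s → s ≤ t → g t / t ^ tau n ≤ g s / s ^ tau n) :
    ∃ C : ℝ → ℝ, (∀ l : ℝ, 0 < l → 0 < C l) ∧
      (∀ l m : ℝ, 0 < l → l ≤ m → C m ≤ C l) ∧
      ∀ l : ℝ, 0 < l →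
        MemLtau1Linf l (crInv u) ∧ MemLtau1Linf l (crInv v) ∧
        MemLtau1Linf l (fun ξ => max (Ulam u l ξ) 0) ∧
        MemLtau1Linf l (fun ξ => max (Ulam v l ξ) 0) ∧
        MemH1 (Sig l) (fun ξ => max (Ulam u l ξ) 0) ∧
        MemH1 (Sig l) (fun ξ => max (Ulam v l ξ) 0) ∧
        ((∫ ξ in Sig l, max (Ulam u l ξ) 0 ^ ((4 * (n : ℝ) + 4) / (2 * n))) ^
            ((2 * (n : ℝ)) / (4 * n + 4)) ≤
          C l *
            (∫ ξ in {ξ : H n | ξ ∈ Sig l ∧ ξ ≠ zl l ∧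
                0 < f (gaugeH ξ ^ (2 * n) * crInv v ξ) /
                    (gaugeH ξ ^ (2 * n) * crInv v ξ) ^ tau n ∧
                0 < Ulam v l ξ},
                (gaugeH ξ ^ (4 * n + 4))⁻¹) ^ ((2 : ℝ) / (2 * n + 2)) *
            (∫ ξ in Sig l, max (Ulam v l ξ) 0 ^ ((4 * (n : ℝ) + 4) / (2 * n))) ^
              ((2 * (n : ℝ)) / (4 * n + 4))) ∧
        ((∫ ξ in Sig l, max (Ulam v l ξ) 0 ^ ((4 * (n : ℝ) + 4) / (2 * n))) ^
            ((2 * (n : ℝ)) / (4 * n + 4)) ≤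
          C l *
            (∫ ξ in {ξ : H n | ξ ∈ Sig l ∧ ξ ≠ zl l ∧
                0 < g (gaugeH ξ ^ (2 * n) * crInv u ξ) /
                    (gaugeH ξ ^ (2 * n) * crInv u ξ) ^ tau n ∧
                0 < Ulam u l ξ},
                (gaugeH ξ ^ (4 * n + 4))⁻¹) ^ ((2 : ℝ) / (2 * n + 2)) *
            (∫ ξ in Sig l, max (Ulam u l ξ) 0 ^ ((4 * (n : ℝ) + 4) / (2 * n))) ^
              ((2 * (n : ℝ)) / (4 * n + 4))) := by
  obtain ⟨S1, hS1, main⟩ := ineqH hn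
  obtain ⟨u0, hu0⟩ : ∃ u0, u0 = prof hn u := ⟨_, rfl⟩
  obtain ⟨v0, hv0⟩ : ∃ v0, v0 = prof hn v := ⟨_, rfl⟩
  have cu : Continuous u0 := hu0 ▸ prof_cont hn hu_cont
  have cv : Continuous v0 := hv0 ▸ prof_cont hn hv_cont
  have eu : ∀ ξ, u ξ = u0 (piH ξ) := hu0 ▸ prof_eq hn hu_cyl
  have ev : ∀ ξ, v ξ = v0 (piH ξ) := hv0 ▸ prof_eq hn hv_cyl
  have pu : ∀ z, 0 < u0 z := fun z => by rw [hu0]; exact hu_pos _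
  have pv : ∀ z, 0 < v0 z := fun z => by rw [hv0]; exact hv_pos _
  have fv : Continuous (fun ξ => f (v ξ)) := hf_cont.comp_continuous hv_cont (fun ξ => (hv_pos ξ).le)
  have gu : Continuous (fun ξ => g (u ξ)) := hg_cont.comp_continuous hu_cont (fun ξ => (hu_pos ξ).le)
  have fv0 : Continuous (fun z => f (v0 z)) := hf_cont.comp_continuous cv (fun z => (pv z).le)
  have gu0 : Continuous (fun z => g (u0 z)) := hg_cont.comp_continuous cu (fun z => (pu z).le)
  have qf : Continuous (fun z => f (v0 z) / v0 z) := fv0.div cv (fun z => (pv z).ne')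
  have qg : Continuous (fun z => g (u0 z) / u0 z) := gu0.div cu (fun z => (pu z).ne')
  have Mu : ∀ l : ℝ, 0 < l → _ := fun l hl => main l hl u v f hu_cont fv hu_cyl hu_sol u0 v0 cu cv fv0 pu pv eu ev hf_mono hh_anti
  have Mv : ∀ l : ℝ, 0 < l → _ := fun l hl => main l hl v u g hv_cont gu hv_cyl hv_sol v0 u0 cv cu gu0 pv pu ev eu hg_mono hk_anti
  refine ⟨fun l => S1 * (Cst (fun z => f (v0 z) / v0 z) l + Cst (fun z => g (u0 z) / u0 z) l) + 1, fun l hl => ?_, fun l m hl hlm => ?_, fun l hl => ?_⟩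
  · have a := (Mu l hl).2.1
    have b := (Mv l hl).2.1
    positivity
  · have a := Cst_anti qf hl hlm
    have b := Cst_anti qg hl hlm
    have := mul_le_mul_of_nonneg_left (add_le_add a b) hS1.le
    linarith
  · obtain ⟨hu1, hu2, hu3⟩ := Mu l hl
    obtain ⟨hv1, hv2, hv3⟩ := Mv l hl
    obtain ⟨Cu, Cu0, hCu⟩ := Dl_bound cu l
    obtain ⟨Cv, Cv0, hCv⟩ := Dl_bound cv l
    have mku : Measurable (kel n u0) := measurable_kel cu.measurable
    have mkv : Measurable (kel n v0) := measurable_kel cv.measurable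
    have mU : Measurable (fun z => max (dif l (kel n u0) z) 0) := (measurable_dif mku).max measurable_const
    have mV : Measurable (fun z => max (dif l (kel n v0) z) 0) := (measurable_dif mkv).max measurable_const
    have eU : (fun ξ => max (Ulam u l ξ) 0) = fun ξ : H n => max (dif l (kel n u0) (piH ξ)) 0 := by
      ext ξ; rw [Ulam_eq eu]
    have eV : (fun ξ => max (Ulam v l ξ) 0) = fun ξ : H n => max (dif l (kel n v0) (piH ξ)) 0 := by
      ext ξ; rw [Ulam_eq ev]
    have I0 : ∀ w : H n → ℝ, 0 ≤ (∫ ξ in Sig l, max (Ulam w l ξ) 0 ^ ((4 * (n : ℝ) + 4) / (2 * n))) ^ ((2 * (n : ℝ)) / (4 * n + 4)) :=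
      fun w => rpow_nonneg (integral_nonneg fun ξ => rpow_nonneg (le_max_right _ _) _) _
    have J0 : ∀ s : Set (H n), 0 ≤ (∫ ξ in s, (gaugeH ξ ^ (4 * n + 4))⁻¹) ^ ((2 : ℝ) / (2 * n + 2)) := by
      intro s
      refine rpow_nonneg (integral_nonneg fun ξ => ?_) _
      have : 0 ≤ gaugeH ξ := by unfold gaugeH; positivity
      show 0 ≤ (gaugeH ξ ^ (4 * n + 4))⁻¹
      positivity
    refine ⟨memLt hn hl mku Cu0.le (fun z hz => kel_bd hl hCu hz.le) (crInv_eq eu),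
      memLt hn hl mkv Cv0.le (fun z hz => kel_bd hl hCv hz.le) (crInv_eq ev),
      memLt hn hl mU Cu0.le (fun z hz => ?_) (fun ξ => congrFun eU ξ),
      memLt hn hl mV Cv0.le (fun z hz => ?_) (fun ξ => congrFun eV ξ), ?_, ?_, ?_, ?_⟩
    · rw [abs_of_nonneg (le_max_right _ _)]; exact pos_bd hl pu Cu0.le hCu hz.le
    · rw [abs_of_nonneg (le_max_right _ _)]; exact pos_bd hl pv Cv0.le hCv hz.le
    · rw [eU]; exact memH1 hn hl mU hu1
    · rw [eV]; exact memH1 hn hl mV hv1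
    · refine hu3.trans (mul_le_mul_of_nonneg_right (mul_le_mul_of_nonneg_right ?_ (J0 _)) (I0 v))
      have := mul_nonneg hS1.le hv2
      beta_reduce; rw [mul_add]; linarith
    · refine hv3.trans (mul_le_mul_of_nonneg_right (mul_le_mul_of_nonneg_right ?_ (J0 _)) (I0 u))
      have := mul_nonneg hS1.le hu2
      beta_reduce; rw [mul_add]; linarith

end Heisenberg
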